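/- Let F be a finite simple graph with e(F) > 0 and m = |F| vertices, let 0 < p ≤ 1, let r ≥ m be an integer, and let α_1,…,α_r be positive reals with Σ_{i=1}^r α_i ≤ 1. Consider the property P̃(F;α_1,…,α_r) of sequences (G_n) with |G_n| → ∞: Σ_{1≤i_1<⋯<i_m≤r} Ñ(F,G_n;U_{i_1},…,U_{i_m}) = p^{e(F)} Σ_{1≤i_1<⋯<i_m≤r} ∏_{j=1}^m |U_{i_j}| + o(|G_n|^m), uniformly over all pairwise disjoint U_1,…,U_r ⊆ V(G_n) with |U_i| = ⌊α_i|G_n|⌋. If either (α_1,…,α_r) ≠ (1/r,…,1/r), or e(F) > 1 and F is a regular graph, a star, or disconnected, then this property is a p-quasi-random property. -/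

import Mathlib

open Filter Finset Asymptotics MeasureTheory

/-- `labCount F G U` is the number of injective graph homomorphisms `φ : F → G`
with `φ i ∈ U i` for every vertex `i` of `F` (the quantity `N(F,G;U₁,…,U_m)`). -/
noncomputable def labCount {m : ℕ} {β : Type} [Fintype β]
    (F : SimpleGraph (Fin m)) (G : SimpleGraph β) (U : Fin m → Finset β) : ℕ :=
  Nat.card {φ : Fin m → β //
    Function.Injective φ ∧ (∀ i j, F.Adj i j → G.Adj (φ i) (φ j)) ∧ ∀ i, φ i ∈ U i}

/-- `totalCount F G` is the total number of injective graph homomorphisms `F → G`,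
the quantity `N(F,G)`. -/
noncomputable def totalCount {m : ℕ} {β : Type} [Fintype β]
    (F : SimpleGraph (Fin m)) (G : SimpleGraph β) : ℕ :=
  Nat.card {φ : Fin m → β //
    Function.Injective φ ∧ ∀ i j, F.Adj i j → G.Adj (φ i) (φ j)}

/-- `symCount F G U` is `Ñ(F,G;U₁,…,U_m) = (1/m!) ∑_σ N(F,G;U_{σ(1)},…,U_{σ(m)})`. -/
noncomputable def symCount {m : ℕ} {β : Type} [Fintype β]
    (F : SimpleGraph (Fin m)) (G : SimpleGraph β) (U : Fin m → Finset β) : ℝ :=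
  ((m.factorial : ℝ))⁻¹ * ∑ σ : Equiv.Perm (Fin m), (labCount F G (fun i => U (σ i)) : ℝ)

/-- `numEdges F` is `e(F)`, the number of edges of `F`. -/
noncomputable def numEdges {m : ℕ} (F : SimpleGraph (Fin m)) : ℕ := Nat.card F.edgeSet

/-- A sequence of graphs `G n` on vertex sets `Fin (V n)` is `p`-quasi-random if, for every
finite simple graph `F`, `N(F,G_n) = p^(e F) |G_n|^(|F|) + o(|G_n|^(|F|))`. -/
def IsQuasirandom (p : ℝ) (V : ℕ → ℕ) (G : ∀ n, SimpleGraph (Fin (V n))) : Prop :=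
  ∀ (m : ℕ) (F : SimpleGraph (Fin m)),
    (fun n => (totalCount F (G n) : ℝ) - p ^ numEdges F * (V n : ℝ) ^ m)
      =o[atTop] (fun n => (V n : ℝ) ^ m)

/-- The property `P(F;α₁,…,α_m)`: `N(F,G_n;U₁,…,U_m) = p^(e F) ∏ |U_i| + o(|G_n|^m)`,
uniformly over all pairwise disjoint `U₁,…,U_m ⊆ V(G_n)` with `|U_i| = ⌊α_i |G_n|⌋`. -/
def SatisfiesP {m : ℕ} (F : SimpleGraph (Fin m)) (p : ℝ) (α : Fin m → ℝ)
    (V : ℕ → ℕ) (G : ∀ n, SimpleGraph (Fin (V n))) : Prop :=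
  ∃ ε : ℕ → ℝ, Tendsto ε atTop (nhds 0) ∧
    ∀ (n : ℕ) (U : Fin m → Finset (Fin (V n))),
      Pairwise (fun i j => Disjoint (U i) (U j)) →
      (∀ i, (U i).card = ⌊α i * (V n : ℝ)⌋₊) →
      |(labCount F (G n) U : ℝ) - p ^ numEdges F * ∏ i, ((U i).card : ℝ)|
        ≤ ε n * (V n : ℝ) ^ m

/-- The property `P̃(F;α₁,…,α_m)`: as `SatisfiesP` but with the symmetrized count `Ñ`. -/
def SatisfiesPt {m : ℕ} (F : SimpleGraph (Fin m)) (p : ℝ) (α : Fin m → ℝ)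
    (V : ℕ → ℕ) (G : ∀ n, SimpleGraph (Fin (V n))) : Prop :=
  ∃ ε : ℕ → ℝ, Tendsto ε atTop (nhds 0) ∧
    ∀ (n : ℕ) (U : Fin m → Finset (Fin (V n))),
      Pairwise (fun i j => Disjoint (U i) (U j)) →
      (∀ i, (U i).card = ⌊α i * (V n : ℝ)⌋₊) →
      |symCount F (G n) U - p ^ numEdges F * ∏ i, ((U i).card : ℝ)|
        ≤ ε n * (V n : ℝ) ^ m

/-- The property `Pᵘ(F;α₁,…,α_m)`: `P` holds for every labelling of `F`. -/
def SatisfiesPu {m : ℕ} (F : SimpleGraph (Fin m)) (p : ℝ) (α : Fin m → ℝ)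
    (V : ℕ → ℕ) (G : ∀ n, SimpleGraph (Fin (V n))) : Prop :=
  ∀ σ : Equiv.Perm (Fin m), SatisfiesP (SimpleGraph.map σ.toEmbedding F) p α V G


/-- The property `P̃(F;α₁,…,α_r)` with `r ≥ m` parts:
`∑_{i₁<⋯<i_m} Ñ(F,G_n;U_{i₁},…,U_{i_m}) = p^(e F) ∑_{i₁<⋯<i_m} ∏_j |U_{i_j}| + o(|G_n|^m)`
uniformly over all pairwise disjoint `U₁,…,U_r` with `|U_i| = ⌊α_i |G_n|⌋`. -/
def SatisfiesPr {m r : ℕ} (F : SimpleGraph (Fin m)) (p : ℝ) (α : Fin r → ℝ)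
    (V : ℕ → ℕ) (G : ∀ n, SimpleGraph (Fin (V n))) : Prop :=
  ∃ ε : ℕ → ℝ, Tendsto ε atTop (nhds 0) ∧
    ∀ (n : ℕ) (U : Fin r → Finset (Fin (V n))),
      Pairwise (fun i j => Disjoint (U i) (U j)) →
      (∀ i, (U i).card = ⌊α i * (V n : ℝ)⌋₊) →
      |(∑ s : Finset (Fin r), if h : s.card = m then
            symCount F (G n) (fun j => U (s.orderEmbOfFin h j)) else 0)
        - p ^ numEdges F *
          ∑ s : Finset (Fin r), if s.card = m then ∏ i ∈ s, ((U i).card : ℝ) else 0|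
        ≤ ε n * (V n : ℝ) ^ m

/-- `F` is a regular graph. -/
def IsRegularGraph {m : ℕ} (F : SimpleGraph (Fin m)) : Prop :=
  ∀ v w : Fin m, Nat.card (F.neighborSet v) = Nat.card (F.neighborSet w)

/-- `F` is a star. -/
def IsStar {m : ℕ} (F : SimpleGraph (Fin m)) : Prop :=
  ∃ c : Fin m, ∀ i j, F.Adj i j ↔ (i = c ∨ j = c) ∧ i ≠ j

open Classical in
/-- The `0`-`1` adjacency indicator of a graph. -/
noncomputable def adjInd {β : Type*} (G : SimpleGraph β) (x y : β) : ℝ :=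
  if G.Adj x y then 1 else 0

/-- The product of the weights `W (x i) (x j)` over the pairs `(i, j) ∈ E`. -/
noncomputable def edgeProd {ι β : Type*} (W : β → β → ℝ) (E : Finset (ι × ι)) (x : ι → β) : ℝ :=
  ∏ e ∈ E, W (x e.1) (x e.2)

open Classical in
/-- The edges of `F`, as pairs `(i, j)` with `i < j`. -/
noncomputable def orderedEdges {m : ℕ} (F : SimpleGraph (Fin m)) : Finset (Fin m × Fin m) :=
  univ.filter fun e => e.1 < e.2 ∧ F.Adj e.1 e.2

lemma orderedEdges_lt {m : ℕ} {F : SimpleGraph (Fin m)} {e : Fin m × Fin m}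
    (he : e ∈ orderedEdges F) : e.1 < e.2 := by
  classical
  exact (by simpa [orderedEdges] using he : e.1 < e.2 ∧ F.Adj e.1 e.2).1

lemma card_orderedEdges {m : ℕ} (F : SimpleGraph (Fin m)) :
    (orderedEdges F).card = numEdges F := by
  classical
  rw [numEdges, Nat.card_eq_fintype_card, ← SimpleGraph.edgeFinset_card]
  refine Finset.card_bij (fun e _ => s(e.1, e.2)) ?_ ?_ ?_
  · intro e he
    have := (by simpa [orderedEdges] using he : e.1 < e.2 ∧ F.Adj e.1 e.2)
    simpa using this.2
  · rintro ⟨a, b⟩ ha ⟨c, d⟩ hc h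
    have h1 := orderedEdges_lt ha
    have h2 := orderedEdges_lt hc
    simp only [Sym2.eq_iff] at h
    rcases h with ⟨rfl, rfl⟩ | ⟨rfl, rfl⟩
    · rfl
    · exact absurd h1 (not_lt.2 h2.le)
  · intro e he
    induction e with
    | _ a b =>
      have hab : F.Adj a b := by simpa using he
      rcases lt_or_gt_of_ne hab.ne with h | h
      · exact ⟨(a, b), by simp [orderedEdges, h, hab], rfl⟩
      · exact ⟨(b, a), by simp [orderedEdges, h, hab.symm], Sym2.eq_swap⟩

lemma adjInd_zero_or_one {β : Type*} (G : SimpleGraph β) (x y : β) :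
    adjInd G x y = 0 ∨ adjInd G x y = 1 := by
  unfold adjInd; split_ifs <;> simp

lemma adjInd_nonneg {β : Type*} (G : SimpleGraph β) (x y : β) : 0 ≤ adjInd G x y := by
  rcases adjInd_zero_or_one G x y with h | h <;> simp [h]

lemma adjInd_le_one {β : Type*} (G : SimpleGraph β) (x y : β) : adjInd G x y ≤ 1 := by
  rcases adjInd_zero_or_one G x y with h | h <;> simp [h]

lemma edgeProd_nonneg {ι β : Type*} {W : β → β → ℝ} (hW : ∀ a b, 0 ≤ W a b)
    (E : Finset (ι × ι)) (x : ι → β) : 0 ≤ edgeProd W E x :=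
  Finset.prod_nonneg fun _ _ => hW _ _

lemma edgeProd_le_one {ι β : Type*} {W : β → β → ℝ} (hW : ∀ a b, 0 ≤ W a b)
    (hW1 : ∀ a b, W a b ≤ 1) (E : Finset (ι × ι)) (x : ι → β) : edgeProd W E x ≤ 1 :=
  Finset.prod_le_one (fun _ _ => hW _ _) fun _ _ => hW1 _ _

lemma edgeProd_orderedEdges {m : ℕ} {β : Type*} (F : SimpleGraph (Fin m)) (G : SimpleGraph β)
    (x : Fin m → β) [Decidable (∀ i j, F.Adj i j → G.Adj (x i) (x j))] :
    edgeProd (adjInd G) (orderedEdges F) x =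
      if ∀ i j, F.Adj i j → G.Adj (x i) (x j) then 1 else 0 := by
  classical
  split_ifs with h
  · refine Finset.prod_eq_one fun e he => ?_
    have := (by simpa [orderedEdges] using he : e.1 < e.2 ∧ F.Adj e.1 e.2)
    simp [adjInd, h _ _ this.2]
  · push Not at h
    obtain ⟨i, j, hij, hG⟩ := h
    rcases lt_or_gt_of_ne hij.ne with hl | hl
    · exact Finset.prod_eq_zero (i := (i, j)) (by simp [orderedEdges, hl, hij])
        (by simp [adjInd, hG])
    · exact Finset.prod_eq_zero (i := (j, i)) (by simp [orderedEdges, hl, hij.symm])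
        (by simp [adjInd, G.adj_comm, hG])

open Classical in
lemma totalCount_eq_sum {m : ℕ} {β : Type} [Fintype β] (F : SimpleGraph (Fin m))
    (G : SimpleGraph β) :
    (totalCount F G : ℝ) = ∑ x : Fin m → β,
      if Function.Injective x then edgeProd (adjInd G) (orderedEdges F) x else 0 := by
  rw [totalCount, Nat.card_eq_fintype_card, Fintype.card_subtype, Finset.card_eq_sum_ones,
    Finset.sum_filter]
  push_cast
  refine Finset.sum_congr rfl fun x _ => ?_
  rw [edgeProd_orderedEdges, ← ite_and]

open Classical in
lemma labCount_eq_sum {m : ℕ} {β : Type} [Fintype β] (F : SimpleGraph (Fin m))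
    (G : SimpleGraph β) (U : Fin m → Finset β) :
    (labCount F G U : ℝ) = ∑ x : Fin m → β,
      (if Function.Injective x then edgeProd (adjInd G) (orderedEdges F) x else 0)
        * ∏ j, if x j ∈ U j then (1 : ℝ) else 0 := by
  rw [labCount, Nat.card_eq_fintype_card, Fintype.card_subtype, Finset.card_eq_sum_ones,
    Finset.sum_filter]
  push_cast
  refine Finset.sum_congr rfl fun x _ => ?_
  rw [edgeProd_orderedEdges, Finset.prod_ite_zero]
  simp only [Finset.mem_univ, true_imp_iff, Finset.prod_const_one]
  split_ifs <;> simp_all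

/-- Summing over one coordinate twice. -/
lemma card_mul_sum_piFinset {ι β : Type*} [Fintype ι] [DecidableEq ι] [DecidableEq β]
    (Ω : ι → Finset β) (i : ι) (h : (ι → β) → ℝ) :
    (#(Ω i) : ℝ) * ∑ x ∈ Fintype.piFinset Ω, h x =
      ∑ y ∈ Fintype.piFinset Ω, ∑ a ∈ Ω i, h (Function.update y i a) := by
  rw [← Finset.sum_product' (f := fun y a => h (Function.update y i a)), ← nsmul_eq_mul,
    ← Finset.sum_const, Finset.sum_comm,
    ← Finset.sum_product' (f := fun (y : ι → β) (_ : β) => h y)]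
  have hmem : ∀ q ∈ Fintype.piFinset Ω ×ˢ Ω i,
      (Function.update q.1 i q.2, q.1 i) ∈ Fintype.piFinset Ω ×ˢ Ω i := by
    rintro ⟨y, a⟩ hq
    simp only [Finset.mem_product, Fintype.mem_piFinset] at hq ⊢
    refine ⟨fun k => ?_, hq.1 i⟩
    by_cases hk : k = i
    · subst hk; simpa using hq.2
    · simpa [hk] using hq.1 k
  refine Finset.sum_bij' (fun q _ => (Function.update q.1 i q.2, q.1 i))
    (fun q _ => (Function.update q.1 i q.2, q.1 i)) hmem hmem ?_ ?_ ?_ <;> simp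

lemma abs_sum_factor_le {ι β : Type*} [Fintype ι] [DecidableEq ι] [DecidableEq β]
    (Ω : ι → Finset β) (hΩ : ∀ i, (Ω i).Nonempty) {i j : ι} (hij : i ≠ j)
    (W : β → β → ℝ) (η : ℝ)
    (hcut : ∀ A ⊆ Ω i, ∀ B ⊆ Ω j, |∑ a ∈ A, ∑ b ∈ B, W a b| ≤ η * #(Ω i) * #(Ω j))
    (φ ψ : (ι → β) → ℝ) (hφ : ∀ x, φ x = 0 ∨ φ x = 1) (hψ : ∀ x, ψ x = 0 ∨ ψ x = 1)
    (hφj : ∀ x b, φ (Function.update x j b) = φ x)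
    (hψi : ∀ x a, ψ (Function.update x i a) = ψ x) :
    |∑ x ∈ Fintype.piFinset Ω, φ x * ψ x * W (x i) (x j)| ≤ η * ∏ l, (#(Ω l) : ℝ) := by
  classical
  have hi : (0 : ℝ) < #(Ω i) := by exact_mod_cast (hΩ i).card_pos
  have hj : (0 : ℝ) < #(Ω j) := by exact_mod_cast (hΩ j).card_pos
  set S := ∑ x ∈ Fintype.piFinset Ω, φ x * ψ x * W (x i) (x j) with hS
  have key : (#(Ω i) : ℝ) * (#(Ω j) * S) =
      ∑ y ∈ Fintype.piFinset Ω, ∑ a ∈ Ω i, ∑ b ∈ Ω j,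
        φ (Function.update y i a) * ψ (Function.update y j b) * W a b := by
    rw [hS, card_mul_sum_piFinset Ω j, card_mul_sum_piFinset Ω i]
    refine Finset.sum_congr rfl fun y _ => Finset.sum_congr rfl fun a _ =>
      Finset.sum_congr rfl fun b _ => ?_
    rw [hφj]
    conv_lhs => rw [Function.update_comm hij, hψi]
    simp [Function.update_of_ne hij.symm]
  have hy : ∀ y : ι → β, |∑ a ∈ Ω i, ∑ b ∈ Ω j,
      φ (Function.update y i a) * ψ (Function.update y j b) * W a b|
        ≤ η * #(Ω i) * #(Ω j) := by
    intro y
    convert hcut ((Ω i).filter fun a => φ (Function.update y i a) = 1) (Finset.filter_subset _ _)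
      ((Ω j).filter fun b => ψ (Function.update y j b) = 1) (Finset.filter_subset _ _) using 2
    rw [Finset.sum_filter]
    refine Finset.sum_congr rfl fun a _ => ?_
    rcases hφ (Function.update y i a) with h | h
    · simp [h]
    · rw [if_pos h, Finset.sum_filter]
      refine Finset.sum_congr rfl fun b _ => ?_
      rcases hψ (Function.update y j b) with h' | h' <;> simp [h, h']
  have h1 : (#(Ω i) : ℝ) * (#(Ω j) * |S|) ≤ (∏ l, (#(Ω l) : ℝ)) * (η * #(Ω i) * #(Ω j)) := by
    calc (#(Ω i) : ℝ) * (#(Ω j) * |S|) = |(#(Ω i) : ℝ) * (#(Ω j) * S)| := by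
          rw [abs_mul, abs_mul, abs_of_pos hi, abs_of_pos hj]
      _ ≤ ∑ y ∈ Fintype.piFinset Ω, η * #(Ω i) * #(Ω j) := by
          rw [key]
          exact (Finset.abs_sum_le_sum_abs _ _).trans (Finset.sum_le_sum fun y _ => hy y)
      _ = _ := by rw [Finset.sum_const, Fintype.card_piFinset, nsmul_eq_mul]; push_cast; rfl
  have h2 : (#(Ω i) * #(Ω j) : ℝ) * |S| ≤ (#(Ω i) * #(Ω j) : ℝ) * (η * ∏ l, (#(Ω l) : ℝ)) := by
    linarith
  exact le_of_mul_le_mul_left h2 (by positivity)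

lemma prod_zero_or_one {κ : Type*} (s : Finset κ) (f : κ → ℝ) (hf : ∀ k ∈ s, f k = 0 ∨ f k = 1) :
    ∏ k ∈ s, f k = 0 ∨ ∏ k ∈ s, f k = 1 :=
  Finset.prod_induction f (fun t => t = 0 ∨ t = 1)
    (by rintro a b (rfl | rfl) (rfl | rfl) <;> simp) (by simp) hf

/-- The counting lemma: if on every edge of `E` the graph `G` is close in cut distance to the
constant `d`, then the number of homomorphisms into given sets is close to the product. -/
theorem abs_count_sub_le {m : ℕ} {β : Type*} [DecidableEq β] (G : SimpleGraph β)
    (Ω U : Fin m → Finset β) (hΩ : ∀ i, (Ω i).Nonempty) (hU : ∀ i, U i ⊆ Ω i)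
    (d : Fin m → Fin m → ℝ) (hd0 : ∀ i j, 0 ≤ d i j) (hd1 : ∀ i j, d i j ≤ 1)
    (η : ℝ) (E : Finset (Fin m × Fin m)) (hE : ∀ e ∈ E, e.1 < e.2)
    (hcut : ∀ e ∈ E, ∀ A ⊆ Ω e.1, ∀ B ⊆ Ω e.2,
      |∑ a ∈ A, ∑ b ∈ B, (adjInd G a b - d e.1 e.2)| ≤ η * #(Ω e.1) * #(Ω e.2)) :
    |∑ x ∈ Fintype.piFinset Ω, (∏ l, if x l ∈ U l then (1 : ℝ) else 0) * edgeProd (adjInd G) E x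
      - (∏ e ∈ E, d e.1 e.2) * ∏ l, (#(U l) : ℝ)| ≤ #E * η * ∏ l, (#(Ω l) : ℝ) := by
  classical
  induction E using Finset.induction_on with
  | empty =>
    have h : ∑ x ∈ Fintype.piFinset Ω, (∏ l, if x l ∈ U l then (1 : ℝ) else 0)
        = ∏ l, (#(U l) : ℝ) := by
      rw [← Finset.prod_univ_sum Ω fun l a => if a ∈ U l then (1 : ℝ) else 0]
      refine Finset.prod_congr rfl fun l _ => ?_
      rw [Finset.sum_ite_mem, Finset.inter_eq_right.2 (hU l)]
      simp
    simp [edgeProd, h]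
  | insert e E heE ih =>
    have ih' := ih (fun e' he' => hE e' (Finset.mem_insert_of_mem he'))
      (fun e' he' => hcut e' (Finset.mem_insert_of_mem he'))
    have hlt : e.1 < e.2 := hE e (Finset.mem_insert_self _ _)
    set I : (Fin m → β) → ℝ := fun x => ∏ l, if x l ∈ U l then (1 : ℝ) else 0 with hI
    set φ : (Fin m → β) → ℝ := fun x => (∏ l ∈ univ.erase e.2, if x l ∈ U l then (1 : ℝ) else 0) *
      ∏ e' ∈ E.filter (fun e' => ¬ (e'.1 = e.2 ∨ e'.2 = e.2)), adjInd G (x e'.1) (x e'.2) with hφ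
    set ψ : (Fin m → β) → ℝ := fun x => (if x e.2 ∈ U e.2 then (1 : ℝ) else 0) *
      ∏ e' ∈ E.filter (fun e' => e'.1 = e.2 ∨ e'.2 = e.2), adjInd G (x e'.1) (x e'.2) with hψ
    have hsplit : ∀ x, φ x * ψ x = I x * edgeProd (adjInd G) E x := by
      intro x
      simp only [hφ, hψ, hI, edgeProd]
      rw [← Finset.mul_prod_erase univ _ (Finset.mem_univ e.2),
        ← Finset.prod_filter_mul_prod_filter_not E (fun e' => e'.1 = e.2 ∨ e'.2 = e.2)]
      ring
    have hbound := abs_sum_factor_le Ω hΩ hlt.ne (fun a b => adjInd G a b - d e.1 e.2) η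
      (hcut e (Finset.mem_insert_self _ _)) φ ψ
      (fun x => by
        simp only [hφ]
        rcases prod_zero_or_one (univ.erase e.2) (fun l => if x l ∈ U l then (1 : ℝ) else 0)
          (fun l _ => by split_ifs <;> simp) with h | h <;>
        rcases prod_zero_or_one (E.filter (fun e' => ¬ (e'.1 = e.2 ∨ e'.2 = e.2)))
          (fun e' => adjInd G (x e'.1) (x e'.2)) (fun _ _ => adjInd_zero_or_one _ _ _)
          with h' | h' <;> rw [h, h'] <;> simp)
      (fun x => by
        simp only [hψ]
        rcases prod_zero_or_one (E.filter (fun e' => (e'.1 = e.2 ∨ e'.2 = e.2)))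
          (fun e' => adjInd G (x e'.1) (x e'.2)) (fun _ _ => adjInd_zero_or_one _ _ _)
          with h' | h' <;> rw [h'] <;> split_ifs <;> simp)
      (fun x b => by
        simp only [hφ]
        congr 1
        · refine Finset.prod_congr rfl fun l hl => ?_
          rw [Function.update_of_ne (Finset.ne_of_mem_erase hl)]
        · refine Finset.prod_congr rfl fun e' he' => ?_
          have := (Finset.mem_filter.1 he').2
          push Not at this
          rw [Function.update_of_ne this.1, Function.update_of_ne this.2])
      (fun x a => by
        simp only [hψ]
        rw [Function.update_of_ne hlt.ne']
        congr 1
        refine Finset.prod_congr rfl fun e' he' => ?_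
        obtain ⟨hm, hc⟩ := Finset.mem_filter.1 he'
        have hl' := hE e' (Finset.mem_insert_of_mem hm)
        have hne : e' ≠ e := fun h => heE (h ▸ hm)
        rw [Function.update_of_ne, Function.update_of_ne]
        · rcases hc with hc | hc
          · intro h; rw [hc, h] at hl'; exact absurd hl' (not_lt.2 hlt.le)
          · rw [hc]; exact hlt.ne'
        · rcases hc with hc | hc
          · rw [hc]; exact hlt.ne'
          · intro h; exact hne (Prod.ext h hc))
    rw [Finset.card_insert_of_notMem heE]
    have heq : ∑ x ∈ Fintype.piFinset Ω, I x * edgeProd (adjInd G) (insert e E) x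
        - (∏ e ∈ insert e E, d e.1 e.2) * ∏ l, (#(U l) : ℝ)
        = ∑ x ∈ Fintype.piFinset Ω, φ x * ψ x * (adjInd G (x e.1) (x e.2) - d e.1 e.2)
          + d e.1 e.2 * (∑ x ∈ Fintype.piFinset Ω, I x * edgeProd (adjInd G) E x
            - (∏ e ∈ E, d e.1 e.2) * ∏ l, (#(U l) : ℝ)) := by
      rw [Finset.prod_insert heE, mul_sub, Finset.mul_sum, ← add_sub_assoc,
        ← Finset.sum_add_distrib]
      congr 1
      · refine Finset.sum_congr rfl fun x _ => ?_
        rw [hsplit, edgeProd, Finset.prod_insert heE, ← edgeProd]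
        ring
      · ring
    rw [heq]
    refine (abs_add_le _ _).trans ?_
    rw [abs_mul, abs_of_nonneg (hd0 _ _)]
    have h3 : d e.1 e.2 * |∑ x ∈ Fintype.piFinset Ω, I x * edgeProd (adjInd G) E x
            - (∏ e ∈ E, d e.1 e.2) * ∏ l, (#(U l) : ℝ)| ≤ #E * η * ∏ l, (#(Ω l) : ℝ) :=
      (mul_le_of_le_one_left (abs_nonneg _) (hd1 _ _)).trans ih'
    push_cast
    linarith

/-- The edge distribution of `G n` is uniformly close to `p` on all pairs of vertex sets. -/
def CutSmall (p : ℝ) (V : ℕ → ℕ) (G : ∀ n, SimpleGraph (Fin (V n))) : Prop :=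
  ∀ δ > 0, ∀ᶠ n in atTop, ∀ X Y : Finset (Fin (V n)),
    |∑ a ∈ X, ∑ b ∈ Y, (adjInd (G n) a b - p)| ≤ δ * (V n : ℝ) ^ 2

open Classical in
lemma card_not_injective_mul_le {ι β : Type*} [Fintype ι] [DecidableEq ι] [Fintype β] :
    #(univ.filter fun x : ι → β => ¬ Function.Injective x) * Fintype.card β ≤
      Fintype.card ι ^ 2 * Fintype.card (ι → β) := by
  have hpair : ∀ q : ι × ι, q.1 ≠ q.2 →
      #(univ.filter fun x : ι → β => x q.1 = x q.2) * Fintype.card β ≤ Fintype.card (ι → β) := by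
    intro q hq
    rw [← Finset.card_univ (α := β), ← Finset.card_product, ← Finset.card_univ (α := ι → β)]
    refine Finset.card_le_card_of_injOn (fun z => Function.update z.1 q.2 z.2) (by simp) ?_
    rintro ⟨x, a⟩ hx ⟨y, b⟩ hy h
    simp only [coe_product, coe_filter, mem_univ, true_and, coe_univ, Set.mem_prod,
      Set.mem_ofPred_eq, Set.mem_univ, and_true] at hx hy h
    have hab : a = b := by simpa using congrFun h q.2
    have hne : ∀ k, k ≠ q.2 → x k = y k := fun k hk => by simpa [hk] using congrFun h k
    refine Prod.ext (funext fun k => ?_) hab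
    by_cases hk : k = q.2
    · subst hk; exact hx.symm.trans ((hne _ hq).trans hy)
    · exact hne k hk
  have hsub : (univ.filter fun x : ι → β => ¬ Function.Injective x) ⊆
      (univ.filter fun q : ι × ι => q.1 ≠ q.2).biUnion
        fun q => univ.filter fun x : ι → β => x q.1 = x q.2 := by
    intro x hx
    simp only [Function.Injective, mem_filter, mem_univ, true_and, not_forall] at hx
    obtain ⟨i, j, hij, hne⟩ := hx
    simp only [mem_biUnion, mem_filter, mem_univ, true_and]
    exact ⟨(i, j), hne, hij⟩
  calc _ ≤ (∑ q ∈ univ.filter (fun q : ι × ι => q.1 ≠ q.2),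
        #(univ.filter fun x : ι → β => x q.1 = x q.2)) * Fintype.card β :=
        Nat.mul_le_mul_right _ ((card_le_card hsub).trans card_biUnion_le)
    _ ≤ ∑ q ∈ univ.filter (fun q : ι × ι => q.1 ≠ q.2), Fintype.card (ι → β) := by
        rw [Finset.sum_mul]
        exact Finset.sum_le_sum fun q hq => hpair q (Finset.mem_filter.1 hq).2
    _ ≤ _ := by
        rw [Finset.sum_const, smul_eq_mul]
        refine Nat.mul_le_mul_right _ ((card_filter_le _ _).trans ?_)
        rw [card_univ, Fintype.card_prod, sq]

open Classical in
/-- Restricting a bounded sum over all maps to the injective ones changes it little. -/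
lemma abs_sum_sub_sum_injective_le {m : ℕ} {β : Type*} [Fintype β] [Nonempty β]
    (h : (Fin m → β) → ℝ) (h1 : ∀ x, |h x| ≤ 1) :
    |∑ x, h x - ∑ x, (if Function.Injective x then h x else 0)| ≤
      m ^ 2 * (Fintype.card β : ℝ) ^ m / Fintype.card β := by
  have hN : (0 : ℝ) < Fintype.card β := by exact_mod_cast Fintype.card_pos
  rw [← Finset.sum_sub_distrib, le_div_iff₀ hN]
  have hle : |∑ x, (h x - if Function.Injective x then h x else 0)| ≤
      #(univ.filter fun x : Fin m → β => ¬ Function.Injective x) := by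
    rw [Finset.card_eq_sum_ones, Finset.sum_filter]
    push_cast
    refine (Finset.abs_sum_le_sum_abs _ _).trans (Finset.sum_le_sum fun x _ => ?_)
    split_ifs <;> simp_all
  have := card_not_injective_mul_le (ι := Fin m) (β := β)
  rw [Fintype.card_fun, Fintype.card_fin] at this
  calc _ ≤ (#(univ.filter fun x : Fin m → β => ¬ Function.Injective x) : ℝ) * Fintype.card β :=
        mul_le_mul_of_nonneg_right hle hN.le
    _ ≤ _ := by exact_mod_cast this

lemma labCount_univ {m : ℕ} {β : Type} [Fintype β] (F : SimpleGraph (Fin m))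
    (G : SimpleGraph β) : labCount F G (fun _ => univ) = totalCount F G := by
  simp [labCount, totalCount]

lemma abs_labCount_sub_le {m : ℕ} {β : Type} [Fintype β] [Nonempty β] (F : SimpleGraph (Fin m))
    (G : SimpleGraph β) (U : Fin m → Finset β) {p η : ℝ} (hp0 : 0 ≤ p) (hp1 : p ≤ 1)
    (hcut : ∀ A B : Finset β,
      |∑ a ∈ A, ∑ b ∈ B, (adjInd G a b - p)| ≤ η * (Fintype.card β : ℝ) ^ 2) :
    |(labCount F G U : ℝ) - p ^ numEdges F * ∏ i, (#(U i) : ℝ)| ≤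
      (numEdges F * η + m ^ 2 / Fintype.card β) * (Fintype.card β : ℝ) ^ m := by
  classical
  have h1 := abs_count_sub_le G (fun _ : Fin m => univ) U (fun _ => univ_nonempty)
    (fun _ => subset_univ _) (fun _ _ => p) (fun _ _ => hp0) (fun _ _ => hp1) η
    (orderedEdges F) (fun e he => orderedEdges_lt he)
    (fun e _ A _ B _ => (hcut A B).trans_eq (by rw [card_univ]; ring))
  rw [Finset.prod_const, card_orderedEdges, Fintype.piFinset_univ, Finset.prod_const, card_univ,
    card_univ, Fintype.card_fin] at h1
  have h2 := abs_sum_sub_sum_injective_le (β := β) (m := m)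
    (fun x => (∏ l, if x l ∈ U l then (1 : ℝ) else 0) *
      edgeProd (adjInd G) (orderedEdges F) x) (fun x => by
    have ha := edgeProd_nonneg (adjInd_nonneg G) (orderedEdges F) x
    have hb := edgeProd_le_one (adjInd_nonneg G) (adjInd_le_one G) (orderedEdges F) x
    rcases prod_zero_or_one univ (fun l => if x l ∈ U l then (1 : ℝ) else 0)
      (fun l _ => by split_ifs <;> simp) with h | h <;> rw [h]
    · simp
    · rw [one_mul, abs_of_nonneg ha]; exact hb)
  have h3 : (labCount F G U : ℝ) = ∑ x : Fin m → β, if Function.Injective x then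
      (∏ l, if x l ∈ U l then (1 : ℝ) else 0) * edgeProd (adjInd G) (orderedEdges F) x
      else 0 := by
    rw [labCount_eq_sum]
    refine Finset.sum_congr rfl fun x _ => ?_
    split_ifs
    · ring
    · simp
  rw [abs_sub_comm, ← h3] at h2
  refine (abs_sub_le _ _ _).trans ((add_le_add h2 h1).trans_eq ?_)
  ring

theorem CutSmall.isQuasirandom {p : ℝ} (hp0 : 0 ≤ p) (hp1 : p ≤ 1) {V : ℕ → ℕ}
    {G : ∀ n, SimpleGraph (Fin (V n))} (hV : Tendsto V atTop atTop) (h : CutSmall p V G) :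
    IsQuasirandom p V G := by
  intro m F
  rw [Asymptotics.isLittleO_iff]
  intro c hc
  have hVR : Tendsto (fun n => (V n : ℝ)) atTop atTop := tendsto_natCast_atTop_atTop.comp hV
  filter_upwards [h (c / (2 * (numEdges F + 1))) (by positivity),
    hVR.eventually_ge_atTop (2 * m ^ 2 / c + 1)] with n h1 h2
  have hN : (0 : ℝ) < V n := lt_of_lt_of_le (by positivity) h2
  have : Nonempty (Fin (V n)) := ⟨⟨0, by exact_mod_cast hN⟩⟩
  have := abs_labCount_sub_le F (G n) (fun _ => univ) hp0 hp1
    (η := c / (2 * (numEdges F + 1))) (by simpa using h1)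
  rw [labCount_univ] at this
  simp only [card_univ, Fintype.card_fin, prod_const] at this
  rw [Real.norm_eq_abs, Real.norm_eq_abs, abs_of_nonneg (by positivity : (0:ℝ) ≤ (V n : ℝ) ^ m)]
  refine this.trans (mul_le_mul_of_nonneg_right ?_ (by positivity))
  have e1 : (numEdges F : ℝ) * (c / (2 * (numEdges F + 1))) ≤ c / 2 := by
    rw [mul_div_assoc', div_le_div_iff₀ (by positivity) (by positivity)]
    nlinarith [(Nat.cast_nonneg (numEdges F) : (0 : ℝ) ≤ numEdges F)]
  have e2 : (m : ℝ) ^ 2 / V n ≤ c / 2 := by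
    rw [div_le_iff₀ hN]
    have : 2 * (m : ℝ) ^ 2 / c ≤ V n := by linarith
    rw [div_le_iff₀ hc] at this
    linarith
  linarith

/-- A uniform error bound at each scale yields a single error sequence tending to zero. -/
lemma exists_error_sequence {ι : ℕ → Type*} [∀ n, Fintype (ι n)] (D : ∀ n, ι n → ℝ) {V : ℕ → ℕ}
    (m : ℕ) (hV : Tendsto V atTop atTop)
    (h : ∀ δ > 0, ∀ᶠ n in atTop, ∀ u, |D n u| ≤ δ * (V n : ℝ) ^ m)
    (h0 : ∀ n u, V n = 0 → D n u = 0) :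
    ∃ ε : ℕ → ℝ, Tendsto ε atTop (nhds 0) ∧ ∀ n u, |D n u| ≤ ε n * (V n : ℝ) ^ m := by
  refine ⟨fun n => ((univ.sup fun u => ‖D n u‖₊ : NNReal) : ℝ) / (V n : ℝ) ^ m, ?_, ?_⟩
  · rw [Metric.tendsto_nhds]
    intro δ hδ
    filter_upwards [h (δ / 2) (by positivity), hV.eventually_gt_atTop 0] with n h1 h2
    have hN : (0 : ℝ) < (V n : ℝ) ^ m := by positivity
    rw [Real.dist_eq, sub_zero, abs_of_nonneg (by positivity)]
    refine lt_of_le_of_lt ?_ (half_lt_self hδ)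
    rw [div_le_iff₀ hN]
    have hb : (univ.sup fun u => ‖D n u‖₊ : NNReal) ≤ ⟨δ / 2 * (V n : ℝ) ^ m, by positivity⟩ :=
      Finset.sup_le fun u _ => h1 u
    exact_mod_cast hb
  · intro n u
    rcases Nat.eq_zero_or_pos (V n) with hz | hpos
    · rw [h0 n u hz, abs_zero]; positivity
    · have hN : (0 : ℝ) < (V n : ℝ) ^ m := by positivity
      rw [div_mul_cancel₀ _ hN.ne']
      exact_mod_cast (Finset.le_sup (f := fun u => ‖D n u‖₊) (mem_univ u) :
        ‖D n u‖₊ ≤ univ.sup fun u => ‖D n u‖₊)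

theorem CutSmall.satisfiesPr {m r : ℕ} (F : SimpleGraph (Fin m)) (hm : 0 < m) {p : ℝ}
    (hp0 : 0 ≤ p) (hp1 : p ≤ 1) (α : Fin r → ℝ) {V : ℕ → ℕ}
    {G : ∀ n, SimpleGraph (Fin (V n))} (hV : Tendsto V atTop atTop) (h : CutSmall p V G) :
    SatisfiesPr F p α V G := by
  classical
  set D : ∀ n, (Fin r → Finset (Fin (V n))) → ℝ := fun n U =>
    (∑ s : Finset (Fin r), if h : s.card = m then
        symCount F (G n) (fun j => U (s.orderEmbOfFin h j)) else 0)
      - p ^ numEdges F * ∑ s : Finset (Fin r), if s.card = m then ∏ i ∈ s, ((U i).card : ℝ) else 0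
    with hD
  have hDsum : ∀ n U, D n U = ∑ s : Finset (Fin r), if h : s.card = m then
      ((m.factorial : ℝ))⁻¹ * ∑ σ : Equiv.Perm (Fin m),
        ((labCount F (G n) (fun i => U (s.orderEmbOfFin h (σ i))) : ℝ) -
          p ^ numEdges F * ∏ i, (#(U (s.orderEmbOfFin h (σ i))) : ℝ)) else 0 := by
    intro n U
    rw [hD]
    simp only
    rw [Finset.mul_sum, ← Finset.sum_sub_distrib]
    refine Finset.sum_congr rfl fun s _ => ?_
    split_ifs with hs
    · have hprod : ∀ σ : Equiv.Perm (Fin m), ∏ i, (#(U (s.orderEmbOfFin hs (σ i))) : ℝ) =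
          ∏ i ∈ s, (#(U i) : ℝ) := by
        intro σ
        rw [Equiv.prod_comp σ (fun i => (#(U (s.orderEmbOfFin hs i)) : ℝ))]
        conv_rhs => rw [← Finset.image_orderEmbOfFin_univ s hs]
        rw [Finset.prod_image (fun _ _ _ _ hxy => (s.orderEmbOfFin hs).injective hxy)]
      rw [Finset.sum_sub_distrib, symCount]
      simp only [hprod, Finset.sum_const, card_univ, Fintype.card_perm, Fintype.card_fin]
      have : (m.factorial : ℝ) ≠ 0 := by positivity
      rw [nsmul_eq_mul]
      field_simp
    · simp
  obtain ⟨ε, hε, hb⟩ := exists_error_sequence D m hV (fun δ hδ => by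
    have hVR : Tendsto (fun n => (V n : ℝ)) atTop atTop := tendsto_natCast_atTop_atTop.comp hV
    set c := δ / 2 ^ r with hc'
    have hc : 0 < c := by positivity
    filter_upwards [h (c / (2 * (numEdges F + 1))) (by positivity),
      hVR.eventually_ge_atTop (2 * m ^ 2 / c + 1)] with n h1 h2 U
    have hN : (0 : ℝ) < V n := lt_of_lt_of_le (by positivity) h2
    have : Nonempty (Fin (V n)) := ⟨⟨0, by exact_mod_cast hN⟩⟩
    have key : ∀ U : Fin m → Finset (Fin (V n)),
        |(labCount F (G n) U : ℝ) - p ^ numEdges F * ∏ i, (#(U i) : ℝ)| ≤ c * (V n : ℝ) ^ m := by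
      intro U
      have := abs_labCount_sub_le F (G n) U hp0 hp1
        (η := c / (2 * (numEdges F + 1))) (by simpa using h1)
      simp only [Fintype.card_fin] at this
      refine this.trans (mul_le_mul_of_nonneg_right ?_ (by positivity))
      have e1 : (numEdges F : ℝ) * (c / (2 * (numEdges F + 1))) ≤ c / 2 := by
        rw [mul_div_assoc', div_le_div_iff₀ (by positivity) (by positivity)]
        nlinarith [(Nat.cast_nonneg (numEdges F) : (0 : ℝ) ≤ numEdges F)]
      have e2 : (m : ℝ) ^ 2 / V n ≤ c / 2 := by
        rw [div_le_iff₀ hN]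
        have : 2 * (m : ℝ) ^ 2 / c ≤ V n := by linarith
        rw [div_le_iff₀ hc] at this
        linarith
      linarith
    rw [hDsum]
    calc _ ≤ ∑ s : Finset (Fin r), c * (V n : ℝ) ^ m := by
          refine (Finset.abs_sum_le_sum_abs _ _).trans (Finset.sum_le_sum fun s _ => ?_)
          split_ifs with hs
          · rw [abs_mul, abs_of_nonneg (by positivity : (0 : ℝ) ≤ (m.factorial : ℝ)⁻¹),
              inv_mul_le_iff₀ (by positivity)]
            refine (Finset.abs_sum_le_sum_abs _ _).trans
              ((Finset.sum_le_sum fun σ _ => key _).trans_eq ?_)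
            rw [Finset.sum_const, card_univ, Fintype.card_perm, Fintype.card_fin, nsmul_eq_mul]
          · rw [abs_zero]; positivity
      _ = _ := by
          rw [Finset.sum_const, card_univ, Fintype.card_finset, Fintype.card_fin, nsmul_eq_mul,
            hc']
          push_cast
          field_simp) (fun n U hz => by
    have hE : IsEmpty (Fin (V n)) := by rw [hz]; infer_instance
    rw [hDsum]
    refine Finset.sum_eq_zero fun s _ => ?_
    split_ifs with hs
    · have : ∀ σ : Equiv.Perm (Fin m),
        ((labCount F (G n) (fun i => U (s.orderEmbOfFin hs (σ i))) : ℝ) -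
          p ^ numEdges F * ∏ i, (#(U (s.orderEmbOfFin hs (σ i))) : ℝ)) = 0 := by
        intro σ
        have hz' : ∀ A : Finset (Fin (V n)), A = ∅ := fun A => Finset.eq_empty_of_isEmpty A
        have : Nonempty (Fin m) := ⟨⟨0, hm⟩⟩
        rw [labCount_eq_sum, Finset.univ_eq_empty (α := Fin m → Fin (V n)), Finset.sum_empty,
          Finset.prod_eq_zero (mem_univ ⟨0, hm⟩) (by rw [hz' (U _)]; simp)]
        simp
      simp [this]
    · rfl)
  exact ⟨ε, hε, fun n U _ _ => hb n U⟩

/-- Two applications of Cauchy–Schwarz bound a bilinear sum by a weighted count of four-cycles. -/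
lemma pow_four_sum_le_edgeProd {β : Type*} [Fintype β] (B : β → β → ℝ) (X Y : Finset β) :
    (∑ a ∈ X, ∑ b ∈ Y, B a b) ^ 4 ≤ (Fintype.card β : ℝ) ^ 4 *
      ∑ x : Fin 4 → β, edgeProd B {(0, 2), (0, 3), (1, 2), (1, 3)} x := by
  classical
  set N : ℝ := (Fintype.card β : ℝ) with hN
  have hcard : ∀ S : Finset β, (#S : ℝ) ≤ N := fun S => by
    rw [hN]; exact_mod_cast card_le_univ S
  have h1 : (∑ a ∈ X, ∑ b ∈ Y, B a b) ^ 2 ≤ N * ∑ b ∈ Y, ∑ b' ∈ Y, ∑ a, B a b * B a b' := by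
    calc (∑ a ∈ X, ∑ b ∈ Y, B a b) ^ 2 ≤ #X * ∑ a ∈ X, (∑ b ∈ Y, B a b) ^ 2 :=
          sq_sum_le_card_mul_sum_sq
      _ ≤ N * ∑ a, (∑ b ∈ Y, B a b) ^ 2 :=
          mul_le_mul (hcard X) (Finset.sum_le_sum_of_subset_of_nonneg (subset_univ _)
            fun _ _ _ => sq_nonneg _) (Finset.sum_nonneg fun _ _ => sq_nonneg _)
            (by positivity)
      _ = _ := by
          congr 1
          simp_rw [sq, Finset.sum_mul_sum]
          rw [Finset.sum_comm]
          exact Finset.sum_congr rfl fun b _ => Finset.sum_comm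
  have h2 : (∑ b ∈ Y, ∑ b' ∈ Y, ∑ a, B a b * B a b') ^ 2 ≤
      N ^ 2 * ∑ b, ∑ b', (∑ a, B a b * B a b') ^ 2 := by
    rw [← Finset.sum_product' (f := fun b b' => ∑ a, B a b * B a b'),
      ← Fintype.sum_prod_type' (f := fun b b' => (∑ a, B a b * B a b') ^ 2)]
    refine sq_sum_le_card_mul_sum_sq.trans (mul_le_mul ?_
      (Finset.sum_le_sum_of_subset_of_nonneg (subset_univ _) fun _ _ _ => sq_nonneg _)
      (Finset.sum_nonneg fun _ _ => sq_nonneg _) (by positivity))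
    rw [card_product, Nat.cast_mul, sq]
    exact mul_le_mul (hcard Y) (hcard Y) (by positivity) (by positivity)
  have h3 : ∑ b, ∑ b', (∑ a, B a b * B a b') ^ 2 =
      ∑ x : Fin 4 → β, edgeProd B {(0, 2), (0, 3), (1, 2), (1, 3)} x := by
    have : ∀ b b', (∑ a, B a b * B a b') ^ 2 =
        ∑ a, ∑ a', B a b * B a b' * (B a' b * B a' b') := fun b b' => by
      rw [sq, Finset.sum_mul_sum]
    simp_rw [this]
    rw [← Fintype.sum_prod_type' (f := fun b b' => ∑ a, ∑ a', B a b * B a b' * (B a' b * B a' b'))]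
    simp_rw [← Fintype.sum_prod_type' (f := fun a a' => B a _ * B a _ * (B a' _ * B a' _))]
    rw [← Fintype.sum_prod_type' (f := fun (c : β × β) (d : β × β) =>
      B d.1 c.1 * B d.1 c.2 * (B d.2 c.1 * B d.2 c.2))]
    refine Fintype.sum_equiv ⟨fun q => ![q.2.1, q.2.2, q.1.1, q.1.2],
      fun x => ((x 2, x 3), (x 0, x 1)), fun q => by simp, fun x => ?_⟩ _ _ fun q => ?_
    · ext i; fin_cases i <;> rfl
    · simp [edgeProd, mul_assoc]
  have hpos : 0 ≤ N * ∑ b ∈ Y, ∑ b' ∈ Y, ∑ a, B a b * B a b' := (sq_nonneg _).trans h1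
  calc (∑ a ∈ X, ∑ b ∈ Y, B a b) ^ 4 = ((∑ a ∈ X, ∑ b ∈ Y, B a b) ^ 2) ^ 2 := by ring
    _ ≤ (N * ∑ b ∈ Y, ∑ b' ∈ Y, ∑ a, B a b * B a b') ^ 2 :=
        pow_le_pow_left₀ (sq_nonneg _) h1 2
    _ = N ^ 2 * (∑ b ∈ Y, ∑ b' ∈ Y, ∑ a, B a b * B a b') ^ 2 := by ring
    _ ≤ N ^ 2 * (N ^ 2 * ∑ b, ∑ b', (∑ a, B a b * B a b') ^ 2) :=
        mul_le_mul_of_nonneg_left h2 (by positivity)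
    _ = _ := by rw [h3]; ring

lemma exists_orderedEdges_eq {m : ℕ} (E : Finset (Fin m × Fin m)) (hE : ∀ e ∈ E, e.1 < e.2) :
    ∃ F : SimpleGraph (Fin m), orderedEdges F = E := by
  classical
  refine ⟨SimpleGraph.fromRel fun i j => (i, j) ∈ E, ?_⟩
  ext ⟨i, j⟩
  simp only [orderedEdges, SimpleGraph.fromRel_adj, mem_filter, mem_univ, true_and]
  constructor
  · rintro ⟨h, -, h' | h'⟩
    · exact h'
    · exact absurd (hE _ h') (not_lt.2 h.le)
  · intro h
    exact ⟨hE _ h, (hE _ h).ne, Or.inl h⟩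

theorem IsQuasirandom.cutSmall {p : ℝ} (hp0 : 0 ≤ p) (hp1 : p ≤ 1) {V : ℕ → ℕ}
    {G : ∀ n, SimpleGraph (Fin (V n))} (hV : Tendsto V atTop atTop) (h : IsQuasirandom p V G) :
    CutSmall p V G := by
  classical
  intro δ hδ
  have hVR : Tendsto (fun n => (V n : ℝ)) atTop atTop := tendsto_natCast_atTop_atTop.comp hV
  set E₀ : Finset (Fin 4 × Fin 4) := {(0, 2), (0, 3), (1, 2), (1, 3)} with hE₀
  have hlt : ∀ e ∈ E₀, e.1 < e.2 := by decide
  have hev : ∀ E ∈ E₀.powerset, ∀ᶠ n in atTop, |∑ x : Fin 4 → Fin (V n),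
      edgeProd (adjInd (G n)) E x - p ^ #E * (V n : ℝ) ^ 4| ≤ δ ^ 4 / 16 * (V n : ℝ) ^ 4 := by
    intro E hE
    obtain ⟨F, hF⟩ := exists_orderedEdges_eq E
      fun e he => hlt e (Finset.mem_powerset.1 hE he)
    filter_upwards [(Asymptotics.isLittleO_iff.1 (h 4 F)) (by positivity : 0 < δ ^ 4 / 32),
      hVR.eventually_ge_atTop (32 * 16 / δ ^ 4 + 1)] with n h1 h2
    have hN : (0 : ℝ) < V n := lt_of_lt_of_le (by positivity) h2
    have : Nonempty (Fin (V n)) := ⟨⟨0, by exact_mod_cast hN⟩⟩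
    have h3 := abs_sum_sub_sum_injective_le (β := Fin (V n)) (edgeProd (adjInd (G n)) E)
      fun x => by
        rw [abs_of_nonneg (edgeProd_nonneg (adjInd_nonneg _) _ _)]
        exact edgeProd_le_one (adjInd_nonneg _) (adjInd_le_one _) _ _
    rw [Real.norm_eq_abs, Real.norm_eq_abs, totalCount_eq_sum, ← card_orderedEdges, hF,
      abs_of_nonneg (by positivity : (0 : ℝ) ≤ (V n : ℝ) ^ 4)] at h1
    have h4 : (4 : ℝ) ^ 2 * (V n : ℝ) ^ 4 / V n ≤ δ ^ 4 / 32 * (V n : ℝ) ^ 4 := by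
      rw [div_le_iff₀ hN]
      have h5 : 32 * 16 / δ ^ 4 ≤ V n := by linarith
      rw [div_le_iff₀ (by positivity)] at h5
      have : (0 : ℝ) ≤ (V n : ℝ) ^ 4 := by positivity
      nlinarith
    rw [Fintype.card_fin] at h3
    push_cast at h3
    refine (abs_sub_le _ _ _).trans ((add_le_add (h3.trans h4) h1).trans_eq (by ring))
  filter_upwards [(Filter.eventually_all_finset _).2 hev] with n hn X Y
  have hpow := pow_four_sum_le_edgeProd (fun a b => adjInd (G n) a b - p) X Y
  have hexp : ∀ x : Fin 4 → Fin (V n), edgeProd (fun a b => adjInd (G n) a b - p) E₀ x =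
      ∑ E ∈ E₀.powerset, edgeProd (adjInd (G n)) E x * (-p) ^ (#E₀ - #E) := by
    intro x
    simp only [edgeProd, sub_eq_add_neg]
    rw [Finset.prod_add]
    refine Finset.sum_congr rfl fun E hE => ?_
    rw [Finset.prod_const, card_sdiff_of_subset (Finset.mem_powerset.1 hE)]
  have hzero : ∑ E ∈ E₀.powerset, p ^ #E * (-p) ^ (#E₀ - #E) = 0 := by
    rw [Finset.sum_pow_mul_eq_add_pow, add_neg_cancel, zero_pow (by decide)]
  have hsum : ∑ x : Fin 4 → Fin (V n), edgeProd (fun a b => adjInd (G n) a b - p) E₀ x =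
      ∑ E ∈ E₀.powerset, (∑ x : Fin 4 → Fin (V n), edgeProd (adjInd (G n)) E x -
        p ^ #E * (V n : ℝ) ^ 4) * (-p) ^ (#E₀ - #E) := by
    simp_rw [hexp, sub_mul]
    rw [Finset.sum_comm, Finset.sum_sub_distrib]
    simp_rw [Finset.sum_mul, mul_right_comm _ ((V n : ℝ) ^ 4)]
    rw [← Finset.sum_mul, hzero, zero_mul, sub_zero]
  have hbound : ∑ x : Fin 4 → Fin (V n), edgeProd (fun a b => adjInd (G n) a b - p) E₀ x ≤
      δ ^ 4 * (V n : ℝ) ^ 4 := by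
    rw [hsum]
    calc _ ≤ ∑ E ∈ E₀.powerset, δ ^ 4 / 16 * (V n : ℝ) ^ 4 := by
          refine (le_abs_self _).trans ((Finset.abs_sum_le_sum_abs _ _).trans
            (Finset.sum_le_sum fun E hE => ?_))
          rw [abs_mul, abs_pow, abs_neg, abs_of_nonneg hp0]
          exact (mul_le_of_le_one_right (abs_nonneg _) (pow_le_one₀ hp0 hp1)).trans (hn E hE)
      _ = _ := by
          rw [Finset.sum_const, card_powerset, show #E₀ = 4 by decide, nsmul_eq_mul]
          push_cast; ring
  rw [Fintype.card_fin] at hpow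
  have h4 : |∑ a ∈ X, ∑ b ∈ Y, (adjInd (G n) a b - p)| ^ 4 ≤ (δ * (V n : ℝ) ^ 2) ^ 4 := by
    rw [Even.pow_abs (by decide)]
    refine hpow.trans ((mul_le_mul_of_nonneg_left hbound (by positivity)).trans_eq (by ring))
  exact (pow_le_pow_iff_left₀ (abs_nonneg _) (by positivity) (by norm_num)).1 h4

lemma two_mul_lt_rpow_sub_rpow {y h : ℝ} (hy0 : 0 < y) (hy1 : y < 1) (hh0 : 0 < h) (hh1 : h ≤ 1) :
    2 * h * y < (1 + h) ^ y - (1 - h) ^ y := by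
  set f : ℝ → ℝ := fun t => (1 + t) ^ y - (1 - t) ^ y - 2 * t * y with hf
  have hcont : ContinuousOn f (Set.Icc 0 1) := by
    refine ContinuousOn.sub (ContinuousOn.sub ?_ ?_) (by fun_prop)
    · exact ContinuousOn.rpow_const (by fun_prop) fun _ _ => Or.inr hy0.le
    · exact ContinuousOn.rpow_const (by fun_prop) fun _ _ => Or.inr hy0.le
  have hmono : StrictMonoOn f (Set.Icc 0 1) := by
    refine strictMonoOn_of_deriv_pos (convex_Icc _ _) hcont fun t ht => ?_
    rw [interior_Icc] at ht
    have h1 : 0 < 1 + t := by linarith [ht.1]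
    have h2 : 0 < 1 - t := by linarith [ht.2]
    have hd : HasDerivAt f (1 * y * (1 + t) ^ (y - 1) - (-1) * y * (1 - t) ^ (y - 1) - 2 * y)
        t := by
      refine HasDerivAt.sub (HasDerivAt.sub ?_ ?_) ?_
      · exact ((hasDerivAt_id t).const_add 1).rpow_const (Or.inl h1.ne')
      · exact ((hasDerivAt_id t).const_sub 1).rpow_const (Or.inl h2.ne')
      · simpa using ((hasDerivAt_id t).const_mul 2).mul_const y
    rw [hd.deriv]
    have ha := Real.rpow_pos_of_pos h1 (y - 1)
    have hb := Real.rpow_pos_of_pos h2 (y - 1)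
    have hab : 1 < (1 + t) ^ (y - 1) * (1 - t) ^ (y - 1) := by
      rw [← Real.mul_rpow h1.le h2.le]
      refine Real.one_lt_rpow_of_pos_of_lt_one_of_neg (mul_pos h1 h2) ?_ (by linarith)
      nlinarith [ht.1]
    have : 2 < (1 + t) ^ (y - 1) + (1 - t) ^ (y - 1) := by
      nlinarith [sq_nonneg ((1 + t) ^ (y - 1) - (1 - t) ^ (y - 1))]
    nlinarith
  have := hmono (Set.left_mem_Icc.2 zero_le_one) ⟨hh0.le, hh1⟩ hh0
  simp only [hf] at this
  norm_num at this
  linarith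

/-- A Hermite–Hadamard type inequality for the concave power `t ↦ t ^ y`. -/
lemma mul_rpow_lt_rpow_sub_rpow {y U V : ℝ} (hy0 : 0 < y) (hy1 : y < 1) (hV : 0 ≤ V) (hVU : V < U) :
    y * (U - V) * ((U + V) / 2) ^ (y - 1) < U ^ y - V ^ y := by
  set M := (U + V) / 2 with hM
  have hMpos : 0 < M := by rw [hM]; linarith
  set h := (U - V) / (U + V) with hh
  have hUV : 0 < U + V := by linarith
  have hU : U = M * (1 + h) := by rw [hM, hh]; field_simp; ring
  have hV' : V = M * (1 - h) := by rw [hM, hh]; field_simp; ring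
  have hh0 : 0 < h := div_pos (by linarith) hUV
  have hh1 : h ≤ 1 := by rw [hh, div_le_one hUV]; linarith
  have key := two_mul_lt_rpow_sub_rpow hy0 hy1 hh0 hh1
  have e1 : U ^ y - V ^ y = M ^ y * ((1 + h) ^ y - (1 - h) ^ y) := by
    conv_lhs => rw [hU, hV', Real.mul_rpow hMpos.le (by linarith),
      Real.mul_rpow hMpos.le (by linarith)]
    ring
  have e2 : y * (U - V) * M ^ (y - 1) = M ^ y * (2 * h * y) := by
    have : U - V = M * (2 * h) := by linarith
    rw [this, Real.rpow_sub_one hMpos.ne']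
    field_simp
  rw [e1, e2]
  exact mul_lt_mul_of_pos_left key (Real.rpow_pos_of_pos hMpos y)

lemma pow_sub_mul_pow_eq_rpow {a b : ℝ} (ha : 0 ≤ a) (hb : 0 ≤ b) {e d : ℕ} (he : 0 < e)
    (hd : d ≤ e) :
    a ^ (e - d) * b ^ d = (a ^ e) ^ (1 - (d : ℝ) / e) * (b ^ e) ^ ((d : ℝ) / e) := by
  have he' : (e : ℝ) ≠ 0 := by positivity
  rw [← Real.rpow_natCast a e, ← Real.rpow_natCast b e, ← Real.rpow_mul ha, ← Real.rpow_mul hb,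
    ← Real.rpow_natCast a (e - d), ← Real.rpow_natCast b d]
  congr 2
  · push_cast [hd]; field_simp
  · field_simp

/-- The system of two equations with unequal `v < u` forces all exponents to be extreme. -/
lemma degree_extreme_of_sum_eq {m e : ℕ} (he : 0 < e) (d : Fin m → ℕ) (hd : ∀ k, d k ≤ e)
    (hsum : ∑ k, d k = 2 * e) {u v s : ℝ} (hv : 0 ≤ v) (hs : 0 ≤ s) (hvu : v ^ e < u ^ e)
    (hu : 0 ≤ u)
    (h1 : ∑ k, v ^ (e - d k) * s ^ d k = (m - 1) * v ^ e + u ^ e)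
    (h2 : ∑ k, u ^ (e - d k) * s ^ d k = (m - 1) * u ^ e + v ^ e) (k : Fin m) :
    d k = 0 ∨ d k = e := by
  have he' : (0 : ℝ) < e := by exact_mod_cast he
  set x : Fin m → ℝ := fun k => (d k : ℝ) / e with hx
  have hx0 : ∀ k, 0 ≤ x k := fun k => by positivity
  have hx1 : ∀ k, x k ≤ 1 := fun k => by
    rw [hx, div_le_one he']; exact_mod_cast hd k
  have hxsum : ∑ k, x k = 2 := by
    rw [hx, ← Finset.sum_div, div_eq_iff he'.ne']; exact_mod_cast hsum
  set U := u ^ e with hU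
  set V := v ^ e with hV
  set S := s ^ e with hS
  have hU0 : 0 ≤ U := by positivity
  have hV0 : 0 ≤ V := by positivity
  have hS0 : 0 ≤ S := by positivity
  simp_rw [pow_sub_mul_pow_eq_rpow hv hs he (hd _)] at h1
  simp_rw [pow_sub_mul_pow_eq_rpow hu hs he (hd _)] at h2
  have hg : ∀ T : ℝ, ∑ k, ((1 - x k) * T + x k * S) = (m - 2) * T + 2 * S := by
    intro T
    rw [Finset.sum_add_distrib, ← Finset.sum_mul, ← Finset.sum_mul, hxsum, Finset.sum_sub_distrib,
      hxsum]
    simp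
  have hgap : ∀ k, 0 ≤ (1 - x k) * V + x k * S - V ^ (1 - x k) * S ^ x k := fun k =>
    sub_nonneg.2 (Real.geom_mean_le_arith_mean2_weighted (by linarith [hx1 k]) (hx0 k) hV0 hS0
      (by ring))
  have hs1 : ∑ k, ((1 - x k) * V + x k * S - V ^ (1 - x k) * S ^ x k) = 2 * S - U - V := by
    rw [Finset.sum_sub_distrib, hg]
    simp only [hx, hU, hV, hS] at h1 ⊢
    rw [h1]; ring
  have hs2 : ∑ k, ((1 - x k) * U + x k * S - U ^ (1 - x k) * S ^ x k) = 2 * S - U - V := by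
    rw [Finset.sum_sub_distrib, hg]
    simp only [hx, hU, hV, hS] at h2 ⊢
    rw [h2]; ring
  have hSM : (U + V) / 2 ≤ S := by
    have := Finset.sum_nonneg fun k (_ : k ∈ univ) => hgap k
    rw [hs1] at this
    linarith
  have hM : 0 < (U + V) / 2 := by linarith
  have hSpos : 0 < S := hM.trans_le hSM
  have hstrict : ∀ k, 0 < x k → x k < 1 →
      (1 - x k) * U + x k * S - U ^ (1 - x k) * S ^ x k <
        (1 - x k) * V + x k * S - V ^ (1 - x k) * S ^ x k := by
    intro k hk0 hk1
    have key := mul_rpow_lt_rpow_sub_rpow (y := 1 - x k) (by linarith) (by linarith) hV0 hvu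
    have hSx : 0 < S ^ x k := Real.rpow_pos_of_pos hSpos _
    have h3 : 1 ≤ ((U + V) / 2) ^ (1 - x k - 1) * S ^ x k := by
      rw [show 1 - x k - 1 = -x k by ring, Real.rpow_neg hM.le, ← div_eq_inv_mul,
        one_le_div (Real.rpow_pos_of_pos hM _)]
      exact Real.rpow_le_rpow hM.le hSM hk0.le
    have h4 := mul_lt_mul_of_pos_right key hSx
    have h5 : (1 - x k) * (U - V) * 1 ≤
        (1 - x k) * (U - V) * (((U + V) / 2) ^ (1 - x k - 1) * S ^ x k) :=
      mul_le_mul_of_nonneg_left h3 (mul_nonneg (by linarith) (by linarith))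
    nlinarith
  have hle : ∀ k, (1 - x k) * U + x k * S - U ^ (1 - x k) * S ^ x k ≤
        (1 - x k) * V + x k * S - V ^ (1 - x k) * S ^ x k := by
    intro k
    rcases (hx0 k).eq_or_lt with h | h
    · rw [← h]; simp
    · rcases (hx1 k).eq_or_lt with h' | h'
      · rw [h']; simp
      · exact (hstrict k h h').le
  have heq := (Finset.sum_eq_sum_iff_of_le fun k _ => hle k).1 (hs2.trans hs1.symm) k (mem_univ k)
  by_contra hcon
  push Not at hcon
  refine (hstrict k ?_ ?_).ne heq
  · have : 0 < d k := Nat.pos_of_ne_zero hcon.1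
    positivity
  · rw [hx, div_lt_one he']
    exact_mod_cast lt_of_le_of_ne (hd k) hcon.2

lemma card_mul_sum_perm {m : ℕ} (H : Fin m → ℝ) (j : Fin m) :
    m * ∑ σ : Equiv.Perm (Fin m), H (σ j) = m.factorial * ∑ k, H k := by
  have h1 : ∀ i, ∑ σ : Equiv.Perm (Fin m), H (σ i) = ∑ σ : Equiv.Perm (Fin m), H (σ j) := by
    intro i
    refine Fintype.sum_equiv (Equiv.mulRight (Equiv.swap i j)) _ _ fun σ => ?_
    simp
  calc (m : ℝ) * ∑ σ : Equiv.Perm (Fin m), H (σ j)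
      = ∑ i, ∑ σ : Equiv.Perm (Fin m), H (σ i) := by
        rw [Finset.sum_congr rfl fun i _ => h1 i, Finset.sum_const, card_univ, Fintype.card_fin,
          nsmul_eq_mul]
    _ = ∑ σ : Equiv.Perm (Fin m), ∑ i, H i := by
        rw [Finset.sum_comm]
        exact Finset.sum_congr rfl fun σ _ => Equiv.sum_comp σ H
    _ = _ := by
        rw [Finset.sum_const, card_univ, Fintype.card_perm, Fintype.card_fin, nsmul_eq_mul]

lemma edgeProd_const {ι β : Type*} (p : ℝ) (E : Finset (ι × ι)) (x : ι → β) :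
    edgeProd (fun _ _ => p) E x = p ^ #E := by
  simp [edgeProd]

lemma exists_perm_apply_eq {m : ℕ} {a b i j : Fin m} (hab : a ≠ b) (hij : i ≠ j) :
    ∃ σ : Equiv.Perm (Fin m), σ a = i ∧ σ b = j := by
  refine ⟨(Equiv.swap a i).trans (Equiv.swap (Equiv.swap a i b) j), ?_, ?_⟩
  · have h1 : i ≠ Equiv.swap a i b := fun h => hab <| by
      have := congrArg (Equiv.swap a i) h
      simpa using this
    simp [Equiv.swap_apply_of_ne_of_ne h1 hij]
  · simp

/-- Strict monotonicity of the symmetrised edge product. -/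
lemma sum_edgeProd_lt {m : ℕ} {E : Finset (Fin m × Fin m)} (hE : ∀ e ∈ E, e.1 < e.2)
    (hne : E.Nonempty) {M₁ M₂ : Fin m → Fin m → ℝ} (h0 : ∀ i j, i ≠ j → 0 ≤ M₁ i j)
    (hle : ∀ i j, i ≠ j → M₁ i j ≤ M₂ i j) (hpos : ∀ i j, i ≠ j → 0 < M₂ i j)
    {i j : Fin m} (hij : i ≠ j) (hlt : M₁ i j < M₂ i j) :
    ∑ σ : Equiv.Perm (Fin m), edgeProd M₁ E σ < ∑ σ : Equiv.Perm (Fin m), edgeProd M₂ E σ := by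
  classical
  have hdist : ∀ (σ : Equiv.Perm (Fin m)), ∀ e ∈ E, σ e.1 ≠ σ e.2 := fun σ e he h =>
    (hE e he).ne (σ.injective h)
  obtain ⟨e₀, he₀⟩ := hne
  obtain ⟨σ₀, h1, h2⟩ := exists_perm_apply_eq (hE e₀ he₀).ne hij
  refine Finset.sum_lt_sum (fun σ _ => Finset.prod_le_prod (fun e he => h0 _ _ (hdist σ e he))
    fun e he => hle _ _ (hdist σ e he)) ⟨σ₀, mem_univ _, ?_⟩
  unfold edgeProd
  rw [← Finset.mul_prod_erase E _ he₀, ← Finset.mul_prod_erase E (fun e => M₂ _ _) he₀, h1, h2]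
  refine (mul_le_mul_of_nonneg_left ?_ (h0 _ _ hij)).trans_lt (mul_lt_mul_of_pos_right hlt ?_)
  · exact Finset.prod_le_prod (fun e he => h0 _ _ (hdist σ₀ e (Finset.mem_of_mem_erase he)))
      fun e he => hle _ _ (hdist σ₀ e (Finset.mem_of_mem_erase he))
  · exact Finset.prod_pos fun e he => hpos _ _ (hdist σ₀ e (Finset.mem_of_mem_erase he))

lemma eq_of_sum_edgeProd_eq {m : ℕ} {E : Finset (Fin m × Fin m)} (hE : ∀ e ∈ E, e.1 < e.2)
    (hne : E.Nonempty) {p w : ℝ} (hp : 0 < p) (hw : 0 ≤ w) {M : Fin m → Fin m → ℝ}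
    (hM : ∀ i j, i ≠ j → M i j = p ∨ M i j = w) {i j : Fin m} (hij : i ≠ j) (hMij : M i j = w)
    (hsum : ∑ σ : Equiv.Perm (Fin m), edgeProd M E σ = m.factorial * p ^ #E) : w = p := by
  have hc : ∑ σ : Equiv.Perm (Fin m), edgeProd (fun _ _ => p) E σ = m.factorial * p ^ #E := by
    simp [edgeProd_const, Fintype.card_perm]
  rcases lt_trichotomy w p with h | h | h
  · refine absurd (hsum.trans hc.symm) (sum_edgeProd_lt hE hne (fun i j hij => ?_)
      (fun i j hij => ?_) (fun _ _ _ => hp) hij (hMij.trans_lt h)).ne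
    · rcases hM i j hij with h' | h' <;> rw [h'] <;> linarith
    · rcases hM i j hij with h' | h' <;> rw [h']; exact h.le
  · exact h
  · refine absurd (hsum.trans hc.symm) (sum_edgeProd_lt hE hne (fun _ _ _ => hp.le)
      (fun i j hij => ?_) (fun i j hij => ?_) hij (h.trans_eq hMij.symm)).ne'
    · rcases hM i j hij with h' | h' <;> rw [h']; exact h.le
    · rcases hM i j hij with h' | h' <;> rw [h']
      · exact hp
      · linarith

/-- A symmetric weight `W` and a potential `g` on `Ω` such that the symmetrised edge product of
any admissible `m`-tuple is an affine function of the potentials; only the points of `R` may be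
repeated in the tuple. -/
structure IsBalanced {m : ℕ} (E : Finset (Fin m × Fin m)) (c : ℝ) {Ω : Type*} (W : Ω → Ω → ℝ)
    (g : Ω → ℝ) (R : Set Ω) : Prop where
  symm : ∀ a b, W a b = W b a
  nonneg : ∀ a b, 0 ≤ W a b
  le_one : ∀ a b, W a b ≤ 1
  abs_le_one : ∀ a, |g a| ≤ 1
  eq : ∀ X : Fin m → Ω, (∀ i j, X i = X j → i = j ∨ X i ∈ R) →
    ∑ σ : Equiv.Perm (Fin m), edgeProd W E (X ∘ σ) = m.factorial * (c + ∑ j, g (X j))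

lemma exists_tendsto_ultrafilter {Ω : Type*} (𝒰 : Ultrafilter Ω) {f : Ω → ℝ} {a b : ℝ}
    (hf : ∀ x, f x ∈ Set.Icc a b) : ∃ l ∈ Set.Icc a b, Tendsto f 𝒰 (nhds l) := by
  obtain ⟨l, hl, h⟩ := isCompact_Icc.ultrafilter_le_nhds (𝒰.map f) (by
    rw [Filter.le_principal_iff]
    exact Filter.Eventually.of_forall (f := (𝒰 : Filter Ω)) hf)
  exact ⟨l, hl, h⟩

/-- A limit point along a non-principal ultrafilter may be adjoined, and may be repeated. -/
theorem IsBalanced.adjoin {m : ℕ} {E : Finset (Fin m × Fin m)} (hE : ∀ e ∈ E, e.1 < e.2) {c : ℝ}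
    {Ω : Type*} {W : Ω → Ω → ℝ} {g : Ω → ℝ} {R : Set Ω} (h : IsBalanced E c W g R)
    (𝒰 : Ultrafilter Ω) (h𝒰 : (𝒰 : Filter Ω) ≤ cofinite) :
    ∃ (W' : Option Ω → Option Ω → ℝ) (g' : Option Ω → ℝ),
      IsBalanced E c W' g' (insert none (some '' R)) ∧
      (∀ a b, W' (some a) (some b) = W a b) ∧ (∀ a, g' (some a) = g a) ∧
      Tendsto g 𝒰 (nhds (g' none)) := by
  classical
  have h1 : ∀ a, ∃ l ∈ Set.Icc (0 : ℝ) 1, Tendsto (fun b => W b a) 𝒰 (nhds l) := fun a =>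
    exists_tendsto_ultrafilter 𝒰 fun b => ⟨h.nonneg b a, h.le_one b a⟩
  choose L hL hLt using h1
  obtain ⟨l, hl, hlt⟩ := exists_tendsto_ultrafilter 𝒰 hL
  obtain ⟨q, hq, hqt⟩ := exists_tendsto_ultrafilter 𝒰 (f := g) (a := -1) (b := 1)
    fun a => abs_le.1 (h.abs_le_one a)
  set W' : Option Ω → Option Ω → ℝ := fun x y =>
    x.elim (y.elim l L) fun a => y.elim (L a) (W a) with hW'
  set g' : Option Ω → ℝ := fun x => x.elim q g with hg'
  have hmem : ∀ x y, W' x y ∈ Set.Icc (0 : ℝ) 1 := by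
    rintro (_ | a) (_ | b)
    · exact hl
    · exact hL b
    · exact hL a
    · exact ⟨h.nonneg a b, h.le_one a b⟩
  have hsymm : ∀ x y, W' x y = W' y x := by
    rintro (_ | a) (_ | b)
    · rfl
    · rfl
    · rfl
    · exact h.symm a b
  have htend : ∀ z, Tendsto (fun ω => W' (some ω) z) 𝒰 (nhds (W' none z)) := by
    rintro (_ | b)
    · exact hlt
    · exact hLt b
  have htg : Tendsto (fun ω => g' (some ω)) 𝒰 (nhds (g' none)) := hqt
  refine ⟨W', g', ⟨hsymm, fun a b => (hmem a b).1, fun a b => (hmem a b).2, ?_, ?_⟩,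
    fun _ _ => rfl, fun _ => rfl, hqt⟩
  · rintro (_ | a)
    · exact abs_le.2 hq
    · exact h.abs_le_one a
  suffices H : ∀ (k : ℕ) (X : Fin m → Option Ω),
      (∀ i j, X i = X j → i = j ∨ X i ∈ insert none (some '' R)) →
      #(univ.filter fun j => X j = none) = k →
      ∑ σ : Equiv.Perm (Fin m), edgeProd W' E (X ∘ σ) = m.factorial * (c + ∑ j, g' (X j)) from
    fun X hX => H _ X hX rfl
  intro k
  induction k with
  | zero =>
    intro X hX hk
    have hsome : ∀ j, ∃ a, X j = some a := fun j => by
      rw [← Option.ne_none_iff_exists']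
      intro hj
      rw [Finset.card_eq_zero] at hk
      exact Finset.notMem_empty j (hk ▸ Finset.mem_filter.2 ⟨mem_univ _, hj⟩)
    choose Y hY using hsome
    have hXY : X = fun j => some (Y j) := funext hY
    subst hXY
    refine Eq.trans ?_ (h.eq Y fun i j hij => ?_)
    · rfl
    · rcases hX i j (congrArg some hij) with h' | h'
      · exact Or.inl h'
      · refine Or.inr ?_
        simpa using h'
  | succ k ih =>
    intro X hX hk
    obtain ⟨j, hj⟩ : ∃ j, X j = none := by
      have : (univ.filter fun j => X j = none).Nonempty := by
        rw [← Finset.card_pos, hk]; omega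
      obtain ⟨j, hj⟩ := this
      exact ⟨j, (Finset.mem_filter.1 hj).2⟩
    have hne : ∀ i, ∀ᶠ ω in (𝒰 : Filter Ω), X i ≠ some ω := by
      intro i
      refine h𝒰 ?_
      rw [Filter.mem_cofinite]
      refine Set.Subsingleton.finite ?_
      intro a ha b hb
      simp only [ne_eq, Set.mem_compl_iff, Set.mem_ofPred_eq, not_not] at ha hb
      exact Option.some_injective _ (ha.symm.trans hb)
    have hev : ∀ᶠ ω in (𝒰 : Filter Ω),
        ∑ σ : Equiv.Perm (Fin m), edgeProd W' E (Function.update X j (some ω) ∘ σ) =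
          m.factorial * (c + ∑ i, g' (Function.update X j (some ω) i)) := by
      filter_upwards [Filter.eventually_all.2 hne] with ω hω
      refine ih _ (fun a b hab => ?_) ?_
      · by_cases ha : a = j <;> by_cases hb : b = j
        · exact Or.inl (ha.trans hb.symm)
        · subst ha
          rw [Function.update_self, Function.update_of_ne hb] at hab
          exact absurd hab.symm (hω b)
        · subst hb
          rw [Function.update_self, Function.update_of_ne ha] at hab
          exact absurd hab (hω a)
        · rw [Function.update_of_ne ha, Function.update_of_ne hb] at hab
          rw [Function.update_of_ne ha]
          exact hX a b hab
      · have : (univ.filter fun i => Function.update X j (some ω) i = none) =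
            (univ.filter fun i => X i = none).erase j := by
          ext i
          by_cases hi : i = j
          · subst hi; simp
          · simp [hi]
        rw [this, Finset.card_erase_of_mem (by simpa using hj), hk]
        rfl
    have hcoord : ∀ i, i ≠ j → ∀ ω, Function.update X j (some ω) i = X i := fun i hi ω =>
      Function.update_of_ne hi _ _
    have hW't : ∀ a b, a ≠ b → Tendsto (fun ω => W' (Function.update X j (some ω) a)
        (Function.update X j (some ω) b)) 𝒰 (nhds (W' (X a) (X b))) := by
      intro a b hab
      by_cases ha : a = j
      · subst ha
        simp only [Function.update_self, hcoord b hab.symm, hj]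
        exact htend _
      · by_cases hb : b = j
        · subst hb
          simp only [Function.update_self, hcoord a hab, hj]
          simp only [hsymm (X a)]
          exact htend _
        · simp only [hcoord a ha, hcoord b hb]
          exact tendsto_const_nhds
    have hlhs : Tendsto (fun ω => ∑ σ : Equiv.Perm (Fin m),
        edgeProd W' E (Function.update X j (some ω) ∘ σ)) 𝒰
        (nhds (∑ σ : Equiv.Perm (Fin m), edgeProd W' E (X ∘ σ))) :=
      tendsto_finsetSum _ fun σ _ => tendsto_finsetProd _ fun e he =>
        hW't _ _ fun h' => (hE e he).ne (σ.injective h')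
    have hrhs : Tendsto (fun ω => (m.factorial : ℝ) *
        (c + ∑ i, g' (Function.update X j (some ω) i))) 𝒰
        (nhds (m.factorial * (c + ∑ i, g' (X i)))) := by
      refine (Tendsto.const_add _ (tendsto_finsetSum _ fun i _ => ?_)).const_mul _
      by_cases hi : i = j
      · subst hi
        simp only [Function.update_self, hj]
        exact htg
      · simp only [hcoord i hi]
        exact tendsto_const_nhds
    exact tendsto_nhds_unique hlhs (hrhs.congr' (hev.mono fun ω hω => hω.symm))

/-- A balanced system on `ℕ` with vanishing potential has constant weight. -/
theorem IsBalanced.weight_eq {m : ℕ} {E : Finset (Fin m × Fin m)} (hE : ∀ e ∈ E, e.1 < e.2)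
    (hne : E.Nonempty) {p : ℝ} (hp : 0 < p) {W : ℕ → ℕ → ℝ}
    (h : IsBalanced E (p ^ #E) W (fun _ => 0) ∅) {a b : ℕ} (hab : a ≠ b) : W a b = p := by
  classical
  obtain ⟨W', g', h', hW', hg', hlim⟩ := h.adjoin hE (hyperfilter ℕ) hyperfilter_le_cofinite
  have hg0 : ∀ z, g' z = 0 := by
    rintro (_ | z)
    · exact tendsto_nhds_unique hlim tendsto_const_nhds
    · exact hg' z
  have heq : ∀ X : Fin m → Option ℕ, (∀ i j, X i = X j → i = j ∨ X i = none) →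
      ∑ σ : Equiv.Perm (Fin m), edgeProd (fun i j => W' (X i) (X j)) E σ =
        m.factorial * p ^ #E := by
    intro X hX
    have := h'.eq X fun i j hij => (hX i j hij).imp_right fun h0 => by simp [h0]
    simp only [hg0, Finset.sum_const_zero, add_zero] at this
    exact this
  obtain ⟨e, he⟩ := hne
  have hlt := hE e he
  have hnn : W' none none = p := by
    have h0 := heq (fun _ => none) fun _ _ _ => Or.inr rfl
    simp only [edgeProd_const, Finset.sum_const, card_univ, Fintype.card_perm, Fintype.card_fin,
      nsmul_eq_mul] at h0
    have h1 := mul_left_cancel₀ (by positivity) h0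
    exact (pow_left_inj₀ (h'.nonneg _ _) hp.le (Finset.card_ne_zero_of_mem he)).1 h1
  have hsome : ∀ c : ℕ, W' (some c) none = p := by
    intro c
    refine eq_of_sum_edgeProd_eq hE ⟨e, he⟩ hp (h'.nonneg _ _) (i := e.1) (j := e.2)
      (fun i j hij => ?_) hlt.ne ?_
      (heq (Function.update (fun _ => none) e.1 (some c)) fun i j hij => ?_)
    · by_cases hi : i = e.1
      · subst hi
        rw [Function.update_self, Function.update_of_ne hij.symm]
        exact Or.inr rfl
      · rw [Function.update_of_ne hi]
        by_cases hj : j = e.1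
        · subst hj
          rw [Function.update_self, h'.symm]
          exact Or.inr rfl
        · rw [Function.update_of_ne hj]
          exact Or.inl hnn
    · rw [Function.update_self, Function.update_of_ne hlt.ne']
    · by_cases hi : i = e.1
      · by_cases hj : j = e.1
        · exact Or.inl (hi.trans hj.symm)
        · subst hi
          rw [Function.update_self, Function.update_of_ne hj] at hij
          exact absurd hij (by simp)
      · rw [Function.update_of_ne hi]
        exact Or.inr rfl
  rw [← hW']
  set X : Fin m → Option ℕ := fun i => if i = e.1 then some a else if i = e.2 then some b else none
    with hX
  have hX1 : X e.1 = some a := by simp [hX]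
  have hX2 : X e.2 = some b := by simp [hX, hlt.ne']
  have hX3 : ∀ i, i ≠ e.1 → i ≠ e.2 → X i = none := fun i h1 h2 => by simp [hX, h1, h2]
  refine eq_of_sum_edgeProd_eq hE ⟨e, he⟩ hp (h'.nonneg _ _) (i := e.1) (j := e.2)
      (fun i j hij => ?_) hlt.ne ?_ (heq X fun i j hij => ?_)
  · have hnone : ∀ z, W' z none = p := by
      rintro (_ | z)
      · exact hnn
      · exact hsome z
    by_cases hi1 : i = e.1
    · by_cases hj2 : j = e.2
      · rw [hi1, hj2, hX1, hX2]; exact Or.inr rfl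
      · rw [hX3 j (fun h => hij (hi1.trans h.symm)) hj2]; exact Or.inl (hnone _)
    · by_cases hi2 : i = e.2
      · by_cases hj1 : j = e.1
        · rw [hi2, hj1, hX1, hX2, h'.symm]; exact Or.inr rfl
        · rw [hX3 j hj1 (fun h => hij (hi2.trans h.symm))]; exact Or.inl (hnone _)
      · rw [hX3 i hi1 hi2, h'.symm]; exact Or.inl (hnone _)
  · rw [hX1, hX2]
  · by_cases hi1 : i = e.1
    · by_cases hj1 : j = e.1
      · exact Or.inl (hi1.trans hj1.symm)
      · by_cases hj2 : j = e.2
        · rw [hi1, hj2, hX1, hX2] at hij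
          exact absurd (Option.some_injective _ hij) hab
        · rw [hi1, hX1, hX3 j hj1 hj2] at hij
          exact absurd hij (by simp)
    · by_cases hi2 : i = e.2
      · by_cases hj2 : j = e.2
        · exact Or.inl (hi2.trans hj2.symm)
        · by_cases hj1 : j = e.1
          · rw [hi2, hj1, hX1, hX2] at hij
            exact absurd (Option.some_injective _ hij) hab.symm
          · rw [hi2, hX2, hX3 j hj1 hj2] at hij
            exact absurd hij (by simp)
      · exact Or.inr (hX3 i hi1 hi2)

/-- The number of pairs in `E` containing `k`. -/
def pairDegree {m : ℕ} (E : Finset (Fin m × Fin m)) (k : Fin m) : ℕ :=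
  #(E.filter fun e => e.1 = k ∨ e.2 = k)

lemma sum_pairDegree {m : ℕ} {E : Finset (Fin m × Fin m)} (hE : ∀ e ∈ E, e.1 < e.2) :
    ∑ k, pairDegree E k = 2 * #E := by
  simp only [pairDegree, Finset.card_filter]
  rw [Finset.sum_comm, mul_comm, ← smul_eq_mul, ← Finset.sum_const]
  refine Finset.sum_congr rfl fun e he => ?_
  rw [← Finset.card_filter]
  have : (univ.filter fun k => e.1 = k ∨ e.2 = k) = {e.1, e.2} := by
    ext k; simp [eq_comm]
  rw [this, Finset.card_pair (hE e he).ne]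

lemma edgeProd_update_const {m : ℕ} {E : Finset (Fin m × Fin m)} (hE : ∀ e ∈ E, e.1 < e.2)
    {Ω : Type*} {W : Ω → Ω → ℝ} (hW : ∀ a b, W a b = W b a) (A B : Ω) (k : Fin m) :
    edgeProd W E (Function.update (fun _ => B) k A) =
      W B B ^ (#E - pairDegree E k) * W A B ^ pairDegree E k := by
  classical
  unfold edgeProd
  rw [← Finset.prod_filter_mul_prod_filter_not E (fun e => e.1 = k ∨ e.2 = k), mul_comm]
  congr 1
  · rw [Finset.prod_congr rfl (g := fun _ => W B B), Finset.prod_const]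
    · congr 1
      have := Finset.card_filter_add_card_filter_not (s := E) fun e => e.1 = k ∨ e.2 = k
      unfold pairDegree
      omega
    · intro e he
      have := (Finset.mem_filter.1 he).2
      push Not at this
      rw [Function.update_of_ne this.1, Function.update_of_ne this.2]
  · rw [Finset.prod_congr rfl (g := fun _ => W A B), Finset.prod_const, pairDegree]
    intro e he
    obtain ⟨he1, h | h⟩ := Finset.mem_filter.1 he
    · subst h
      rw [Function.update_self, Function.update_of_ne (hE e he1).ne']
    · subst h
      rw [Function.update_self, Function.update_of_ne (hE e he1).ne, hW]

lemma IsBalanced.pow_eq {m : ℕ} {E : Finset (Fin m × Fin m)} {c : ℝ} {Ω : Type*} {W : Ω → Ω → ℝ}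
    {g : Ω → ℝ} {R : Set Ω} (h : IsBalanced E c W g R) {A : Ω} (hA : A ∈ R) :
    W A A ^ #E = c + m * g A := by
  have h0 := h.eq (fun _ => A) fun _ _ _ => Or.inr hA
  have h1 : ∀ σ : Equiv.Perm (Fin m), edgeProd W E ((fun _ => A) ∘ σ) = W A A ^ #E := fun σ => by
    simp [edgeProd]
  simp only [h1, Finset.sum_const, card_univ, Fintype.card_perm, Fintype.card_fin,
    nsmul_eq_mul] at h0
  exact mul_left_cancel₀ (by positivity) h0

lemma IsBalanced.sum_pow_eq {m : ℕ} {E : Finset (Fin m × Fin m)} (hE : ∀ e ∈ E, e.1 < e.2)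
    (hm : 0 < m) {c : ℝ} {Ω : Type*} {W : Ω → Ω → ℝ} {g : Ω → ℝ} {R : Set Ω}
    (h : IsBalanced E c W g R) {A B : Ω} (hA : A ∈ R) (hB : B ∈ R) :
    ∑ k, W B B ^ (#E - pairDegree E k) * W A B ^ pairDegree E k =
      (m - 1) * W B B ^ #E + W A A ^ #E := by
  classical
  set j₀ : Fin m := ⟨0, hm⟩
  have h0 := h.eq (Function.update (fun _ => B) j₀ A) fun i j _ => Or.inr (by
    by_cases hi : i = j₀
    · subst hi; simpa using hA
    · simpa [hi] using hB)
  have h1 : ∀ σ : Equiv.Perm (Fin m), Function.update (fun _ => B) j₀ A ∘ σ =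
      Function.update (fun _ => B) (σ⁻¹ j₀) A := fun σ => by
    ext k
    by_cases hk : σ k = j₀
    · have : k = σ⁻¹ j₀ := by rw [← hk]; simp
      simp [hk, ← this]
    · have : k ≠ σ⁻¹ j₀ := fun h => hk (by rw [h]; simp)
      rw [Function.comp_apply, Function.update_of_ne hk, Function.update_of_ne this]
  simp only [h1, edgeProd_update_const hE h.symm] at h0
  have h6 := Equiv.sum_comp (Equiv.inv (Equiv.Perm (Fin m))) (fun σ : Equiv.Perm (Fin m) =>
    W B B ^ (#E - pairDegree E (σ j₀)) * W A B ^ pairDegree E (σ j₀))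
  simp only [Equiv.inv_apply] at h6
  rw [h6] at h0
  have h2 := card_mul_sum_perm
    (fun k => W B B ^ (#E - pairDegree E k) * W A B ^ pairDegree E k) j₀
  rw [h0, ← Finset.add_sum_erase univ _ (mem_univ j₀), Function.update_self,
    Finset.sum_congr rfl (g := fun _ => g B) (fun i hi => by
      rw [Function.update_of_ne (Finset.ne_of_mem_erase hi)]), Finset.sum_const,
    Finset.card_erase_of_mem (mem_univ _), card_univ, Fintype.card_fin, nsmul_eq_mul] at h2
  have h3 := h.pow_eq hA
  have h4 := h.pow_eq hB
  push_cast [Nat.cast_sub (Nat.one_le_iff_ne_zero.2 hm.ne')] at h2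
  have hf : (m.factorial : ℝ) ≠ 0 := by positivity
  have h5 : ∑ k, W B B ^ (#E - pairDegree E k) * W A B ^ pairDegree E k =
      m * (c + (g A + (m - 1) * g B)) := by
    refine mul_left_cancel₀ hf ?_
    rw [← h2]; ring
  rw [h5, h3, h4]
  ring

/-- Two repeatable points cannot have potentials of opposite signs. -/
theorem IsBalanced.not_lt_of_mem {m : ℕ} {E : Finset (Fin m × Fin m)} (hE : ∀ e ∈ E, e.1 < e.2)
    (hE2 : 2 ≤ #E) {c : ℝ} {Ω : Type*} {W : Ω → Ω → ℝ} {g : Ω → ℝ} {R : Set Ω}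
    (h : IsBalanced E c W g R) {A B : Ω} (hA : A ∈ R) (hB : B ∈ R) : ¬ g B < g A := by
  intro hlt
  obtain ⟨e₁, he₁, e₂, he₂, hne⟩ := Finset.one_lt_card.1 hE2
  have hm : 0 < m := e₁.1.pos
  have hm' : (0 : ℝ) < m := by exact_mod_cast hm
  have hAB := h.sum_pow_eq hE hm hA hB
  have hBA := h.sum_pow_eq hE hm hB hA
  simp only [h.symm B A] at hBA
  have key := degree_extreme_of_sum_eq (by omega) (pairDegree E)
    (fun k => Finset.card_filter_le _ _) (sum_pairDegree hE) (h.nonneg B B) (h.nonneg A B)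
    (by rw [h.pow_eq hA, h.pow_eq hB]; nlinarith) (h.nonneg A A) hAB hBA
  have hall : ∀ k, (e₁.1 = k ∨ e₁.2 = k) → e₂.1 = k ∨ e₂.2 = k := by
    intro k hk
    rcases key k with h0 | h0
    · exact absurd (Finset.card_eq_zero.1 h0)
        (Finset.ne_empty_of_mem (Finset.mem_filter.2 ⟨he₁, hk⟩))
    · have := Finset.filter_true_of_mem (s := E) (p := fun e => e.1 = k ∨ e.2 = k)
      exact (Finset.card_filter_eq_iff.1 h0) e₂ he₂
  have h1 := hE _ he₁
  have h2 := hE _ he₂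
  rcases hall _ (Or.inl rfl) with h3 | h3 <;> rcases hall _ (Or.inr rfl) with h4 | h4
  · exact h1.ne (h3.symm.trans h4)
  · exact hne (Prod.ext h3.symm h4.symm)
  · rw [h3, h4] at h2; exact absurd h1 (not_lt.2 h2.le)
  · exact h1.ne (h3.symm.trans h4)

/-- A balanced system on `ℕ` cannot have potentials of both signs bounded away from zero. -/
theorem IsBalanced.false_of_alternating {m : ℕ} {E : Finset (Fin m × Fin m)}
    (hE : ∀ e ∈ E, e.1 < e.2) (hE2 : 2 ≤ #E) {c τ : ℝ} (hτ : 0 < τ) {W : ℕ → ℕ → ℝ} {g : ℕ → ℝ}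
    (h : IsBalanced E c W g ∅) (heven : ∀ t, τ ≤ g (2 * t)) (hodd : ∀ t, g (2 * t + 1) ≤ -τ) :
    False := by
  have hi₁ : Function.Injective fun t : ℕ => 2 * t := fun a b hab => by simpa using hab
  have hi₂ : Function.Injective fun t : ℕ => some (2 * t + 1) := fun a b hab => by simpa using hab
  obtain ⟨W₁, g₁, h₁, -, hg₁, hlim₁⟩ := h.adjoin hE ((hyperfilter ℕ).map fun t => 2 * t)
    ((tendsto_map' (hi₁.tendsto_cofinite.mono_left hyperfilter_le_cofinite)).trans le_rfl)
  obtain ⟨W₂, g₂, h₂, -, hg₂, hlim₂⟩ := h₁.adjoin hE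
    ((hyperfilter ℕ).map fun t => some (2 * t + 1))
    ((tendsto_map' (hi₂.tendsto_cofinite.mono_left hyperfilter_le_cofinite)).trans le_rfl)
  have hA : τ ≤ g₁ none := ge_of_tendsto hlim₁ (by
    rw [Ultrafilter.coe_map]
    exact Filter.eventually_map.2 (Filter.Eventually.of_forall heven))
  have hB : g₂ none ≤ -τ := le_of_tendsto hlim₂ (by
    rw [Ultrafilter.coe_map]
    exact Filter.eventually_map.2 (Filter.Eventually.of_forall fun t => by
      rw [hg₁]; exact hodd t))
  refine h₂.not_lt_of_mem hE hE2 (A := some none) (B := none) (by simp) (by simp) ?_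
  rw [hg₂]
  linarith

/-- An approximate, finite version of a balanced system: the relation `R` holds for all but an
`η` proportion of the pairs, and the balance equation holds up to `η` for tuples of pairwise
`R`-related points. -/
structure ApproxBalanced {m : ℕ} (E : Finset (Fin m × Fin m)) (c η : ℝ) {k : ℕ}
    (w : Fin k → Fin k → ℝ) (g : Fin k → ℝ) (R : Fin k → Fin k → Prop) : Prop where
  symm : ∀ a b, w a b = w b a
  nonneg : ∀ a b, 0 ≤ w a b
  le_one : ∀ a b, w a b ≤ 1
  abs_le_one : ∀ a, |g a| ≤ 1
  rel_symm : ∀ a b, R a b → R b a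
  card_not_rel : (Nat.card {q : Fin k × Fin k // ¬ R q.1 q.2} : ℝ) ≤ η * (k : ℝ) ^ 2
  sum_le : |∑ a, g a| ≤ η * k
  approx : ∀ x : Fin m → Fin k, (∀ i j, i ≠ j → R (x i) (x j)) →
    |∑ σ : Equiv.Perm (Fin m), edgeProd w E (x ∘ σ) - m.factorial * (c + ∑ j, g (x j))| ≤ η

lemma exists_isBalanced_limit {m : ℕ} {E : Finset (Fin m × Fin m)} {c : ℝ}
    {k : ℕ → ℕ} {η : ℕ → ℝ} {w : ∀ n, Fin (k n) → Fin (k n) → ℝ} {g : ∀ n, Fin (k n) → ℝ}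
    {R : ∀ n, Fin (k n) → Fin (k n) → Prop}
    (h : ∀ n, ApproxBalanced E c (η n) (w n) (g n) (R n)) (hη : Tendsto η atTop (nhds 0))
    (y : ∀ n, ℕ → Fin (k n)) (hy : ∀ n a b, a < b → b < n → R n (y n a) (y n b)) :
    ∃ (W : ℕ → ℕ → ℝ) (γ : ℕ → ℝ), IsBalanced E c W γ ∅ ∧
      (∀ a b, Tendsto (fun n => w n (y n a) (y n b)) (hyperfilter ℕ) (nhds (W a b))) ∧
      ∀ a, Tendsto (fun n => g n (y n a)) (hyperfilter ℕ) (nhds (γ a)) := by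
  have h1 : ∀ a b, ∃ l ∈ Set.Icc (0 : ℝ) 1,
      Tendsto (fun n => w n (y n a) (y n b)) (hyperfilter ℕ) (nhds l) := fun a b =>
    exists_tendsto_ultrafilter _ fun n => ⟨(h n).nonneg _ _, (h n).le_one _ _⟩
  have h2 : ∀ a, ∃ l ∈ Set.Icc (-1 : ℝ) 1,
      Tendsto (fun n => g n (y n a)) (hyperfilter ℕ) (nhds l) := fun a =>
    exists_tendsto_ultrafilter _ fun n => abs_le.1 ((h n).abs_le_one _)
  choose W hW hWt using h1
  choose γ hγ hγt using h2
  refine ⟨W, γ, ⟨fun a b => ?_, fun a b => (hW a b).1, fun a b => (hW a b).2,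
    fun a => abs_le.2 (hγ a), fun X hX => ?_⟩, hWt, hγt⟩
  · refine tendsto_nhds_unique (hWt a b) ((hWt b a).congr fun n => (h n).symm _ _)
  · have hle : (hyperfilter ℕ : Filter ℕ) ≤ atTop := Nat.hyperfilter_le_atTop
    have hX' : ∀ i j, i ≠ j → X i ≠ X j := fun i j hij hXij => by
      rcases hX i j hXij with h' | h'
      · exact hij h'
      · exact h'
    have hlim : Tendsto (fun n => ∑ σ : Equiv.Perm (Fin m), edgeProd (w n) E ((y n ∘ X) ∘ σ) -
        m.factorial * (c + ∑ j, g n ((y n ∘ X) j))) (hyperfilter ℕ)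
        (nhds (∑ σ : Equiv.Perm (Fin m), edgeProd W E (X ∘ σ) -
          m.factorial * (c + ∑ j, γ (X j)))) :=
      (tendsto_finsetSum _ fun σ _ => tendsto_finsetProd _ fun e _ => hWt _ _).sub
        ((Tendsto.const_add _ (tendsto_finsetSum _ fun j _ => hγt _)).const_mul _)
    have hev : ∀ᶠ n in (hyperfilter ℕ : Filter ℕ),
        |∑ σ : Equiv.Perm (Fin m), edgeProd (w n) E ((y n ∘ X) ∘ σ) -
        m.factorial * (c + ∑ j, g n ((y n ∘ X) j))| ≤ η n := by
      refine hle ?_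
      have : ∀ᶠ n in atTop, ∀ i, X i < n :=
        Filter.eventually_all.2 fun i => eventually_gt_atTop (X i)
      filter_upwards [this] with n hn
      refine (h n).approx _ fun i j hij => ?_
      rcases lt_or_gt_of_ne (hX' i j hij) with h' | h'
      · exact hy n _ _ h' (hn j)
      · exact (h n).rel_symm _ _ (hy n _ _ h' (hn i))
    have := le_of_tendsto_of_tendsto hlim.abs (hη.mono_left hle) hev
    exact sub_eq_zero.1 (abs_eq_zero.1 (le_antisymm this (abs_nonneg _)))

/-- Greedy extension of a finite sequence. -/
lemma exists_greedy_sequence {ι : Type*} (R : ι → ι → Prop) (Q : ℕ → ι → Prop) {n₀ T : ℕ}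
    (hT : n₀ ≤ T) (y₀ : ℕ → ι) (hQ : ∀ a < n₀, Q a (y₀ a))
    (hR : ∀ a b, a < b → b < n₀ → R (y₀ a) (y₀ b))
    (step : ∀ n, n₀ ≤ n → n < T → ∀ y : ℕ → ι, (∀ a < n, Q a (y a)) →
      ∃ v, Q n v ∧ ∀ a < n, R (y a) v) :
    ∃ y : ℕ → ι, (∀ a < T, Q a (y a)) ∧ (∀ a b, a < b → b < T → R (y a) (y b)) ∧
      ∀ a < n₀, y a = y₀ a := by
  induction T, hT using Nat.le_induction with
  | base => exact ⟨y₀, hQ, hR, fun _ _ => rfl⟩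
  | succ T hT ih =>
    obtain ⟨y, h1, h2, h3⟩ := ih fun n hn hnT => step n hn (hnT.trans (Nat.lt_succ_self T))
    obtain ⟨v, hv, hv'⟩ := step T hT (Nat.lt_succ_self T) y h1
    refine ⟨Function.update y T v, fun a ha => ?_, fun a b hab hb => ?_, fun a ha => ?_⟩
    · rcases (Nat.lt_succ_iff.1 ha).eq_or_lt with h | h
      · subst h; simpa using hv
      · rw [Function.update_of_ne h.ne]; exact h1 a h
    · have haT : a < T := hab.trans_le (Nat.lt_succ_iff.1 hb)
      rw [Function.update_of_ne haT.ne]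
      rcases (Nat.lt_succ_iff.1 hb).eq_or_lt with h | h
      · subst h; simpa using hv' a haT
      · rw [Function.update_of_ne h.ne]; exact h2 a b hab h
    · rw [Function.update_of_ne (ha.trans_le hT).ne]; exact h3 a ha

open Classical in
/-- The points having at most `s` non-neighbours with respect to `R`. -/
noncomputable def lightPoints {k : ℕ} (R : Fin k → Fin k → Prop) (s : ℝ) : Finset (Fin k) :=
  univ.filter fun a => (#(univ.filter fun b => ¬ R a b) : ℝ) ≤ s

open Classical in
lemma card_not_lightPoints_le {k : ℕ} (R : Fin k → Fin k → Prop) {ρ : ℝ} (hρ : 0 < ρ)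
    (h : (Nat.card {q : Fin k × Fin k // ¬ R q.1 q.2} : ℝ) ≤ ρ ^ 2 * (k : ℝ) ^ 2) :
    (#(univ.filter fun a => a ∉ lightPoints R (ρ * k)) : ℝ) ≤ ρ * k := by
  rcases Nat.eq_zero_or_pos k with hk | hk
  · subst hk; simp
  have hk' : (0 : ℝ) < k := by exact_mod_cast hk
  have hsum : (Nat.card {q : Fin k × Fin k // ¬ R q.1 q.2} : ℝ) =
      ∑ a, (#(univ.filter fun b => ¬ R a b) : ℝ) := by
    rw [Nat.card_eq_fintype_card, Fintype.card_subtype, Finset.card_filter,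
      Fintype.sum_prod_type]
    push_cast
    refine Finset.sum_congr rfl fun a _ => ?_
    rw [Finset.card_filter]; push_cast; rfl
  have h1 : (#(univ.filter fun a => a ∉ lightPoints R (ρ * k)) : ℝ) * (ρ * k) ≤
      ∑ a, (#(univ.filter fun b => ¬ R a b) : ℝ) := by
    rw [← nsmul_eq_mul, ← Finset.sum_const]
    refine (Finset.sum_le_sum fun a ha => ?_).trans
      (Finset.sum_le_sum_of_subset_of_nonneg (subset_univ _) fun _ _ _ => by positivity)
    have := (Finset.mem_filter.1 ha).2
    simp only [lightPoints, Finset.mem_filter, mem_univ, true_and, not_le] at this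
    exact this.le
  rw [← hsum] at h1
  have h2 : (#(univ.filter fun a => a ∉ lightPoints R (ρ * k)) : ℝ) * (ρ * k) ≤
      (ρ * k) * (ρ * k) := h1.trans (h.trans_eq (by ring))
  exact le_of_mul_le_mul_right h2 (by positivity)

lemma exists_rel_light_of_lt_card {k : ℕ} (R : Fin k → Fin k → Prop) {ρ : ℝ} (hρ : 0 < ρ)
    (h : (Nat.card {q : Fin k × Fin k // ¬ R q.1 q.2} : ℝ) ≤ ρ ^ 2 * (k : ℝ) ^ 2)
    (S : Finset (Fin k)) (n : ℕ) (hS : (n + 1) * (ρ * k) < #S) (y : ℕ → Fin k)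
    (hy : ∀ a < n, y a ∈ lightPoints R (ρ * k)) :
    ∃ v, (v ∈ lightPoints R (ρ * k) ∧ v ∈ S) ∧ ∀ a < n, R (y a) v := by
  classical
  by_contra hcon
  push Not at hcon
  have hsub : S ⊆ (univ.filter fun a => a ∉ lightPoints R (ρ * k)) ∪
      (Finset.range n).biUnion fun a => univ.filter fun b => ¬ R (y a) b := by
    intro v hv
    by_cases hl : v ∈ lightPoints R (ρ * k)
    · obtain ⟨a, ha, har⟩ := hcon v ⟨hl, hv⟩
      exact Finset.mem_union_right _
        (Finset.mem_biUnion.2 ⟨a, by simpa using ha, by simpa using har⟩)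
    · exact Finset.mem_union_left _ (by simpa using hl)
  have h1 := (card_le_card hsub).trans ((card_union_le _ _).trans
    (Nat.add_le_add_left card_biUnion_le _))
  have h2 : (#S : ℝ) ≤ (#(univ.filter fun a => a ∉ lightPoints R (ρ * k)) : ℝ) +
      ∑ a ∈ Finset.range n, (#(univ.filter fun b => ¬ R (y a) b) : ℝ) := by exact_mod_cast h1
  have h3 : ∑ a ∈ Finset.range n, (#(univ.filter fun b => ¬ R (y a) b) : ℝ) ≤ n * (ρ * k) := by
    calc _ ≤ ∑ a ∈ Finset.range n, ρ * k := Finset.sum_le_sum fun a ha => by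
          have := hy a (Finset.mem_range.1 ha)
          simpa [lightPoints] using this
      _ = _ := by simp
  have := card_not_lightPoints_le R hρ h
  linarith

lemma ApproxBalanced.mono {m : ℕ} {E : Finset (Fin m × Fin m)} {c η η' : ℝ} {k : ℕ}
    {w : Fin k → Fin k → ℝ} {g : Fin k → ℝ} {R : Fin k → Fin k → Prop}
    (h : ApproxBalanced E c η w g R) (hη : η ≤ η') : ApproxBalanced E c η' w g R :=
  ⟨h.symm, h.nonneg, h.le_one, h.abs_le_one, h.rel_symm,
    h.card_not_rel.trans (mul_le_mul_of_nonneg_right hη (by positivity)),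
    h.sum_le.trans (mul_le_mul_of_nonneg_right hη (by positivity)),
    fun x hx => (h.approx x hx).trans hη⟩

lemma lt_card_filter_of_lt_card_abs {k : ℕ} {g : Fin k → ℝ} (hg : ∀ a, |g a| ≤ 1) {δ η : ℝ}
    (hδ : 0 < δ) (hη : η ≤ δ ^ 2 / 2) (hsum : |∑ a, g a| ≤ η * k)
    (hbad : δ * k < #(univ.filter fun a => δ < |g a|)) :
    δ ^ 2 / 8 * k < #(univ.filter fun a => δ ^ 2 / 8 ≤ g a) := by
  set τ := δ ^ 2 / 8 with hτ
  have hτ0 : 0 < τ := by positivity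
  have h1 : δ * #(univ.filter fun a => δ < |g a|) ≤ ∑ a, |g a| := by
    rw [mul_comm, ← nsmul_eq_mul, ← Finset.sum_const]
    exact (Finset.sum_le_sum fun a ha => (Finset.mem_filter.1 ha).2.le).trans
      (Finset.sum_le_sum_of_subset_of_nonneg (subset_univ _) fun _ _ _ => abs_nonneg _)
  have h2 : ∑ a, |g a| ≤ ∑ a, (2 * (if τ ≤ g a then (1 : ℝ) else 0) + (2 * τ - g a)) := by
    refine Finset.sum_le_sum fun a _ => ?_
    have := abs_le.1 (hg a)
    split_ifs with h
    · rw [abs_of_nonneg (hτ0.le.trans h)]; linarith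
    · rcases abs_cases (g a) with ⟨h', _⟩ | ⟨h', _⟩ <;> rw [h'] <;> linarith
  rw [Finset.sum_add_distrib, ← Finset.mul_sum, Finset.sum_sub_distrib, Finset.sum_boole,
    Finset.sum_const, card_univ, Fintype.card_fin, nsmul_eq_mul] at h2
  have h3 := (abs_le.1 hsum).1
  have h4 : δ * (δ * k) < δ * #(univ.filter fun a => δ < |g a|) :=
    mul_lt_mul_of_pos_left hbad hδ
  have h5 : η * k ≤ δ ^ 2 / 2 * k := mul_le_mul_of_nonneg_right hη (by positivity)
  have h6 : δ * (δ * k) = 8 * (τ * k) := by rw [hτ]; ring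
  have h7 : δ ^ 2 / 2 * k = 4 * (τ * k) := by rw [hτ]; ring
  have h8 : (k : ℝ) * (2 * τ) = 2 * (τ * k) := by ring
  linarith

/-- In an approximately balanced system most potentials are small. -/
theorem ApproxBalanced.card_potential_le {m : ℕ} {E : Finset (Fin m × Fin m)}
    (hE : ∀ e ∈ E, e.1 < e.2) (c : ℝ) {δ : ℝ} (hδ : 0 < δ) :
    ∃ η > 0, ∀ (k : ℕ) (w : Fin k → Fin k → ℝ) (g : Fin k → ℝ) (R : Fin k → Fin k → Prop),
      ApproxBalanced E c η w g R → (2 ≤ #E ∨ ∀ a, g a = 0) →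
      (#(univ.filter fun a => δ < |g a|) : ℝ) ≤ δ * k := by
  classical
  by_contra hcon
  push Not at hcon
  set τ := δ ^ 2 / 8 with hτ
  have hτ0 : 0 < τ := by positivity
  set ρ : ℕ → ℝ := fun n => min τ (1 / 4) / (n + 1) with hρ
  have hmin : 0 < min τ (1 / 4 : ℝ) := lt_min hτ0 (by norm_num)
  have hρ0 : ∀ n, 0 < ρ n := fun n => div_pos hmin (by positivity)
  have hρle : ∀ n, ρ n ≤ min τ (1 / 4) := fun n =>
    div_le_self hmin.le (by linarith [(Nat.cast_nonneg n : (0 : ℝ) ≤ n)])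
  choose k w g R hAB hd hbad using fun n => hcon (ρ n ^ 2) (pow_pos (hρ0 n) 2)
  have hk : ∀ n, 0 < k n := fun n => by
    by_contra h0
    have : (#(univ.filter fun a => δ < |g n a|) : ℝ) ≤ k n := by
      exact_mod_cast (card_le_univ _).trans_eq (Fintype.card_fin _)
    have h1 : (k n : ℝ) = 0 := by exact_mod_cast Nat.eq_zero_of_not_pos h0
    have h2 := hbad n
    rw [h1] at h2 this
    linarith
  have hE2 : 2 ≤ #E := by
    rcases hd 0 with h | h
    · exact h
    · have h2 := hbad 0
      simp only [h, abs_zero, not_lt_of_gt hδ, Finset.filter_false, card_empty] at h2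
      have : (0 : ℝ) ≤ δ * k 0 := by positivity
      norm_num at h2
      linarith
  have hη : ∀ n, ρ n ^ 2 ≤ δ ^ 2 / 2 := fun n => by
    have h1 := (hρle n).trans (min_le_left _ _)
    have h2 := (hρle n).trans (min_le_right _ _)
    have : ρ n ^ 2 ≤ τ * 1 := by
      rw [sq]; exact mul_le_mul h1 (by linarith) (hρ0 n).le hτ0.le
    rw [hτ] at this
    nlinarith [sq_nonneg δ]
  have hpos : ∀ n, τ * k n < #(univ.filter fun a => τ ≤ g n a) := fun n =>
    lt_card_filter_of_lt_card_abs (hAB n).abs_le_one hδ (hη n) (hAB n).sum_le (hbad n)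
  have hneg : ∀ n, τ * k n < #(univ.filter fun a => τ ≤ -g n a) := fun n =>
    lt_card_filter_of_lt_card_abs (g := fun a => -g n a)
      (fun a => by rw [abs_neg]; exact (hAB n).abs_le_one a) hδ (hη n)
      (by rw [Finset.sum_neg_distrib, abs_neg]; exact (hAB n).sum_le)
      (by simpa only [abs_neg] using hbad n)
  set S : ∀ n, ℕ → Finset (Fin (k n)) := fun n a =>
    if Even a then univ.filter fun a => τ ≤ g n a else univ.filter fun a => τ ≤ -g n a with hS
  have hScard : ∀ n a, τ * k n < #(S n a) := fun n a => by
    simp only [hS]; split_ifs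
    · exact hpos n
    · exact hneg n
  have hex : ∀ n, ∃ y : ℕ → Fin (k n),
      (∀ a < n, y a ∈ lightPoints (R n) (ρ n * k n) ∧ y a ∈ S n a) ∧
      (∀ a b, a < b → b < n → R n (y a) (y b)) ∧ ∀ a < 0, y a = (fun _ => ⟨0, hk n⟩ : ℕ → _) a := by
    intro n
    refine exists_greedy_sequence (R n) (fun a v => v ∈ lightPoints (R n) (ρ n * k n) ∧ v ∈ S n a)
      (Nat.zero_le n) _ (by simp) (by simp) fun a _ han y hy => ?_
    refine exists_rel_light_of_lt_card (R n) (hρ0 n) (hAB n).card_not_rel (S n a) a ?_ y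
      fun b hb => (hy b hb).1
    refine lt_of_le_of_lt ?_ (hScard n a)
    have h1 : ((a : ℝ) + 1) * ρ n ≤ τ := by
      rw [hρ]
      simp only
      rw [mul_div_assoc', div_le_iff₀ (by positivity)]
      have : (a : ℝ) + 1 ≤ n + 1 := by
        have : (a : ℝ) ≤ n := by exact_mod_cast han.le
        linarith
      calc ((a : ℝ) + 1) * min τ (1 / 4) ≤ (n + 1) * τ :=
            mul_le_mul this (min_le_left _ _) hmin.le (by positivity)
        _ = _ := by ring
    rw [← mul_assoc]
    exact mul_le_mul_of_nonneg_right h1 (by positivity)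
  choose y hy hyR _ using hex
  have hlimη : Tendsto (fun n => ρ n ^ 2) atTop (nhds 0) := by
    have : Tendsto ρ atTop (nhds 0) := by
      have := (tendsto_one_div_add_atTop_nhds_zero_nat (𝕜 := ℝ)).const_mul (min τ (1 / 4))
      simpa [hρ, div_eq_mul_inv] using this
    simpa using this.pow 2
  obtain ⟨W, γ, hbal, -, hγ⟩ := exists_isBalanced_limit hAB hlimη y hyR
  refine hbal.false_of_alternating hE hE2 hτ0 (fun t => ?_) fun t => ?_
  · refine ge_of_tendsto (hγ (2 * t)) (Nat.hyperfilter_le_atTop ?_)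
    filter_upwards [eventually_gt_atTop (2 * t)] with n hn
    have := (hy n _ hn).2
    simp only [hS, even_two_mul, if_true] at this
    exact (Finset.mem_filter.1 this).2
  · refine le_of_tendsto (hγ (2 * t + 1)) (Nat.hyperfilter_le_atTop ?_)
    filter_upwards [eventually_gt_atTop (2 * t + 1)] with n hn
    have := (hy n _ hn).2
    rw [hS] at this
    simp only at this
    rw [if_neg (by simp)] at this
    have := (Finset.mem_filter.1 this).2
    linarith

lemma card_filter_fst_or_snd_le {k : ℕ} (B : Finset (Fin k)) :
    (univ.filter fun q : Fin k × Fin k => q.1 ∈ B ∨ q.2 ∈ B).card ≤ 2 * (#B * k) := by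
  classical
  rw [Finset.filter_or, two_mul]
  refine (card_union_le _ _).trans (Nat.add_le_add ?_ ?_)
  · refine (card_le_card (t := B ×ˢ univ) fun q hq => ?_).trans_eq (by simp)
    simpa using hq
  · refine (card_le_card (t := univ ×ˢ B) fun q hq => ?_).trans_eq (by simp [mul_comm])
    simpa using hq

/-- In an approximately balanced system most weights are close to `p`. -/
theorem ApproxBalanced.card_weight_le {m : ℕ} {E : Finset (Fin m × Fin m)}
    (hE : ∀ e ∈ E, e.1 < e.2) (hne : E.Nonempty) {p : ℝ} (hp : 0 < p) {δ : ℝ} (hδ : 0 < δ) :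
    ∃ η > 0, ∀ (k : ℕ) (w : Fin k → Fin k → ℝ) (g : Fin k → ℝ) (R : Fin k → Fin k → Prop),
      ApproxBalanced E (p ^ #E) η w g R → (2 ≤ #E ∨ ∀ a, g a = 0) →
      (#(univ.filter fun q : Fin k × Fin k => δ < |w q.1 q.2 - p|) : ℝ) ≤ δ * (k : ℝ) ^ 2 := by
  classical
  by_contra hcon
  push Not at hcon
  set ρ : ℕ → ℝ := fun n => min δ 1 / 8 / (n + 2) with hρ
  have hmin : 0 < min δ (1 : ℝ) := lt_min hδ one_pos
  have hρ0 : ∀ n, 0 < ρ n := fun n => by positivity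
  have hρ8 : ∀ n, ρ n ≤ min δ 1 / 8 := fun n => div_le_self (by positivity)
    (by linarith [(Nat.cast_nonneg n : (0 : ℝ) ≤ n)])
  have hρδ : ∀ n, ρ n ≤ δ / 8 := fun n => (hρ8 n).trans (by linarith [min_le_left δ (1 : ℝ)])
  have hρ1 : ∀ n, ρ n ≤ 1 / 8 := fun n => (hρ8 n).trans (by linarith [min_le_right δ (1 : ℝ)])
  choose η₁ hη₁ hsmall using fun n => ApproxBalanced.card_potential_le hE (p ^ #E) (hρ0 n)
  choose k w g R hAB' hd hbad using fun n => hcon (min (η₁ n) (ρ n ^ 2))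
    (lt_min (hη₁ n) (pow_pos (hρ0 n) 2))
  have hAB : ∀ n, ApproxBalanced E (p ^ #E) (ρ n ^ 2) (w n) (g n) (R n) := fun n =>
    (hAB' n).mono (min_le_right _ _)
  have hg : ∀ n, (#(univ.filter fun a => ρ n < |g n a|) : ℝ) ≤ ρ n * k n := fun n =>
    hsmall n _ _ _ _ ((hAB' n).mono (min_le_left _ _)) (hd n)
  have hk : ∀ n, (0 : ℝ) < k n := fun n => by
    rcases Nat.eq_zero_or_pos (k n) with h0 | h0
    · have h1 : (#(univ.filter fun q : Fin (k n) × Fin (k n) => δ < |w n q.1 q.2 - p|) : ℝ) ≤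
          ((k n * k n : ℕ) : ℝ) := by
        refine Nat.cast_le.2 ((card_le_univ _).trans_eq ?_)
        simp
      have h2 := (hbad n).trans_le h1
      rw [h0] at h2
      simp at h2
    · exact_mod_cast h0
  set S : ∀ n, Finset (Fin (k n)) := fun n => univ.filter fun a => |g n a| ≤ ρ n with hS
  have hpair : ∀ n, ∃ q : Fin (k n) × Fin (k n), δ < |w n q.1 q.2 - p| ∧ R n q.1 q.2 ∧
      (q.1 ∈ lightPoints (R n) (ρ n * k n) ∧ q.1 ∈ S n) ∧
      (q.2 ∈ lightPoints (R n) (ρ n * k n) ∧ q.2 ∈ S n) := by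
    intro n
    by_contra hno
    push Not at hno
    set B₁ := univ.filter fun a => a ∉ lightPoints (R n) (ρ n * k n)
    set B₂ := univ.filter fun a => ρ n < |g n a|
    have hsub : (univ.filter fun q : Fin (k n) × Fin (k n) => δ < |w n q.1 q.2 - p|) ⊆
        (univ.filter fun q : Fin (k n) × Fin (k n) => ¬ R n q.1 q.2) ∪
        ((univ.filter fun q : Fin (k n) × Fin (k n) => q.1 ∈ B₁ ∨ q.2 ∈ B₁) ∪
          univ.filter fun q : Fin (k n) × Fin (k n) => q.1 ∈ B₂ ∨ q.2 ∈ B₂) := by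
      intro q hq
      have hq := (Finset.mem_filter.1 hq).2
      have := hno q hq
      simp only [S, B₁, B₂, Finset.mem_union, Finset.mem_filter, mem_univ, true_and] at this ⊢
      simp only [not_le] at this
      by_contra hc
      simp only [not_or, not_not] at hc
      obtain ⟨h1, ⟨h2, h3⟩, h4, h5⟩ := hc
      exact h5 (this h1 ⟨h2, not_lt.1 h4⟩ h3)
    have hc1 : (#(univ.filter fun q : Fin (k n) × Fin (k n) => ¬ R n q.1 q.2) : ℝ) ≤
        ρ n ^ 2 * (k n : ℝ) ^ 2 := by
      have := (hAB n).card_not_rel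
      rwa [Nat.card_eq_fintype_card, Fintype.card_subtype] at this
    have hc2 := card_not_lightPoints_le (R n) (hρ0 n) (hAB n).card_not_rel
    have hc3 := hg n
    have hc4 : (#(univ.filter fun q : Fin (k n) × Fin (k n) => δ < |w n q.1 q.2 - p|) : ℝ) ≤
        #(univ.filter fun q : Fin (k n) × Fin (k n) => ¬ R n q.1 q.2) +
          (2 * (#B₁ * k n) + 2 * (#B₂ * k n)) := by
      exact_mod_cast (card_le_card hsub).trans ((card_union_le _ _).trans (Nat.add_le_add_left
        ((card_union_le _ _).trans (Nat.add_le_add (card_filter_fst_or_snd_le _)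
          (card_filter_fst_or_snd_le _))) _))
    have hk2 : (0 : ℝ) < (k n : ℝ) ^ 2 := pow_pos (hk n) 2
    have h1 := mul_le_mul_of_nonneg_right hc2 (hk n).le
    have h2 := mul_le_mul_of_nonneg_right hc3 (hk n).le
    have h3 : ρ n ^ 2 ≤ ρ n * 1 := by
      rw [sq]; exact mul_le_mul_of_nonneg_left (by linarith [hρ1 n]) (hρ0 n).le
    have h4 : (ρ n ^ 2 + 4 * ρ n) * (k n : ℝ) ^ 2 ≤ δ * (k n : ℝ) ^ 2 :=
      mul_le_mul_of_nonneg_right (by linarith [hρδ n]) hk2.le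
    have h5 := hbad n
    nlinarith
  choose q hq hqR hq1 hq2 using hpair
  have hex : ∀ n, ∃ y : ℕ → Fin (k n),
      (∀ a < n + 2, y a ∈ lightPoints (R n) (ρ n * k n) ∧ y a ∈ S n) ∧
      (∀ a b, a < b → b < n + 2 → R n (y a) (y b)) ∧
      ∀ a < 2, y a = (fun a => if a = 0 then (q n).1 else (q n).2 : ℕ → _) a := by
    intro n
    refine exists_greedy_sequence (R n) (fun a v => v ∈ lightPoints (R n) (ρ n * k n) ∧ v ∈ S n)
      (by omega) _ ?_ ?_ fun a _ han y hy => ?_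
    · intro a _
      by_cases h0 : a = 0
      · simpa only [h0, if_true] using hq1 n
      · simpa only [h0, if_false] using hq2 n
    · intro a b hab hb
      have ha : a = 0 := by omega
      have hb : b = 1 := by omega
      subst ha hb
      simpa using hqR n
    · refine exists_rel_light_of_lt_card (R n) (hρ0 n) (hAB n).card_not_rel (S n) a ?_ y
        fun b hb => (hy b hb).1
      have h1 : ((a : ℝ) + 1) * ρ n ≤ 1 / 8 := by
        have : (a : ℝ) + 1 ≤ n + 2 := by exact_mod_cast han
        calc ((a : ℝ) + 1) * ρ n ≤ (n + 2) * ρ n := mul_le_mul_of_nonneg_right this (hρ0 n).le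
          _ = min δ 1 / 8 := by rw [hρ]; field_simp
          _ ≤ 1 / 8 := by linarith [min_le_right δ (1 : ℝ)]
      have h2 : (k n : ℝ) = #(S n) + #(univ.filter fun a => ρ n < |g n a|) := by
        have := Finset.card_filter_add_card_filter_not (s := (univ : Finset (Fin (k n))))
          fun a => |g n a| ≤ ρ n
        simp only [not_le, card_univ, Fintype.card_fin] at this
        exact_mod_cast this.symm
      have h3 := hg n
      have h4 := mul_le_mul_of_nonneg_right h1 (hk n).le
      have h5 := mul_le_mul_of_nonneg_right (hρ1 n) (hk n).le
      have h6 := hk n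
      rw [← mul_assoc]
      linarith
  choose y hy hyR hy0 using hex
  have hlimρ : Tendsto ρ atTop (nhds 0) := by
    have h1 : Tendsto (fun n : ℕ => (n : ℝ) + 2) atTop atTop :=
      tendsto_atTop_add_const_right _ _ tendsto_natCast_atTop_atTop
    exact h1.const_div_atTop (min δ 1 / 8)
  have hlimη : Tendsto (fun n => ρ n ^ 2) atTop (nhds 0) := by simpa using hlimρ.pow 2
  obtain ⟨W, γ, hbal, hW, hγ⟩ := exists_isBalanced_limit hAB hlimη y
    fun n a b hab hb => hyR n a b hab (by omega)
  have hγ0 : γ = fun _ => 0 := by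
    funext a
    have h1 : Tendsto (fun n => |g n (y n a)|) (hyperfilter ℕ) (nhds |γ a|) := (hγ a).abs
    have h2 : |γ a| ≤ 0 := le_of_tendsto_of_tendsto h1
      (hlimρ.mono_left Nat.hyperfilter_le_atTop) (Nat.hyperfilter_le_atTop (by
        filter_upwards [eventually_gt_atTop a] with n hn
        exact (Finset.mem_filter.1 (hy n a (by omega)).2).2))
    exact abs_nonpos_iff.1 h2
  rw [hγ0] at hbal
  have hW01 := hbal.weight_eq hE hne hp (zero_ne_one : (0 : ℕ) ≠ 1)
  have h1 : Tendsto (fun n => |w n (y n 0) (y n 1) - p|) (hyperfilter ℕ) (nhds |W 0 1 - p|) :=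
    ((hW 0 1).sub_const p).abs
  rw [hW01, sub_self, abs_zero] at h1
  have h2 : δ ≤ 0 := ge_of_tendsto h1 (Filter.Eventually.of_forall fun n => by
    have e0 : y n 0 = (q n).1 := by simpa using hy0 n 0 (by norm_num)
    have e1 : y n 1 = (q n).2 := by simpa using hy0 n 1 (by norm_num)
    rw [e0, e1]
    exact (hq n).le)
  linarith

/-- Independence of the colours of distinct vertices under a product distribution. -/
lemma sum_prod_mul_prod_of_injective {ι β K : Type*} [Fintype ι] [Fintype β] [DecidableEq β]
    [Fintype K] {π : β → K → ℝ} (hπ : ∀ v, ∑ o, π v o = 1) {x : ι → β}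
    (hx : Function.Injective x) (h : ι → K → ℝ) :
    ∑ c : β → K, (∏ v, π v (c v)) * ∏ j, h j (c (x j)) = ∏ j, ∑ o, π (x j) o * h j o := by
  classical
  have h1 : ∀ c : β → K, ∏ j, h j (c (x j)) = ∏ v, ∏ j, if v = x j then h j (c v) else 1 := by
    intro c
    rw [Finset.prod_comm]
    refine Finset.prod_congr rfl fun j _ => ?_
    rw [Finset.prod_ite_eq' univ (x j)]
    simp
  simp_rw [h1, ← Finset.prod_mul_distrib]
  rw [← Fintype.prod_sum (f := fun v o => π v o * ∏ j, if v = x j then h j o else 1)]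
  have h2 : ∀ v, ∑ o, π v o * ∏ j, (if v = x j then h j o else 1) =
      ∏ j, if v = x j then ∑ o, π (x j) o * h j o else 1 := by
    intro v
    by_cases hv : ∃ j, v = x j
    · obtain ⟨j, rfl⟩ := hv
      have : ∀ g : ι → ℝ, ∏ i, (if x j = x i then g i else 1) = g j := by
        intro g
        simp [hx.eq_iff]
      simp_rw [this]
    · push Not at hv
      simp [hv, hπ]
  simp_rw [h2]
  rw [Finset.prod_comm]
  refine Finset.prod_congr rfl fun j _ => ?_
  rw [Finset.prod_ite_eq' univ (x j)]
  simp

lemma sum_prod_mul_sq_le {β K : Type*} [Fintype β] [DecidableEq β] [Fintype K] [DecidableEq K]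
    {π : β → K → ℝ} (h0 : ∀ v o, 0 ≤ π v o) (hπ : ∀ v, ∑ o, π v o = 1) (i : K) :
    ∑ c : β → K, (∏ v, π v (c v)) * (∑ v, ((if c v = i then 1 else 0) - π v i)) ^ 2 ≤
      Fintype.card β := by
  have hexp : ∀ v w : β, ∑ c : β → K, (∏ u, π u (c u)) *
      (((if c v = i then 1 else 0) - π v i) * ((if c w = i then 1 else 0) - π w i)) ≤
        if v = w then (1 : ℝ) else 0 := by
    intro v w
    split_ifs with hvw
    · subst hvw
      have := sum_prod_mul_prod_of_injective hπ (x := fun _ : Unit => v)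
        (fun _ _ _ => Subsingleton.elim _ _)
        (fun _ o => ((if o = i then 1 else 0) - π v i) * ((if o = i then 1 else 0) - π v i))
      simp only [Finset.univ_unique, Finset.prod_singleton] at this
      rw [this]
      refine le_of_le_of_eq ?_ (hπ v)
      have hle : ∀ o, π v o ≤ 1 := fun o => by
        rw [← hπ v]; exact Finset.single_le_sum (fun o _ => h0 v o) (Finset.mem_univ o)
      refine Finset.sum_le_sum fun o _ => mul_le_of_le_one_right (h0 v o) ?_
      have := h0 v i; have := hle i
      split_ifs <;> nlinarith
    · have hinj : Function.Injective ![v, w] := by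
        intro a b hab
        fin_cases a <;> fin_cases b <;> simp_all
      have := sum_prod_mul_prod_of_injective hπ hinj
        ![fun o => (if o = i then 1 else 0) - π v i, fun o => (if o = i then 1 else 0) - π w i]
      simp only [Fin.prod_univ_two, Matrix.cons_val_zero, Matrix.cons_val_one] at this
      rw [this]
      simp [mul_sub, Finset.sum_sub_distrib, ← Finset.sum_mul, hπ]
  calc _ = ∑ v, ∑ w, ∑ c : β → K, (∏ u, π u (c u)) *
      (((if c v = i then 1 else 0) - π v i) * ((if c w = i then 1 else 0) - π w i)) := by
        simp_rw [sq, Finset.sum_mul_sum, Finset.mul_sum]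
        rw [Finset.sum_comm]
        exact Finset.sum_congr rfl fun v _ => Finset.sum_comm
    _ ≤ ∑ v : β, ∑ w : β, if v = w then (1 : ℝ) else 0 :=
        Finset.sum_le_sum fun v _ => Finset.sum_le_sum fun w _ => hexp v w
    _ = _ := by simp

/-- A partial colouring can be turned into one with prescribed class sizes by changing few
colours. -/
lemma exists_card_fiber_eq {β : Type*} [Fintype β] [DecidableEq β] {r : ℕ}
    (a : Fin r → ℕ) (ha : ∑ i, a i ≤ Fintype.card β) (c : β → Option (Fin r)) :
    ∃ c' : β → Option (Fin r), (∀ i, #(univ.filter fun v => c' v = some i) = a i) ∧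
      hammingDist c c' ≤ ∑ i, Nat.dist #(univ.filter fun v => c v = some i) (a i) := by
  generalize hs : ∑ i, Nat.dist #(univ.filter fun v => c v = some i) (a i) = s
  induction s generalizing c with
  | zero =>
    refine ⟨c, fun i => Nat.eq_of_dist_eq_zero ?_, by simp⟩
    exact (Finset.sum_eq_zero_iff.1 hs) i (Finset.mem_univ i)
  | succ s ih =>
    have key : ∀ (v : β) (o : Option (Fin r)),
        ∑ i, Nat.dist #(univ.filter fun u => Function.update c v o u = some i) (a i) = s →
        ∃ c' : β → Option (Fin r), (∀ i, #(univ.filter fun v => c' v = some i) = a i) ∧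
          hammingDist c c' ≤ s + 1 := by
      intro v o h
      obtain ⟨c', h1, h2⟩ := ih _ h
      refine ⟨c', h1, (hammingDist_triangle c (Function.update c v o) c').trans ?_⟩
      have : hammingDist c (Function.update c v o) ≤ 1 := by
        unfold hammingDist
        refine Finset.card_le_one.2 fun p hp q hq => ?_
        simp only [Finset.mem_filter_univ, ne_eq] at hp hq
        have h1 : p = v := by by_contra hne; simp [hne] at hp
        have h2 : q = v := by by_contra hne; simp [hne] at hq
        rw [h1, h2]
      omega
    have hfib : ∀ (v : β) (o : Option (Fin r)) (i : Fin r),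
        #(univ.filter fun u => Function.update c v o u = some i) + (if c v = some i then 1 else 0)
          = #(univ.filter fun u => c u = some i) + (if o = some i then 1 else 0) := by
      intro v o i
      simp only [Finset.card_filter]
      rw [← Finset.add_sum_erase _ _ (Finset.mem_univ v),
        ← Finset.add_sum_erase _ (fun u => if c u = some i then 1 else 0) (Finset.mem_univ v)]
      have : ∀ u ∈ univ.erase v, (if Function.update c v o u = some i then 1 else 0) =
          if c u = some i then 1 else 0 := by
        intro u hu
        rw [Function.update_of_ne (Finset.ne_of_mem_erase hu)]
      rw [Finset.sum_congr rfl this, Function.update_self]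
      ring
    by_cases hbig : ∃ i, a i < #(univ.filter fun v => c v = some i)
    · obtain ⟨i, hi⟩ := hbig
      obtain ⟨v, hv⟩ := Finset.card_pos.1 (lt_of_le_of_lt (Nat.zero_le _) hi)
      simp only [Finset.mem_filter_univ] at hv
      refine key v none ?_
      rw [← Finset.add_sum_erase _ _ (Finset.mem_univ i)] at hs ⊢
      have hrest : ∀ j ∈ univ.erase i,
          Nat.dist #(univ.filter fun u => Function.update c v none u = some j) (a j) =
          Nat.dist #(univ.filter fun u => c u = some j) (a j) := by
        intro j hj
        have := hfib v none j
        have hne : c v ≠ some j := by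
          rw [hv]; simpa using (Finset.ne_of_mem_erase hj).symm
        simp only [hne, if_false, reduceCtorEq] at this
        rw [show #(univ.filter fun u => Function.update c v none u = some j) =
          #(univ.filter fun u => c u = some j) by omega]
      rw [Finset.sum_congr rfl hrest]
      have := hfib v none i
      simp only [hv, if_true, reduceCtorEq, if_false] at this
      simp only [Nat.dist] at hs ⊢
      omega
    · push Not at hbig
      have hex : ∃ i, #(univ.filter fun v => c v = some i) < a i := by
        by_contra hcon
        push Not at hcon
        have : ∑ i, Nat.dist #(univ.filter fun v => c v = some i) (a i) = 0 :=
          Finset.sum_eq_zero fun i _ => by rw [le_antisymm (hbig i) (hcon i), Nat.dist_self]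
        omega
      obtain ⟨i, hi⟩ := hex
      have hnone : ∃ v, c v = none := by
        by_contra hcon
        push Not at hcon
        have h1 : Fintype.card β = ∑ i, #(univ.filter fun v => c v = some i) := by
          rw [← Finset.card_univ, Finset.card_eq_sum_card_fiberwise
            (f := c) (t := univ) (fun _ _ => Finset.mem_coe.2 (Finset.mem_univ _)),
          Fintype.sum_option]
          simp [hcon]
        have h2 : ∑ i, #(univ.filter fun v => c v = some i) < ∑ i, a i :=
          Finset.sum_lt_sum (fun i _ => hbig i) ⟨i, Finset.mem_univ i, hi⟩
        omega
      obtain ⟨v, hv⟩ := hnone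
      refine key v (some i) ?_
      rw [← Finset.add_sum_erase _ _ (Finset.mem_univ i)] at hs ⊢
      have hrest : ∀ j ∈ univ.erase i,
          Nat.dist #(univ.filter fun u => Function.update c v (some i) u = some j) (a j) =
          Nat.dist #(univ.filter fun u => c u = some j) (a j) := by
        intro j hj
        have := hfib v (some i) j
        have hne : ¬ i = j := (Finset.ne_of_mem_erase hj).symm
        simp only [hv, reduceCtorEq, if_false, Option.some.injEq, hne] at this
        rw [show #(univ.filter fun u => Function.update c v (some i) u = some j) =
          #(univ.filter fun u => c u = some j) by omega]
      rw [Finset.sum_congr rfl hrest]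
      have := hfib v (some i) i
      simp only [hv, if_true, reduceCtorEq, if_false] at this
      simp only [Nat.dist] at hs ⊢
      omega

/-- The sum of `f`, weighted by the products `∏ j, φ (κ j) (x j)`, over all injections `κ` of the
coordinates into the parts. -/
noncomputable def embSum {m r : ℕ} {β : Type*} [Fintype β] (f : (Fin m → β) → ℝ)
    (φ : Fin r → β → ℝ) : ℝ :=
  ∑ κ : Fin m ↪ Fin r, ∑ x, f x * ∏ j, φ (κ j) (x j)

lemma card_mul_card_filter_apply {m : ℕ} {β : Type*} [Fintype β] [DecidableEq β] (j : Fin m)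
    (P : β → Prop) [DecidablePred P] :
    (Fintype.card β : ℝ) * #(univ.filter fun x : Fin m → β => P (x j)) =
      #(univ.filter P) * (Fintype.card β : ℝ) ^ m := by
  have := card_mul_sum_piFinset (fun _ : Fin m => (univ : Finset β)) j
    (fun x => if P (x j) then 1 else 0)
  simp only [Fintype.piFinset_univ, Function.update_self, Finset.sum_const, nsmul_eq_mul,
    Finset.card_univ, Fintype.card_fun, Fintype.card_fin, Finset.sum_boole] at this
  rw [this]
  push_cast
  ring

lemma abs_embSum_sub_le {m r : ℕ} {β : Type*} [Fintype β] [DecidableEq β] {f : (Fin m → β) → ℝ}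
    (hf : ∀ x, |f x| ≤ 1) (c c' : β → Option (Fin r)) :
    Fintype.card β * |embSum f (fun i v => if c v = some i then 1 else 0) -
        embSum f (fun i v => if c' v = some i then 1 else 0)| ≤
      Fintype.card (Fin m ↪ Fin r) * (m * (hammingDist c c' * (Fintype.card β : ℝ) ^ m)) := by
  classical
  have hpt : ∀ (κ : Fin m ↪ Fin r) (x : Fin m → β),
      |f x * (∏ j, if c (x j) = some (κ j) then 1 else 0) -
        f x * ∏ j, if c' (x j) = some (κ j) then 1 else 0| ≤
        ∑ j, if c (x j) ≠ c' (x j) then (1 : ℝ) else 0 := by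
    intro κ x
    have hnn : ∀ j ∈ (univ : Finset (Fin m)), (0 : ℝ) ≤ if c (x j) ≠ c' (x j) then 1 else 0 :=
      fun j _ => by split_ifs <;> norm_num
    by_cases h : ∃ j, c (x j) ≠ c' (x j)
    · obtain ⟨j, hj⟩ := h
      have h1 : (1 : ℝ) ≤ ∑ j, if c (x j) ≠ c' (x j) then (1 : ℝ) else 0 := by
        refine le_trans ?_ (Finset.single_le_sum hnn (Finset.mem_univ j))
        simp [hj]
      refine le_trans ?_ h1
      rw [← mul_sub, abs_mul]
      refine mul_le_one₀ (hf x) (abs_nonneg _) ?_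
      have hp : ∀ c : β → Option (Fin r), 0 ≤ (∏ j, if c (x j) = some (κ j) then (1 : ℝ) else 0) ∧
          (∏ j, if c (x j) = some (κ j) then (1 : ℝ) else 0) ≤ 1 := fun c =>
        ⟨Finset.prod_nonneg fun j _ => by split_ifs <;> norm_num,
          Finset.prod_le_one (fun j _ => by split_ifs <;> norm_num)
            (fun j _ => by split_ifs <;> norm_num)⟩
      have := hp c; have := hp c'
      rw [abs_le]; constructor <;> linarith
    · push Not at h
      simp only [h, sub_self, abs_zero]
      exact Finset.sum_nonneg fun j _ => by split_ifs <;> norm_num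
  have hsum : |embSum f (fun i v => if c v = some i then 1 else 0) -
        embSum f (fun i v => if c' v = some i then 1 else 0)| ≤
      ∑ _κ : Fin m ↪ Fin r, ∑ x : Fin m → β, ∑ j, if c (x j) ≠ c' (x j) then (1 : ℝ) else 0 := by
    unfold embSum
    rw [← Finset.sum_sub_distrib]
    simp_rw [← Finset.sum_sub_distrib]
    refine (Finset.abs_sum_le_sum_abs _ _).trans (Finset.sum_le_sum fun κ _ => ?_)
    exact (Finset.abs_sum_le_sum_abs _ _).trans (Finset.sum_le_sum fun x _ => hpt κ x)
  refine (mul_le_mul_of_nonneg_left hsum (Nat.cast_nonneg _)).trans_eq ?_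
  rw [Finset.sum_const, Finset.card_univ, nsmul_eq_mul, mul_left_comm, Finset.sum_comm]
  congr 1
  rw [Finset.mul_sum]
  have : ∀ j : Fin m, (Fintype.card β : ℝ) *
      ∑ x : Fin m → β, (if c (x j) ≠ c' (x j) then (1 : ℝ) else 0) =
        hammingDist c c' * (Fintype.card β : ℝ) ^ m := by
    intro j
    rw [Finset.sum_boole, card_mul_card_filter_apply j (fun v => c v ≠ c' v)]
    rfl
  rw [Finset.sum_congr rfl fun j _ => this j]
  simp

/-- Rounding: a bound for `embSum` on disjoint sets of prescribed sizes extends to fractional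
families. -/
theorem abs_embSum_le_of_sets {m r : ℕ} {β : Type*} [Fintype β] [DecidableEq β] [Nonempty β]
    {f : (Fin m → β) → ℝ} (hf : ∀ x, |f x| ≤ 1)
    (hinj : ∀ x, ¬ Function.Injective x → f x = 0) {α : Fin r → ℝ} (hα : ∀ i, 0 ≤ α i)
    (hsum : ∑ i, α i ≤ 1) {τ : ℝ}
    (hτ : ∀ U : Fin r → Finset β, Pairwise (fun i j => Disjoint (U i) (U j)) →
      (∀ i, #(U i) = ⌊α i * Fintype.card β⌋₊) →
      |embSum f (fun i v => if v ∈ U i then 1 else 0)| ≤ τ * (Fintype.card β : ℝ) ^ m)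
    {φ : Fin r → β → ℝ} (h0 : ∀ i v, 0 ≤ φ i v) (h1 : ∀ v, ∑ i, φ i v ≤ 1)
    (hφ : ∀ i, ∑ v, φ i v = α i * Fintype.card β) :
    |embSum f φ| ≤ (τ + 2 * r * m * Fintype.card (Fin m ↪ Fin r) / √(Fintype.card β)) *
      (Fintype.card β : ℝ) ^ m := by
  classical
  set N : ℝ := (Fintype.card β : ℝ) with hN
  have hNn : (1 : ℝ) ≤ N := by rw [hN]; exact_mod_cast Fintype.card_pos
  have hN0 : 0 < N := by linarith
  set s := √N with hs
  have hs1 : 1 ≤ s := by rw [hs]; exact Real.one_le_sqrt.2 hNn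
  have hss : s * s = N := Real.mul_self_sqrt hN0.le
  set M : ℝ := (Fintype.card (Fin m ↪ Fin r) : ℝ) with hM
  set a : Fin r → ℕ := fun i => ⌊α i * N⌋₊ with ha
  have haN : ∑ i, a i ≤ Fintype.card β := by
    have : (∑ i, (a i : ℝ)) ≤ N := by
      calc _ ≤ ∑ i, α i * N := Finset.sum_le_sum fun i _ =>
            Nat.floor_le (mul_nonneg (hα i) hN0.le)
        _ = (∑ i, α i) * N := by rw [Finset.sum_mul]
        _ ≤ 1 * N := mul_le_mul_of_nonneg_right hsum hN0.le
        _ = N := one_mul _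
    rw [hN] at this
    exact_mod_cast this
  -- the deterministic bound
  have hdet : ∀ c : β → Option (Fin r),
      |embSum f (fun i v => if c v = some i then 1 else 0)| ≤ τ * N ^ m +
        M * m * N ^ m / N * ∑ i, (|∑ v, ((if c v = some i then 1 else 0) - φ i v)| + 1) := by
    intro c
    obtain ⟨c', hc1, hc2⟩ := exists_card_fiber_eq a haN c
    have hD := hτ (fun i => univ.filter fun v => c' v = some i)
      (fun i j hij => by
        refine Finset.disjoint_filter.2 ?_
        intro v _ h1 h2
        exact hij (Option.some_injective _ (h1.symm.trans h2))) hc1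
    simp only [Finset.mem_filter_univ] at hD
    have hL := abs_embSum_sub_le hf c c'
    rw [mul_comm, ← le_div_iff₀ hN0] at hL
    have hham : (hammingDist c c' : ℝ) ≤
        ∑ i, (|∑ v, ((if c v = some i then 1 else 0) - φ i v)| + 1) := by
      refine (Nat.cast_le.2 hc2).trans ?_
      push_cast
      refine Finset.sum_le_sum fun i _ => ?_
      rw [Finset.sum_sub_distrib, hφ, Finset.sum_boole]
      have e1 := Nat.floor_le (mul_nonneg (hα i) hN0.le)
      have e2 := (Nat.lt_floor_add_one (α i * N)).le
      have e3 : (Nat.dist #(univ.filter fun v => c v = some i) (a i) : ℝ) =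
          |(#(univ.filter fun v => c v = some i) : ℝ) - a i| := by
        rcases le_total #(univ.filter fun v => c v = some i) (a i) with h | h
        · rw [Nat.dist_eq_sub_of_le h, Nat.cast_sub h, abs_sub_comm, abs_of_nonneg]
          exact sub_nonneg.2 (Nat.cast_le.2 h)
        · rw [Nat.dist_eq_sub_of_le_right h, Nat.cast_sub h, abs_of_nonneg]
          exact sub_nonneg.2 (Nat.cast_le.2 h)
      rw [e3]
      have e4 : |α i * N - a i| ≤ 1 := by rw [abs_le]; constructor <;> linarith
      calc _ = |((#(univ.filter fun v => c v = some i) : ℝ) - α i * N) + (α i * N - a i)| := by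
            congr 1; ring
        _ ≤ _ := (abs_add_le _ _).trans (by linarith)
    have h3 : embSum f (fun i v => if c v = some i then 1 else 0) =
        (embSum f (fun i v => if c v = some i then 1 else 0) -
          embSum f (fun i v => if c' v = some i then 1 else 0)) +
          embSum f (fun i v => if c' v = some i then 1 else 0) := by ring
    rw [h3]
    refine (abs_add_le _ _).trans ?_
    rw [add_comm]
    refine add_le_add hD (hL.trans ?_)
    calc M * (m * (hammingDist c c' * N ^ m)) / N = M * m * N ^ m / N * hammingDist c c' := by ring
      _ ≤ _ := mul_le_mul_of_nonneg_left hham (by positivity)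
  -- averaging
  let π : β → Option (Fin r) → ℝ := fun v o => o.elim (1 - ∑ i, φ i v) (fun i => φ i v)
  have hπ0 : ∀ v o, 0 ≤ π v o := by
    intro v o
    cases o with
    | none => exact sub_nonneg.2 (h1 v)
    | some i => exact h0 i v
  have hπ1 : ∀ v, ∑ o, π v o = 1 := by
    intro v
    rw [Fintype.sum_option]
    simp [π]
  have hw0 : ∀ c : β → Option (Fin r), 0 ≤ ∏ v, π v (c v) :=
    fun c => Finset.prod_nonneg fun v _ => hπ0 v _
  have hw1 : ∑ c : β → Option (Fin r), ∏ v, π v (c v) = 1 := by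
    rw [← Fintype.prod_sum]
    simp [hπ1]
  have hE : embSum f φ = ∑ c : β → Option (Fin r), (∏ v, π v (c v)) *
      embSum f (fun i v => if c v = some i then 1 else 0) := by
    unfold embSum
    simp_rw [Finset.mul_sum]
    refine Eq.trans ?_ Finset.sum_comm
    refine Finset.sum_congr rfl fun κ _ => ?_
    refine Eq.trans ?_ Finset.sum_comm
    refine Finset.sum_congr rfl fun x _ => ?_
    by_cases hx : Function.Injective x
    · simp_rw [mul_left_comm _ (f x)]
      rw [← Finset.mul_sum, sum_prod_mul_prod_of_injective hπ1 hx
        (fun j o => if o = some (κ j) then 1 else 0)]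
      simp [π]
    · simp [hinj x hx]
  have hdev : ∀ i, ∑ c : β → Option (Fin r), (∏ v, π v (c v)) *
      (|∑ v, ((if c v = some i then 1 else 0) - φ i v)| + 1) ≤ 2 * s := by
    intro i
    have h2 := sum_prod_mul_sq_le hπ0 hπ1 (some i)
    have h3 : ∀ c : β → Option (Fin r), (∏ v, π v (c v)) *
      (|∑ v, ((if c v = some i then 1 else 0) - φ i v)| + 1) ≤
        (∏ v, π v (c v)) * (∑ v, ((if c v = some i then 1 else 0) - π v (some i))) ^ 2 / (2 * s) +
          (∏ v, π v (c v)) * (s / 2 + 1) := by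
      intro c
      rw [mul_div_assoc, ← mul_add]
      refine mul_le_mul_of_nonneg_left ?_ (hw0 c)
      change |∑ v, ((if c v = some i then 1 else 0) - φ i v)| + 1 ≤
        (∑ v, ((if c v = some i then 1 else 0) - φ i v)) ^ 2 / (2 * s) + (s / 2 + 1)
      rw [← sq_abs]
      generalize |∑ v, ((if c v = some i then 1 else 0) - φ i v)| = X
      have : X ≤ X ^ 2 / (2 * s) + s / 2 := by
        rw [div_add_div _ _ (by positivity) (by norm_num), le_div_iff₀ (by positivity)]
        nlinarith [sq_nonneg (X - s)]
      linarith
    refine (Finset.sum_le_sum fun c _ => h3 c).trans ?_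
    rw [Finset.sum_add_distrib, ← Finset.sum_div, ← Finset.sum_mul, hw1]
    have h4 : (∑ c : β → Option (Fin r), (∏ v, π v (c v)) *
        (∑ v, ((if c v = some i then 1 else 0) - π v (some i))) ^ 2) / (2 * s) ≤ s / 2 := by
      rw [div_le_iff₀ (by positivity)]
      refine h2.trans_eq ?_
      rw [← hN, ← hss]; ring
    linarith
  calc |embSum f φ| ≤ ∑ c : β → Option (Fin r), (∏ v, π v (c v)) * (τ * N ^ m +
        M * m * N ^ m / N * ∑ i, (|∑ v, ((if c v = some i then 1 else 0) - φ i v)| + 1)) := by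
        rw [hE]
        refine (Finset.abs_sum_le_sum_abs _ _).trans (Finset.sum_le_sum fun c _ => ?_)
        rw [abs_mul, abs_of_nonneg (hw0 c)]
        exact mul_le_mul_of_nonneg_left (hdet c) (hw0 c)
    _ = τ * N ^ m + M * m * N ^ m / N * ∑ i, ∑ c : β → Option (Fin r), (∏ v, π v (c v)) *
          (|∑ v, ((if c v = some i then 1 else 0) - φ i v)| + 1) := by
        simp_rw [mul_add (∏ v, π v _) (τ * N ^ m)]
        rw [Finset.sum_add_distrib, ← Finset.sum_mul, hw1, one_mul, Finset.sum_comm (γ := Fin r),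
          Finset.mul_sum]
        congr 1
        refine Finset.sum_congr rfl fun c _ => ?_
        rw [← Finset.mul_sum]
        ring
    _ ≤ τ * N ^ m + M * m * N ^ m / N * ∑ _i : Fin r, 2 * s := by
        gcongr with i
        exact hdev i
    _ = _ := by
        rw [Finset.sum_const, Finset.card_univ, Fintype.card_fin, nsmul_eq_mul]
        rw [← hss]
        field_simp

lemma sum_embedding_eq {m r : ℕ} (T : (Fin m ↪ Fin r) → ℝ) :
    ∑ κ, T κ = ∑ s : Finset (Fin r), if h : #s = m then
      ∑ σ : Equiv.Perm (Fin m), T (σ.toEmbedding.trans (s.orderEmbOfFin h).toEmbedding) else 0 := by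
  classical
  rw [← Finset.sum_fiberwise univ (fun κ : Fin m ↪ Fin r => univ.map κ)]
  refine Finset.sum_congr rfl fun s _ => ?_
  split_ifs with h
  · symm
    refine Finset.sum_bij (fun σ _ => σ.toEmbedding.trans (s.orderEmbOfFin h).toEmbedding)
      ?_ ?_ ?_ (fun _ _ => rfl)
    · intro σ _
      simp only [Finset.mem_filter_univ]
      rw [← Finset.map_map, Finset.map_univ_equiv]
      ext i
      simp only [Finset.mem_map, Finset.mem_univ, true_and]
      exact Set.ext_iff.1 (Finset.range_orderEmbOfFin s h) i
    · intro σ _ τ _ hστ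
      refine Equiv.ext fun j => ?_
      have := DFunLike.congr_fun hστ j
      simpa using this
    · intro κ hκ
      simp only [Finset.mem_filter_univ] at hκ
      have hmem : ∀ j, ∃ i, s.orderEmbOfFin h i = κ j := by
        intro j
        have h1 : κ j ∈ s := by rw [← hκ]; simp
        exact (Set.ext_iff.1 (Finset.range_orderEmbOfFin s h) (κ j)).2 h1
      choose t ht using hmem
      have hinj : Function.Injective t := by
        intro a b hab
        apply κ.injective
        rw [← ht a, ← ht b, hab]
      refine ⟨Equiv.ofBijective t (Finite.injective_iff_bijective.1 hinj), Finset.mem_univ _, ?_⟩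
      ext j
      simp [ht]
  · refine Finset.sum_eq_zero fun κ hκ => ?_
    simp only [Finset.mem_filter_univ] at hκ
    refine absurd ?_ h
    rw [← hκ]; simp

open Classical in
/-- The deviation of the indicator of the event that `x` spans the edges `E` from its expected
value; zero on non-injective maps. -/
noncomputable def deviation {m : ℕ} {β : Type*} (G : SimpleGraph β) (E : Finset (Fin m × Fin m))
    (p : ℝ) (x : Fin m → β) : ℝ :=
  if Function.Injective x then edgeProd (adjInd G) E x - p ^ #E else 0

lemma abs_deviation_le {m : ℕ} {β : Type*} (G : SimpleGraph β) (E : Finset (Fin m × Fin m))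
    {p : ℝ} (hp0 : 0 ≤ p) (hp1 : p ≤ 1) (x : Fin m → β) : |deviation G E p x| ≤ 1 := by
  unfold deviation
  have h1 := edgeProd_nonneg (adjInd_nonneg G) E x
  have h2 := edgeProd_le_one (adjInd_nonneg G) (adjInd_le_one G) E x
  have h3 : 0 ≤ p ^ #E := by positivity
  have h4 : p ^ #E ≤ 1 := pow_le_one₀ hp0 hp1
  split_ifs
  · rw [abs_le]; constructor <;> linarith
  · simp

lemma deviation_of_not_injective {m : ℕ} {β : Type*} (G : SimpleGraph β)
    (E : Finset (Fin m × Fin m)) (p : ℝ) (x : Fin m → β) (hx : ¬ Function.Injective x) :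
    deviation G E p x = 0 := if_neg hx

open Classical in
lemma labCount_sub_eq_sum_deviation {m : ℕ} {β : Type} [Fintype β] (F : SimpleGraph (Fin m))
    (G : SimpleGraph β) (p : ℝ) {U : Fin m → Finset β}
    (hU : Pairwise fun i j => Disjoint (U i) (U j)) :
    (labCount F G U : ℝ) - p ^ numEdges F * ∏ j, (#(U j) : ℝ) =
      ∑ x, deviation G (orderedEdges F) p x * ∏ j, if x j ∈ U j then 1 else 0 := by
  have hcard : ∏ j, (#(U j) : ℝ) = ∑ x : Fin m → β, ∏ j, if x j ∈ U j then 1 else 0 := by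
    rw [← Fintype.prod_sum (f := fun j v => if v ∈ U j then (1 : ℝ) else 0)]
    simp
  rw [labCount_eq_sum, hcard, Finset.mul_sum, ← Finset.sum_sub_distrib, ← card_orderedEdges]
  refine Finset.sum_congr rfl fun x _ => ?_
  by_cases hx : Function.Injective x
  · simp only [deviation, hx, if_true]
    ring
  · have : ∏ j, (if x j ∈ U j then (1 : ℝ) else 0) = 0 := by
      by_contra hne
      refine hx fun i j hij => ?_
      by_contra hne'
      have hi : ∀ j, x j ∈ U j := by
        intro j
        by_contra hj
        exact hne (Finset.prod_eq_zero (Finset.mem_univ j) (by simp [hj]))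
      have h1 := hi i
      rw [hij] at h1
      exact Finset.disjoint_left.1 (hU hne') h1 (hi j)
    simp [this]

open Classical in
lemma factorial_mul_eq_embSum {m r : ℕ} {β : Type} [Fintype β] (F : SimpleGraph (Fin m))
    (G : SimpleGraph β) (p : ℝ) {U : Fin r → Finset β}
    (hU : Pairwise fun i j => Disjoint (U i) (U j)) :
    (m.factorial : ℝ) * ((∑ s : Finset (Fin r), if h : s.card = m then
        symCount F G (fun j => U (s.orderEmbOfFin h j)) else 0)
      - p ^ numEdges F *
        ∑ s : Finset (Fin r), if s.card = m then ∏ i ∈ s, ((U i).card : ℝ) else 0) =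
      embSum (deviation G (orderedEdges F) p) (fun i v => if v ∈ U i then 1 else 0) := by
  have hm : (m.factorial : ℝ) ≠ 0 := by exact_mod_cast m.factorial_ne_zero
  rw [embSum, sum_embedding_eq, Finset.mul_sum (a := p ^ numEdges F), ← Finset.sum_sub_distrib,
    Finset.mul_sum]
  refine Finset.sum_congr rfl fun s _ => ?_
  by_cases h : #s = m
  · simp only [h, dite_true, if_true]
    rw [symCount, mul_sub, mul_inv_cancel_left₀ hm]
    have hprod : ∏ i ∈ s, (#(U i) : ℝ) = ∏ j, (#(U (s.orderEmbOfFin h j)) : ℝ) := by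
      conv_lhs => rw [← Finset.map_orderEmbOfFin_univ s h, Finset.prod_map]
      rfl
    have hperm : ∀ σ : Equiv.Perm (Fin m), ∏ j, (#(U (s.orderEmbOfFin h (σ j))) : ℝ) =
        ∏ j, (#(U (s.orderEmbOfFin h j)) : ℝ) :=
      fun σ => Equiv.prod_comp σ fun j => (#(U (s.orderEmbOfFin h j)) : ℝ)
    have hcount : (m.factorial : ℝ) * (p ^ numEdges F * ∏ i ∈ s, (#(U i) : ℝ)) =
        ∑ σ : Equiv.Perm (Fin m), p ^ numEdges F *
          ∏ j, (#(U (s.orderEmbOfFin h (σ j))) : ℝ) := by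
      simp_rw [hperm]
      rw [Finset.sum_const, Finset.card_univ, Fintype.card_perm, Fintype.card_fin, nsmul_eq_mul,
        hprod]
    rw [hcount, ← Finset.sum_sub_distrib]
    refine Finset.sum_congr rfl fun σ _ => ?_
    refine (labCount_sub_eq_sum_deviation F G p fun i j hij => hU ?_).trans ?_
    · exact fun heq => hij (σ.injective ((s.orderEmbOfFin h).injective heq))
    · rfl
  · simp [h]

/-- The coefficients of a polynomial are controlled by its values on an interval. -/
lemma exists_coeff_le (m : ℕ) {θ : ℝ} (hθ : 0 < θ) :
    ∃ C : ℝ, 0 ≤ C ∧ ∀ (a : Fin (m + 1) → ℝ) (B : ℝ),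
      (∀ t, 0 ≤ t → t ≤ θ → |∑ k : Fin (m + 1), t ^ (k : ℕ) * a k| ≤ B) → ∀ k, |a k| ≤ C * B := by
  let v : Fin (m + 1) → ℝ := fun i => θ * ((i : ℕ) / (m + 1 : ℝ))
  have hv : Function.Injective v := by
    intro i j hij
    have hm : (m + 1 : ℝ) ≠ 0 := by positivity
    have h1 := mul_left_cancel₀ hθ.ne' hij
    have h2 := (div_left_inj' hm).1 h1
    exact Fin.ext (by exact_mod_cast h2)
  have hv0 : ∀ i, 0 ≤ v i := fun i => by positivity
  have hvθ : ∀ i, v i ≤ θ := by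
    intro i
    refine mul_le_of_le_one_right hθ.le ((div_le_one (by positivity)).2 ?_)
    have : (i : ℕ) < m + 1 := i.2
    exact_mod_cast this.le
  have hdet : IsUnit (Matrix.vandermonde v).det :=
    isUnit_iff_ne_zero.2 (Matrix.det_vandermonde_ne_zero_iff.2 hv)
  refine ⟨∑ k, ∑ i, |(Matrix.vandermonde v)⁻¹ k i|, by positivity, fun a B h k => ?_⟩
  have h1 : ∀ i, |(Matrix.vandermonde v).mulVec a i| ≤ B := fun i => h (v i) (hv0 i) (hvθ i)
  have h2 : a = (Matrix.vandermonde v)⁻¹.mulVec ((Matrix.vandermonde v).mulVec a) := by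
    rw [Matrix.mulVec_mulVec, Matrix.nonsing_inv_mul _ hdet, Matrix.one_mulVec]
  have hB : 0 ≤ B := (abs_nonneg _).trans (h1 0)
  calc |a k| = |∑ i, (Matrix.vandermonde v)⁻¹ k i * (Matrix.vandermonde v).mulVec a i| := by
        conv_lhs => rw [h2]
        rfl
    _ ≤ ∑ i, |(Matrix.vandermonde v)⁻¹ k i| * B := by
        refine (Finset.abs_sum_le_sum_abs _ _).trans (Finset.sum_le_sum fun i _ => ?_)
        rw [abs_mul]
        exact mul_le_mul_of_nonneg_left (h1 i) (abs_nonneg _)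
    _ = (∑ i, |(Matrix.vandermonde v)⁻¹ k i|) * B := by rw [Finset.sum_mul]
    _ ≤ _ := by
        refine mul_le_mul_of_nonneg_right ?_ hB
        exact Finset.single_le_sum (f := fun k => ∑ i, |(Matrix.vandermonde v)⁻¹ k i|)
          (fun k _ => by positivity) (Finset.mem_univ k)

/-- The sum of `∏ j ∈ S, c (κ j) * ∏ j ∉ S, α (κ j)` over all injections `κ`. -/
noncomputable def mixedSum {m r : ℕ} (α c : Fin r → ℝ) (S : Finset (Fin m)) : ℝ :=
  ∑ κ : Fin m ↪ Fin r, (∏ j ∈ S, c (κ j)) * ∏ j ∈ Sᶜ, α (κ j)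

lemma mixedSum_congr {m r : ℕ} (α c : Fin r → ℝ) {S T : Finset (Fin m)} (h : #S = #T) :
    mixedSum α c S = mixedSum α c T := by
  classical
  let e : {x // x ∈ S} ≃ {x // x ∈ T} := Finset.equivOfCardEq h
  let σ : Equiv.Perm (Fin m) := e.extendSubtype
  have hσ : ∀ x, σ x ∈ T ↔ x ∈ S := fun x =>
    ⟨fun hx => by_contra fun hn => e.extendSubtype_not_mem x hn hx, e.extendSubtype_mem x⟩
  have hS : S.map σ.toEmbedding = T := by
    ext x
    rw [← σ.apply_symm_apply x, hσ]
    simp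
  have hSc : Sᶜ.map σ.toEmbedding = Tᶜ := by
    ext x
    rw [← σ.apply_symm_apply x, Finset.mem_compl, hσ]
    simp
  symm
  unfold mixedSum
  refine Fintype.sum_equiv (Equiv.embeddingCongr σ.symm (Equiv.refl _)) _ _ fun κ => ?_
  rw [← hSc, ← hS, Finset.prod_map, Finset.prod_map]
  simp

/-- The sum of `f x * ∏ j ∈ S, ψ (x j)` over all `x` and all `S` of size `k`. -/
noncomputable def partialSum {m : ℕ} {β : Type*} [Fintype β] (f : (Fin m → β) → ℝ) (ψ : β → ℝ)
    (k : ℕ) : ℝ :=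
  ∑ S : Finset (Fin m) with #S = k, ∑ x, f x * ∏ j ∈ S, ψ (x j)

lemma sum_finset_eq_sum_card {m : ℕ} (H : Finset (Fin m) → ℝ) :
    ∑ S, H S = ∑ k : Fin (m + 1), ∑ S with #S = (k : ℕ), H S := by
  rw [Fin.sum_univ_eq_sum_range (fun k => ∑ S with #S = k, H S) (m + 1)]
  refine (Finset.sum_fiberwise_of_maps_to (fun S _ => ?_) H).symm
  rw [Finset.mem_range, Nat.lt_succ_iff]
  simpa using Finset.card_le_univ S

lemma embSum_add_mul {m r : ℕ} {β : Type*} [Fintype β] (f : (Fin m → β) → ℝ) (α c : Fin r → ℝ)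
    (ψ : β → ℝ) (t : ℝ) :
    embSum f (fun i v => t * c i * ψ v + α i) = ∑ k : Fin (m + 1), t ^ (k : ℕ) *
      ∑ S : Finset (Fin m) with #S = (k : ℕ), mixedSum α c S * ∑ x, f x * ∏ j ∈ S, ψ (x j) := by
  have h1 : embSum f (fun i v => t * c i * ψ v + α i) = ∑ S : Finset (Fin m),
      t ^ #S * (mixedSum α c S * ∑ x, f x * ∏ j ∈ S, ψ (x j)) := by
    unfold embSum mixedSum
    simp_rw [Fintype.prod_add, Finset.mul_sum, Finset.sum_mul, Finset.mul_sum]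
    rw [Finset.sum_congr rfl fun κ _ => Finset.sum_comm, Finset.sum_comm]
    refine Finset.sum_congr rfl fun S _ => ?_
    rw [Finset.sum_comm]
    refine Finset.sum_congr rfl fun x _ => ?_
    refine Finset.sum_congr rfl fun κ _ => ?_
    rw [Finset.prod_mul_distrib, Finset.prod_mul_distrib, Finset.prod_const]
    ring
  rw [h1, sum_finset_eq_sum_card]
  refine Finset.sum_congr rfl fun k _ => ?_
  rw [Finset.mul_sum]
  refine Finset.sum_congr rfl fun S hS => ?_
  rw [(Finset.mem_filter.1 hS).2]

/-- `embSum f` is at most `B` on all fractional families with class sizes given by `α`. -/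
def EmbSumBounded {m r : ℕ} {β : Type*} [Fintype β] (f : (Fin m → β) → ℝ) (α : Fin r → ℝ)
    (B : ℝ) : Prop :=
  ∀ φ : Fin r → β → ℝ, (∀ i v, 0 ≤ φ i v) → (∀ v, ∑ i, φ i v ≤ 1) →
    (∀ i, ∑ v, φ i v = α i * Fintype.card β) → |embSum f φ| ≤ B

lemma exists_partialSum_le_of_mixedSum_ne {m r : ℕ} {α : Fin r → ℝ} (hα : ∀ i, 0 < α i)
    (hsum : ∑ i, α i ≤ 1) {S : Finset (Fin m)} {c : Fin r → ℝ} (hc : ∑ i, c i = 0 ∨ ∑ i, α i < 1)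
    (hne : mixedSum α c S ≠ 0) :
    ∃ C : ℝ, 0 ≤ C ∧ ∀ (β : Type) [Fintype β] (f : (Fin m → β) → ℝ) (B : ℝ),
      EmbSumBounded f α B → ∀ ψ : β → ℝ, (∀ v, |ψ v| ≤ 1) → ∑ v, ψ v = 0 →
        |partialSum f ψ #S| ≤ C * B := by
  -- an admissible range of parameters
  obtain ⟨θ, hθ, h1, h2⟩ : ∃ θ : ℝ, 0 < θ ∧ (∀ i, θ * |c i| ≤ α i) ∧
      (θ * |∑ i, c i| + ∑ i, α i ≤ 1) := by
    have hlim : ∀ (a b : ℝ), (b = 0 ∧ 0 ≤ a) ∨ 0 < a →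
        ∀ᶠ θ in nhdsWithin (0 : ℝ) (Set.Ioi 0), θ * b ≤ a := by
      rintro a b (⟨rfl, ha⟩ | ha)
      · exact Eventually.of_forall fun θ => by simpa using ha
      · have : Tendsto (fun θ : ℝ => θ * b) (nhdsWithin 0 (Set.Ioi 0)) (nhds (0 * b)) :=
          (continuous_id.mul continuous_const).continuousAt.mono_left nhdsWithin_le_nhds
        rw [zero_mul] at this
        exact (this.eventually_lt_const ha).mono fun _ h => h.le
    have e1 : ∀ᶠ θ in nhdsWithin (0 : ℝ) (Set.Ioi 0), ∀ i, θ * |c i| ≤ α i :=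
      eventually_all.2 fun i => hlim _ _ (Or.inr (hα i))
    have e2 : ∀ᶠ θ in nhdsWithin (0 : ℝ) (Set.Ioi 0), θ * |∑ i, c i| ≤ 1 - ∑ i, α i := by
      refine hlim _ _ (hc.imp (fun h => ⟨by simp [h], by linarith⟩) fun h => by linarith)
    obtain ⟨θ, ⟨h1, h2⟩, h3⟩ := ((e1.and e2).and self_mem_nhdsWithin).exists
    exact ⟨θ, h3, h1, by linarith⟩
  obtain ⟨C, hC, hcoeff⟩ := exists_coeff_le m hθ
  refine ⟨C / |mixedSum α c S|, by positivity, fun β _ f B hB ψ hψ hψ0 => ?_⟩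
  have hSm : #S < m + 1 := Nat.lt_succ_of_le (by simpa using Finset.card_le_univ S)
  have := hcoeff (fun k => ∑ T : Finset (Fin m) with #T = (k : ℕ),
      mixedSum α c T * ∑ x, f x * ∏ j ∈ T, ψ (x j)) B (fun t ht0 htθ => ?_) ⟨#S, hSm⟩
  · have heq : ∑ T : Finset (Fin m) with #T = #S,
        mixedSum α c T * ∑ x, f x * ∏ j ∈ T, ψ (x j) = mixedSum α c S * partialSum f ψ #S := by
      rw [partialSum, Finset.mul_sum]
      refine Finset.sum_congr rfl fun T hT => ?_
      rw [mixedSum_congr α c (Finset.mem_filter.1 hT).2]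
    simp only [heq, abs_mul] at this
    rw [div_mul_eq_mul_div, le_div_iff₀ (abs_pos.2 hne), mul_comm]
    exact this
  · rw [← embSum_add_mul]
    have hle : ∀ v, |t * ψ v| ≤ θ := fun v => by
      rw [abs_mul, abs_of_nonneg ht0]
      exact (mul_le_of_le_one_right ht0 (hψ v)).trans htθ
    refine hB _ (fun i v => ?_) (fun v => ?_) (fun i => ?_)
    · have h3 : |t * c i * ψ v| ≤ α i := by
        calc |t * c i * ψ v| = |t * ψ v| * |c i| := by rw [← abs_mul]; ring_nf
          _ ≤ θ * |c i| := mul_le_mul_of_nonneg_right (hle v) (abs_nonneg _)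
          _ ≤ _ := h1 i
      linarith [neg_abs_le (t * c i * ψ v)]
    · have h3 : ∑ i, (t * c i * ψ v + α i) = (t * ψ v) * ∑ i, c i + ∑ i, α i := by
        rw [Finset.sum_add_distrib, Finset.mul_sum]
        congr 1
        exact Finset.sum_congr rfl fun i _ => by ring
      rw [h3]
      have h4 : (t * ψ v) * ∑ i, c i ≤ θ * |∑ i, c i| := by
        refine (le_abs_self _).trans ?_
        rw [abs_mul]
        exact mul_le_mul_of_nonneg_right (hle v) (abs_nonneg _)
      linarith
    · rw [Finset.sum_add_distrib, ← Finset.mul_sum, hψ0]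
      simp [mul_comm]

lemma mixedSum_pos_of_pos {m r : ℕ} (hrm : m ≤ r) {α c : Fin r → ℝ} (hα : ∀ i, 0 < α i)
    {S : Finset (Fin m)} (hc : ∀ i, 0 < c i) : 0 < mixedSum α c S :=
  Finset.sum_pos (fun _ _ => mul_pos (Finset.prod_pos fun _ _ => hc _)
    (Finset.prod_pos fun _ _ => hα _)) ⟨Fin.castLEEmb hrm, Finset.mem_univ _⟩

lemma mixedSum_empty_pos {m r : ℕ} (hrm : m ≤ r) {α : Fin r → ℝ} (hα : ∀ i, 0 < α i)
    (c : Fin r → ℝ) : 0 < mixedSum α c (∅ : Finset (Fin m)) := by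
  have : mixedSum α c (∅ : Finset (Fin m)) = mixedSum α 1 (∅ : Finset (Fin m)) := by
    simp [mixedSum]
  rw [this]
  exact mixedSum_pos_of_pos hrm hα fun _ => one_pos

lemma exists_mixedSum_ne_of_two_le {m r : ℕ} (hrm : m ≤ r) {α : Fin r → ℝ} (hα : ∀ i, 0 < α i)
    {S : Finset (Fin m)} (hS : 2 ≤ #S) : ∃ c : Fin r → ℝ, ∑ i, c i = 0 ∧ mixedSum α c S ≠ 0 := by
  classical
  obtain ⟨j₀, hj₀⟩ := Finset.card_pos.1 (by omega : 0 < #S)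
  set κ₀ : Fin m ↪ Fin r := Fin.castLEEmb hrm
  set T := S.map κ₀ with hT
  have hTS : #T = #S := Finset.card_map _
  have ht₀ : κ₀ j₀ ∈ T := Finset.mem_map_of_mem _ hj₀
  set c : Fin r → ℝ := fun i => if i ∈ T then if i = κ₀ j₀ then -((#S : ℝ) - 1) else 1 else 0
    with hc
  have hcT : ∏ i ∈ T, c i = -((#S : ℝ) - 1) := by
    rw [← Finset.mul_prod_erase _ _ ht₀, Finset.prod_eq_one (s := T.erase (κ₀ j₀))]
    · simp only [hc, ht₀, if_true, mul_one]
    · intro i hi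
      rw [Finset.mem_erase] at hi
      simp only [hc, hi.2, hi.1, if_true, if_false]
  have hneg : -((#S : ℝ) - 1) < 0 := by
    have : (2 : ℝ) ≤ #S := by exact_mod_cast hS
    linarith
  refine ⟨c, ?_, ne_of_lt ?_⟩
  · have : ∑ i, c i = ∑ i ∈ T, c i := by
      refine (Finset.sum_subset (Finset.subset_univ T) fun i _ hi => ?_).symm
      simp only [hc, hi, if_false]
    rw [this, ← Finset.add_sum_erase _ _ ht₀, Finset.sum_congr rfl (g := fun _ => (1 : ℝ))]
    · simp only [hc, ht₀, if_true]
      rw [Finset.sum_const, Finset.card_erase_of_mem ht₀, hTS, nsmul_eq_mul, mul_one,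
        Nat.cast_sub (by omega)]
      push_cast; ring
    · intro i hi
      rw [Finset.mem_erase] at hi
      simp only [hc, hi.2, hi.1, if_true, if_false]
  · have hα' : ∀ κ : Fin m ↪ Fin r, 0 < ∏ j ∈ Sᶜ, α (κ j) :=
      fun κ => Finset.prod_pos fun _ _ => hα _
    refine Finset.sum_neg' (fun κ _ => ?_) ⟨κ₀, Finset.mem_univ _, ?_⟩
    · refine mul_nonpos_of_nonpos_of_nonneg ?_ (hα' κ).le
      by_cases h : S.map κ = T
      · rw [← Finset.prod_map S κ c, h, hcT]
        exact hneg.le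
      · have : ∃ j ∈ S, κ j ∉ T := by
          by_contra hcon
          push Not at hcon
          refine h (Finset.eq_of_subset_of_card_le ?_ (by rw [hTS, Finset.card_map]))
          intro i hi
          obtain ⟨j, hj, rfl⟩ := Finset.mem_map.1 hi
          exact hcon j hj
        obtain ⟨j, hj, hjT⟩ := this
        rw [Finset.prod_eq_zero hj]
        simp only [hc, hjT, if_false]
    · rw [← Finset.prod_map S κ₀ c, ← hT, hcT]
      exact mul_neg_of_neg_of_pos hneg (hα' κ₀)

lemma exists_mixedSum_ne_of_ne_const {m r : ℕ} (hm : 2 ≤ m) (hrm : m ≤ r) {α : Fin r → ℝ}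
    (hα : ∀ i, 0 < α i) (hsum : ∑ i, α i ≤ 1) (hne : α ≠ fun _ => 1 / (r : ℝ))
    {S : Finset (Fin m)} (hS : #S = 1) :
    ∃ c : Fin r → ℝ, (∑ i, c i = 0 ∨ ∑ i, α i < 1) ∧ mixedSum α c S ≠ 0 := by
  classical
  rcases hsum.lt_or_eq with hlt | heq
  · exact ⟨1, Or.inr hlt, (mixedSum_pos_of_pos hrm hα fun _ => one_pos).ne'⟩
  obtain ⟨a, b, hab⟩ : ∃ a b, α a < α b := by
    by_contra hcon
    push Not at hcon
    refine hne (funext fun i => ?_)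
    have h1 : ∀ j, α j = α i := fun j => le_antisymm (hcon i j) (hcon j i)
    have hr : (r : ℝ) ≠ 0 := by
      have : 0 < r := by omega
      positivity
    rw [Finset.sum_congr rfl fun j _ => h1 j, Finset.sum_const, Finset.card_univ,
      Fintype.card_fin, nsmul_eq_mul] at heq
    field_simp
    linarith
  have hne' : a ≠ b := fun h => by simp [h] at hab
  obtain ⟨j, rfl⟩ := Finset.card_eq_one.1 hS
  obtain ⟨j', hj'⟩ : ∃ j', j ≠ j' := by
    have : Nontrivial (Fin m) := Fin.nontrivial_iff_two_le.2 hm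
    obtain ⟨j', h⟩ := exists_ne j
    exact ⟨j', h.symm⟩
  refine ⟨fun i => (if i = a then 1 else 0) - (if i = b then 1 else 0), Or.inl (by simp),
    ne_of_gt ?_⟩
  set P : (Fin m ↪ Fin r) → ℝ := fun κ => ∏ i ∈ ({j}ᶜ : Finset (Fin m)), α (κ i) with hP
  set sw : (Fin m ↪ Fin r) → (Fin m ↪ Fin r) :=
    fun κ => κ.trans (Equiv.swap a b).toEmbedding with hsw
  have hsw2 : ∀ κ, sw (sw κ) = κ := fun κ => by ext i; simp [sw]
  have hB : mixedSum α (fun i => (if i = a then (1 : ℝ) else 0) - (if i = b then 1 else 0)) {j} =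
      ∑ κ : Fin m ↪ Fin r, (if κ j = a then 1 else 0) * (P κ - P (sw κ)) := by
    have h1 : ∑ κ : Fin m ↪ Fin r, (if κ j = b then 1 else 0) * P κ =
        ∑ κ : Fin m ↪ Fin r, (if κ j = a then 1 else 0) * P (sw κ) := by
      refine Fintype.sum_equiv ⟨sw, sw, hsw2, hsw2⟩ _ _ fun κ => ?_
      simp only [Equiv.coe_fn_mk, hsw2]
      congr 2
      simp only [hsw, Function.Embedding.trans_apply, Equiv.coe_toEmbedding, eq_iff_iff]
      rw [Equiv.swap_apply_eq_iff, Equiv.swap_apply_left]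
    simp_rw [mul_sub]
    rw [Finset.sum_sub_distrib, ← h1, ← Finset.sum_sub_distrib]
    unfold mixedSum
    refine Finset.sum_congr rfl fun κ _ => ?_
    rw [Finset.prod_singleton, sub_mul]
  have hle : ∀ κ : Fin m ↪ Fin r, κ j = a → ∀ i ∈ ({j}ᶜ : Finset (Fin m)),
      0 < α (sw κ i) ∧ α (sw κ i) ≤ α (κ i) := by
    intro κ hκ i hi
    refine ⟨hα _, ?_⟩
    have hia : κ i ≠ a := by
      rw [← hκ]
      exact fun h => (by simpa using hi : i ≠ j) (κ.injective h)
    simp only [hsw, Function.Embedding.trans_apply, Equiv.coe_toEmbedding]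
    by_cases hib : κ i = b
    · rw [hib, Equiv.swap_apply_right]; exact hab.le
    · rw [Equiv.swap_apply_of_ne_of_ne hia hib]
  rw [hB]
  obtain ⟨σ, hσ1, hσ2⟩ : ∃ σ : Equiv.Perm (Fin r), σ (Fin.castLE hrm j) = a ∧
      σ (Fin.castLE hrm j') = b :=
    exists_perm_apply_eq (fun h => hj' (Fin.castLE_injective hrm h)) hne'
  refine Finset.sum_pos' (fun κ _ => ?_)
    ⟨(Fin.castLEEmb hrm).trans σ.toEmbedding, Finset.mem_univ _, ?_⟩
  · split_ifs with h
    · rw [one_mul, sub_nonneg]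
      exact Finset.prod_le_prod (fun i hi => (hle κ h i hi).1.le) fun i hi => (hle κ h i hi).2
    · simp
  · have h : ((Fin.castLEEmb hrm).trans σ.toEmbedding) j = a := hσ1
    rw [if_pos h, one_mul, sub_pos]
    refine Finset.prod_lt_prod (fun i hi => (hle _ h i hi).1) (fun i hi => (hle _ h i hi).2)
      ⟨j', by simpa using hj'.symm, ?_⟩
    simp [hsw, hσ2, hab]

/-- Up to a small error, only the linear part of `f` is visible when `embSum f` is small, and
not even that one if `α` is not uniform. -/
lemma exists_partialSum_le {m r : ℕ} (hm : 2 ≤ m) (hrm : m ≤ r) {α : Fin r → ℝ}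
    (hα : ∀ i, 0 < α i) (hsum : ∑ i, α i ≤ 1) :
    ∃ C : ℝ, 0 ≤ C ∧ ∀ (β : Type) [Fintype β] (f : (Fin m → β) → ℝ) (B : ℝ),
      EmbSumBounded f α B → ∀ ψ : β → ℝ, (∀ v, |ψ v| ≤ 1) → ∑ v, ψ v = 0 →
        ∀ k ≤ m, (k ≠ 1 ∨ α ≠ fun _ => 1 / (r : ℝ)) → |partialSum f ψ k| ≤ C * B := by
  have key : ∀ k : Fin (m + 1), ∃ C : ℝ, 0 ≤ C ∧
      (((k : ℕ) ≠ 1 ∨ α ≠ fun _ => 1 / (r : ℝ)) → ∀ (β : Type) [Fintype β]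
        (f : (Fin m → β) → ℝ) (B : ℝ), EmbSumBounded f α B → ∀ ψ : β → ℝ, (∀ v, |ψ v| ≤ 1) →
        ∑ v, ψ v = 0 → |partialSum f ψ k| ≤ C * B) := by
    intro k
    obtain ⟨S, -, hS⟩ := Finset.exists_subset_card_eq
      (show (k : ℕ) ≤ #(univ : Finset (Fin m)) by simpa using Nat.lt_succ_iff.1 k.2)
    by_cases hk : (k : ℕ) ≠ 1 ∨ α ≠ fun _ => 1 / (r : ℝ)
    · obtain ⟨c, hc, hne⟩ : ∃ c : Fin r → ℝ, (∑ i, c i = 0 ∨ ∑ i, α i < 1) ∧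
          mixedSum α c S ≠ 0 := by
        rcases Nat.lt_or_ge #S 2 with h2 | h2
        · rcases Nat.lt_or_ge #S 1 with h1 | h1
          · have : S = ∅ := Finset.card_eq_zero.1 (by omega)
            subst this
            exact ⟨0, Or.inl (by simp), (mixedSum_empty_pos hrm hα 0).ne'⟩
          · refine exists_mixedSum_ne_of_ne_const hm hrm hα hsum ?_ (by omega)
            exact hk.resolve_left fun h => h (by omega)
        · obtain ⟨c, h1, h2⟩ := exists_mixedSum_ne_of_two_le hrm hα h2
          exact ⟨c, Or.inl h1, h2⟩
      obtain ⟨C, hC, h⟩ := exists_partialSum_le_of_mixedSum_ne hα hsum hc hne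
      rw [hS] at h
      exact ⟨C, hC, fun _ => h⟩
    · exact ⟨0, le_rfl, fun h => absurd h hk⟩
  choose C hC h using key
  refine ⟨∑ k, C k, Finset.sum_nonneg fun k _ => hC k, ?_⟩
  intro β _ f B hB ψ hψ hψ0 k hk hk1
  have hB0 : 0 ≤ B := by
    have := (abs_nonneg _).trans (hB (fun i _ => α i) (fun i _ => (hα i).le) (fun _ => hsum)
      (fun i => by simp [mul_comm]))
    exact this
  refine (h ⟨k, Nat.lt_succ_of_le hk⟩ hk1 β f B hB ψ hψ hψ0).trans ?_
  exact mul_le_mul_of_nonneg_right (Finset.single_le_sum (fun k _ => hC k) (Finset.mem_univ _)) hB0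

lemma sum_apply_mul_prod_eq {ι β : Type*} [Fintype ι] [DecidableEq ι] [Fintype β]
    (g : β → ℝ) (a : ι → β → ℝ) (j : ι) :
    ∑ x : ι → β, g (x j) * ∏ i, a i (x i) =
      (∑ v, g v * a j v) * ∏ i ∈ univ.erase j, ∑ v, a i v := by
  have h1 : ∀ x : ι → β, g (x j) * ∏ i, a i (x i) =
      ∏ i, (if i = j then g (x i) * a i (x i) else a i (x i)) := by
    intro x
    rw [← Finset.mul_prod_erase _ _ (Finset.mem_univ j),
      ← Finset.mul_prod_erase univ (fun i => if i = j then g (x i) * a i (x i) else a i (x i))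
        (Finset.mem_univ j), if_pos rfl, mul_assoc]
    congr 2
    exact Finset.prod_congr rfl fun i hi => (if_neg (Finset.ne_of_mem_erase hi)).symm
  simp_rw [h1]
  rw [← Fintype.prod_sum (f := fun i v => if i = j then g v * a i v else a i v),
    ← Finset.mul_prod_erase _ _ (Finset.mem_univ j)]
  congr 1
  · simp
  · refine Finset.prod_congr rfl fun i hi => ?_
    simp [Finset.ne_of_mem_erase hi]

open Classical in
/-- The total of `f` over the maps through the vertex `v`, counted with multiplicity. -/
noncomputable def vertexSum {m : ℕ} {β : Type*} [Fintype β] (f : (Fin m → β) → ℝ) (v : β) : ℝ :=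
  ∑ j, ∑ x, if x j = v then f x else 0

lemma sum_mul_vertexSum {m : ℕ} {β : Type*} [Fintype β] (f : (Fin m → β) → ℝ) (ψ : β → ℝ) :
    ∑ v, ψ v * vertexSum f v = ∑ j, ∑ x, f x * ψ (x j) := by
  classical
  unfold vertexSum
  simp_rw [Finset.mul_sum]
  rw [Finset.sum_comm]
  refine Finset.sum_congr rfl fun j _ => ?_
  rw [Finset.sum_comm]
  refine Finset.sum_congr rfl fun x _ => ?_
  simp [mul_comm]

lemma partialSum_one {m : ℕ} {β : Type*} [Fintype β] (f : (Fin m → β) → ℝ) (ψ : β → ℝ) :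
    partialSum f ψ 1 = ∑ v, ψ v * vertexSum f v := by
  rw [sum_mul_vertexSum, partialSum]
  symm
  refine Finset.sum_bij (fun j _ => {j}) (fun j _ => by simp) (fun i _ j _ h => by simpa using h)
    (fun S hS => ?_) (fun j _ => by simp)
  obtain ⟨j, rfl⟩ := Finset.card_eq_one.1 (Finset.mem_filter.1 hS).2
  exact ⟨j, Finset.mem_univ _, rfl⟩

lemma partialSum_zero {m : ℕ} {β : Type*} [Fintype β] (f : (Fin m → β) → ℝ) (ψ : β → ℝ) :
    partialSum f ψ 0 = ∑ x, f x := by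
  have : (univ.filter fun S : Finset (Fin m) => #S = 0) = {∅} := by ext; simp
  rw [partialSum, this]
  simp

lemma sum_mul_prod_add_const {m : ℕ} {β : Type*} [Fintype β] (f : (Fin m → β) → ℝ) (ψ : β → ℝ)
    (t : ℝ) : ∑ x, f x * ∏ j, (ψ (x j) + t) =
      ∑ k : Fin (m + 1), t ^ (m - k) * partialSum f ψ k := by
  simp_rw [Fintype.prod_add, Finset.mul_sum]
  rw [Finset.sum_comm, sum_finset_eq_sum_card]
  refine Finset.sum_congr rfl fun k _ => ?_
  rw [partialSum, Finset.mul_sum]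
  refine Finset.sum_congr rfl fun S hS => ?_
  rw [Finset.mul_sum]
  refine Finset.sum_congr rfl fun x _ => ?_
  rw [Finset.prod_const, Finset.card_compl, (Finset.mem_filter.1 hS).2, Fintype.card_fin]
  ring

lemma abs_vertexSum_le {m : ℕ} (hm : 0 < m) {β : Type*} [Fintype β] [Nonempty β]
    {f : (Fin m → β) → ℝ} (hf : ∀ x, |f x| ≤ 1) (v : β) :
    |vertexSum f v| ≤ m * (Fintype.card β : ℝ) ^ (m - 1) := by
  classical
  have hN : (0 : ℝ) < Fintype.card β := by exact_mod_cast Fintype.card_pos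
  have h1 : ∀ j : Fin m, |∑ x, if x j = v then f x else 0| ≤ (Fintype.card β : ℝ) ^ (m - 1) := by
    intro j
    have h2 := card_mul_card_filter_apply (m := m) j (fun u => u = v)
    have h3 : (#(univ.filter fun u : β => u = v) : ℝ) = 1 := by
      exact_mod_cast Finset.card_eq_one.2 ⟨v, by ext; simp⟩
    have hpow : (Fintype.card β : ℝ) ^ m = Fintype.card β * (Fintype.card β : ℝ) ^ (m - 1) := by
      conv_lhs => rw [show m = (m - 1) + 1 by omega, pow_succ']
    rw [h3, one_mul, hpow] at h2
    rw [← mul_left_cancel₀ hN.ne' h2, ← Finset.sum_boole]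
    refine (Finset.abs_sum_le_sum_abs _ _).trans (Finset.sum_le_sum fun x _ => ?_)
    split_ifs
    · exact hf x
    · simp
  refine (Finset.abs_sum_le_sum_abs _ _).trans ((Finset.sum_le_sum fun j _ => h1 j).trans_eq ?_)
  simp

/-- A function `f` with small `embSum` is close, on powers of functions, to a sum of functions of
one vertex. -/
theorem exists_vertexWeight {m r : ℕ} (hm : 2 ≤ m) (hrm : m ≤ r) {α : Fin r → ℝ}
    (hα : ∀ i, 0 < α i) (hsum : ∑ i, α i ≤ 1) :
    ∃ C : ℝ, 0 ≤ C ∧ ∀ (β : Type) [Fintype β] [Nonempty β] (f : (Fin m → β) → ℝ) (B : ℝ),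
      (∀ x, |f x| ≤ 1) → EmbSumBounded f α B →
      ∃ g : β → ℝ, (∀ v, |g v| ≤ 1) ∧
        |∑ v, g v| * (Fintype.card β : ℝ) ^ m ≤ C * B * Fintype.card β ∧
        ((α ≠ fun _ => 1 / (r : ℝ)) → ∀ v, g v = 0) ∧
        ∀ φ : β → ℝ, (∀ v, 0 ≤ φ v) → (∀ v, φ v ≤ 1) →
          |∑ x, (f x - ∑ j, g (x j)) * ∏ j, φ (x j)| ≤ C * B := by
  classical
  obtain ⟨C, hC, key⟩ := exists_partialSum_le hm hrm hα hsum
  refine ⟨(2 * m + 1) * C, by positivity, fun β _ _ f B hf hB => ?_⟩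
  set N : ℝ := (Fintype.card β : ℝ) with hN
  have hN0 : 0 < N := by rw [hN]; exact_mod_cast Fintype.card_pos
  have hB0 : 0 ≤ B := (abs_nonneg _).trans (hB (fun i _ => α i) (fun i _ => (hα i).le)
    (fun _ => hsum) (fun i => by simp [mul_comm]))
  have hm0 : (0 : ℝ) < m := by positivity
  have hCB : C * B ≤ (2 * m + 1) * C * B := by
    have : 0 ≤ 2 * m * (C * B) := by positivity
    linarith
  -- decomposition of a function into its mean and a balanced part
  have hdec : ∀ φ : β → ℝ, (∀ v, 0 ≤ φ v) → (∀ v, φ v ≤ 1) → ∃ (t : ℝ) (ψ : β → ℝ),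
      0 ≤ t ∧ t ≤ 1 ∧ (∀ v, φ v = ψ v + t) ∧ (∀ v, |ψ v| ≤ 1) ∧ ∑ v, ψ v = 0 ∧
        ∑ v, φ v = t * N := by
    intro φ h0 h1
    have ht0 : 0 ≤ (∑ v, φ v) / N := div_nonneg (Finset.sum_nonneg fun v _ => h0 v) hN0.le
    have ht1 : (∑ v, φ v) / N ≤ 1 := by
      rw [div_le_one hN0]
      refine (Finset.sum_le_sum fun v _ => h1 v).trans_eq ?_
      simp [hN]
    refine ⟨(∑ v, φ v) / N, fun v => φ v - (∑ v, φ v) / N, ht0, ht1, fun v => by ring,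
      fun v => ?_, ?_, by field_simp⟩
    · have := h0 v; have := h1 v
      rw [abs_le]; constructor <;> linarith
    · rw [Finset.sum_sub_distrib, Finset.sum_const, Finset.card_univ, nsmul_eq_mul, ← hN]
      field_simp
      ring
  by_cases hc : α ≠ fun _ => 1 / (r : ℝ)
  · refine ⟨0, by simp, ?_, by simp, fun φ h0 h1 => ?_⟩
    · simp only [Pi.zero_apply, Finset.sum_const_zero, abs_zero, zero_mul]
      positivity
    · obtain ⟨t, ψ, ht0, ht1, hφ, hψ, hψ0, -⟩ := hdec φ h0 h1
      simp only [Pi.zero_apply, Finset.sum_const_zero, sub_zero, hφ]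
      rw [sum_mul_prod_add_const]
      calc _ ≤ ∑ k : Fin (m + 1), C * B := by
            refine (Finset.abs_sum_le_sum_abs _ _).trans (Finset.sum_le_sum fun k _ => ?_)
            rw [abs_mul]
            have h2 : |t ^ (m - k : ℕ)| ≤ 1 := by
              rw [abs_of_nonneg (pow_nonneg ht0 _)]; exact pow_le_one₀ ht0 ht1
            have h3 := key β f B hB ψ hψ hψ0 k (Nat.lt_succ_iff.1 k.2) (Or.inr hc)
            exact (mul_le_of_le_one_left (abs_nonneg _) h2).trans h3
        _ = (m + 1) * (C * B) := by simp
        _ ≤ _ := by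
          have : 0 ≤ m * (C * B) := by positivity
          linarith
  · have hpow : N ^ m = N * N ^ (m - 1) := by
      conv_lhs => rw [show m = (m - 1) + 1 by omega, pow_succ']
    have hNp : 0 < N ^ (m - 1) := by positivity
    have hf0 : |∑ x, f x| ≤ C * B := by
      rw [← partialSum_zero f 0]
      exact key β f B hB 0 (by simp) (by simp) 0 (by omega) (Or.inl (by omega))
    have hG : ∑ v, vertexSum f v = m * ∑ x, f x := by
      have := sum_mul_vertexSum f 1
      simp only [Pi.one_apply, one_mul, mul_one] at this
      rw [this]; simp
    refine ⟨fun v => vertexSum f v / (m * N ^ (m - 1)), fun v => ?_, ?_, fun h => absurd h hc,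
      fun φ h0 h1 => ?_⟩
    · rw [abs_div, abs_of_pos (by positivity : (0 : ℝ) < m * N ^ (m - 1)),
        div_le_one (by positivity)]
      exact abs_vertexSum_le (by omega) hf v
    · rw [← Finset.sum_div, hG, mul_div_mul_left _ _ hm0.ne', hpow, abs_div, abs_of_pos hNp,
        div_mul_eq_mul_div, mul_left_comm, ← mul_assoc, mul_div_cancel_right₀ _ hNp.ne', mul_comm]
      exact mul_le_mul_of_nonneg_right (hf0.trans hCB) hN0.le
    · obtain ⟨t, ψ, ht0, ht1, hφ, hψ, hψ0, hφs⟩ := hdec φ h0 h1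
      have e1 : ∑ x : Fin m → β, (∑ j, vertexSum f (x j) / (m * N ^ (m - 1))) * ∏ j, φ (x j) =
          t ^ (m - 1) * ∑ v, φ v * vertexSum f v := by
        simp_rw [Finset.sum_mul]
        rw [Finset.sum_comm]
        have : ∀ j : Fin m, ∑ x : Fin m → β,
            vertexSum f (x j) / (m * N ^ (m - 1)) * ∏ j, φ (x j) =
            t ^ (m - 1) * (∑ v, φ v * vertexSum f v) / m := by
          intro j
          rw [sum_apply_mul_prod_eq (fun v => vertexSum f v / (m * N ^ (m - 1))) (fun _ => φ) j,
            Finset.prod_const, Finset.card_erase_of_mem (Finset.mem_univ j), Finset.card_univ,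
            Fintype.card_fin, hφs, mul_pow]
          simp_rw [div_mul_eq_mul_div]
          rw [← Finset.sum_div, Finset.sum_congr rfl fun v _ => mul_comm _ _]
          field_simp
        rw [Finset.sum_congr rfl fun j _ => this j, Finset.sum_const, Finset.card_univ,
          Fintype.card_fin, nsmul_eq_mul]
        field_simp
      have e2 : ∑ v, φ v * vertexSum f v = partialSum f ψ 1 + t * (m * ∑ x, f x) := by
        rw [partialSum_one, ← hG, Finset.mul_sum, ← Finset.sum_add_distrib]
        exact Finset.sum_congr rfl fun v _ => by rw [hφ]; ring
      have e3 : ∑ x, f x * ∏ j, φ (x j) = ∑ k : Fin (m + 1), t ^ (m - k) * partialSum f ψ k := by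
        simp_rw [hφ]
        exact sum_mul_prod_add_const f ψ t
      have h1m : 1 < m + 1 := by omega
      simp_rw [sub_mul]
      rw [Finset.sum_sub_distrib, e1, e2, e3,
        ← Finset.add_sum_erase univ (fun k : Fin (m + 1) => t ^ (m - (k : ℕ)) * partialSum f ψ k)
          (Finset.mem_univ ⟨1, h1m⟩)]
      have e4 : ∀ k ∈ univ.erase (⟨1, h1m⟩ : Fin (m + 1)),
          |t ^ (m - (k : ℕ)) * partialSum f ψ k| ≤ C * B := by
        intro k hk
        have hk1 : (k : ℕ) ≠ 1 := fun h => Finset.ne_of_mem_erase hk (Fin.ext h)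
        rw [abs_mul]
        have h2 : |t ^ (m - k : ℕ)| ≤ 1 := by
          rw [abs_of_nonneg (pow_nonneg ht0 _)]; exact pow_le_one₀ ht0 ht1
        exact (mul_le_of_le_one_left (abs_nonneg _) h2).trans
          (key β f B hB ψ hψ hψ0 k (Nat.lt_succ_iff.1 k.2) (Or.inl hk1))
      have e5 : |∑ k ∈ univ.erase (⟨1, h1m⟩ : Fin (m + 1)),
          t ^ (m - (k : ℕ)) * partialSum f ψ k| ≤ m * (C * B) := by
        refine (Finset.abs_sum_le_sum_abs _ _).trans ((Finset.sum_le_sum e4).trans_eq ?_)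
        rw [Finset.sum_const, Finset.card_erase_of_mem (Finset.mem_univ _), Finset.card_univ,
          Fintype.card_fin, nsmul_eq_mul, Nat.add_sub_cancel]
      have e6 : |t ^ (m - 1) * (t * (m * ∑ x, f x))| ≤ m * (C * B) := by
        rw [← mul_assoc, ← pow_succ, abs_mul, abs_of_nonneg (pow_nonneg ht0 _), abs_mul,
          Nat.abs_cast]
        refine (mul_le_of_le_one_left (by positivity) (pow_le_one₀ ht0 ht1)).trans ?_
        exact mul_le_mul_of_nonneg_left hf0 hm0.le
      simp only
      rw [mul_add]
      calc _ = |(∑ k ∈ univ.erase (⟨1, h1m⟩ : Fin (m + 1)),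
          t ^ (m - (k : ℕ)) * partialSum f ψ k) + -(t ^ (m - 1) * (t * (m * ∑ x, f x)))| := by
            congr 1; ring
        _ ≤ m * (C * B) + m * (C * B) := by
            refine (abs_add_le _ _).trans (add_le_add e5 ?_)
            rw [abs_neg]; exact e6
        _ ≤ _ := by
            have : 0 ≤ C * B := by positivity
            linarith

/-- Ryser's formula: a permanent as an alternating sum of products of partial row sums. -/
lemma sum_perm_prod_eq {m : ℕ} (a : Fin m → Fin m → ℝ) :
    ∑ σ : Equiv.Perm (Fin m), ∏ j, a j (σ j) =
      ∑ S : Finset (Fin m), (-1) ^ #Sᶜ * ∏ j, ∑ i ∈ S, a j i := by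
  classical
  have h1 : ∀ t : Fin m → Fin m, ∑ S : Finset (Fin m), (-1 : ℝ) ^ #Sᶜ *
      (∏ j, if t j ∈ S then 1 else 0) = if Function.Bijective t then 1 else 0 := by
    intro t
    have h2 : ∀ S : Finset (Fin m), (-1 : ℝ) ^ #Sᶜ * (∏ j, if t j ∈ S then 1 else 0) =
        (∏ i ∈ S, (1 : ℝ)) * ∏ i ∈ Sᶜ, -(if i ∈ univ.image t then (0 : ℝ) else 1) := by
      intro S
      rw [Finset.prod_const_one, one_mul, Finset.prod_neg]
      congr 1
      by_cases h : ∃ j, t j ∉ S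
      · obtain ⟨j, hj⟩ := h
        rw [Finset.prod_eq_zero (Finset.mem_univ j) (if_neg hj),
          Finset.prod_eq_zero (i := t j) (by simpa using hj) (by simp)]
      · push Not at h
        rw [Finset.prod_eq_one fun j _ => if_pos (h j), Finset.prod_eq_one fun i hi => ?_]
        refine if_neg fun hi' => ?_
        obtain ⟨j, -, rfl⟩ := Finset.mem_image.1 hi'
        exact (Finset.mem_compl.1 hi) (h j)
    simp_rw [h2]
    rw [← Fintype.prod_add]
    by_cases h : Function.Bijective t
    · rw [if_pos h]
      refine Finset.prod_eq_one fun i _ => ?_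
      obtain ⟨j, rfl⟩ := h.2 i
      simp
    · rw [if_neg h]
      have h3 : ¬ Function.Surjective t := fun hs => h (Finite.surjective_iff_bijective.1 hs)
      unfold Function.Surjective at h3
      push Not at h3
      obtain ⟨i, hi⟩ := h3
      refine Finset.prod_eq_zero (Finset.mem_univ i) ?_
      simp [hi]
  have h4 : ∀ S : Finset (Fin m), ∏ j, ∑ i ∈ S, a j i =
      ∑ t : Fin m → Fin m, (∏ j, a j (t j)) * ∏ j, if t j ∈ S then 1 else 0 := by
    intro S
    simp_rw [← Finset.prod_mul_distrib]
    rw [← Fintype.prod_sum (f := fun j i => a j i * if i ∈ S then (1 : ℝ) else 0)]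
    simp
  simp_rw [h4, Finset.mul_sum]
  rw [Finset.sum_comm]
  have h5 : ∀ t : Fin m → Fin m, ∑ S : Finset (Fin m), (-1 : ℝ) ^ #Sᶜ *
      ((∏ j, a j (t j)) * ∏ j, if t j ∈ S then 1 else 0) =
        if Function.Bijective t then ∏ j, a j (t j) else 0 := by
    intro t
    simp_rw [mul_left_comm _ (∏ j, a j (t j))]
    rw [← Finset.mul_sum, h1]
    simp
  rw [Finset.sum_congr rfl fun t _ => h5 t, ← Finset.sum_filter]
  refine Finset.sum_bij (fun σ _ => ⇑σ) 
    (fun σ _ => Finset.mem_filter.2 ⟨Finset.mem_univ _, σ.bijective⟩)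
    (fun σ _ τ _ h => DFunLike.coe_injective h) (fun t ht => ?_) (fun _ _ => rfl)
  exact ⟨Equiv.ofBijective t (Finset.mem_filter.1 ht).2, Finset.mem_univ _, rfl⟩

open Classical in
lemma abs_sum_perm_le {m : ℕ} {β : Type*} [Fintype β] {h : (Fin m → β) → ℝ} {B : ℝ}
    (hB : ∀ φ : β → ℝ, (∀ v, 0 ≤ φ v) → (∀ v, φ v ≤ 1) → |∑ x, h x * ∏ j, φ (x j)| ≤ B)
    {U : Fin m → Finset β} (hU : Pairwise fun i j => Disjoint (U i) (U j)) :
    |∑ σ : Equiv.Perm (Fin m), ∑ x, h x * ∏ j, if x j ∈ U (σ j) then 1 else 0| ≤ 2 ^ m * B := by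
  have h1 : ∑ σ : Equiv.Perm (Fin m), ∑ x, h x * ∏ j, (if x j ∈ U (σ j) then (1 : ℝ) else 0) =
      ∑ S : Finset (Fin m), (-1) ^ #Sᶜ *
        ∑ x, h x * ∏ j, ∑ i ∈ S, if x j ∈ U i then (1 : ℝ) else 0 := by
    have hx : ∀ x : Fin m → β, ∑ σ : Equiv.Perm (Fin m),
        h x * ∏ j, (if x j ∈ U (σ j) then (1 : ℝ) else 0) =
          ∑ S : Finset (Fin m), (-1) ^ #Sᶜ *
            (h x * ∏ j, ∑ i ∈ S, if x j ∈ U i then (1 : ℝ) else 0) := by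
      intro x
      rw [← Finset.mul_sum, sum_perm_prod_eq (fun j i => if x j ∈ U i then (1 : ℝ) else 0),
        Finset.mul_sum]
      exact Finset.sum_congr rfl fun S _ => by ring
    rw [Finset.sum_comm, Finset.sum_congr rfl fun x _ => hx x, Finset.sum_comm]
    exact Finset.sum_congr rfl fun S _ => (Finset.mul_sum _ _ _).symm
  rw [h1]
  have h2 : ∀ S : Finset (Fin m), |(-1 : ℝ) ^ #Sᶜ *
        ∑ x, h x * ∏ j, ∑ i ∈ S, (if x j ∈ U i then (1 : ℝ) else 0)| ≤ B := by
    intro S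
    rw [abs_mul, abs_pow, abs_neg, abs_one, one_pow, one_mul]
    refine hB (fun v => ∑ i ∈ S, if v ∈ U i then (1 : ℝ) else 0) (fun v => ?_) (fun v => ?_)
    · exact Finset.sum_nonneg fun i _ => by split_ifs <;> norm_num
    · rw [Finset.sum_boole]
      have : #(S.filter fun i => v ∈ U i) ≤ 1 := by
        refine Finset.card_le_one.2 fun i hi j hj => ?_
        by_contra hij
        exact Finset.disjoint_left.1 (hU hij) (Finset.mem_filter.1 hi).2 (Finset.mem_filter.1 hj).2
      exact_mod_cast this
  refine (Finset.abs_sum_le_sum_abs _ _).trans ((Finset.sum_le_sum fun S _ => h2 S).trans_eq ?_)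
  simp

/-- For a single graph: if the property `P̃(F;α₁,…,α_r)` holds with error `τ`, then the
symmetrised counts of `F` between disjoint sets are controlled by vertex weights. -/
theorem exists_weight_symmetrised_count {m r : ℕ} (F : SimpleGraph (Fin m)) (hm : 2 ≤ m)
    (hrm : m ≤ r) {p : ℝ} (hp0 : 0 ≤ p) (hp1 : p ≤ 1) {α : Fin r → ℝ} (hα : ∀ i, 0 < α i)
    (hsum : ∑ i, α i ≤ 1) :
    ∃ C : ℝ, 0 ≤ C ∧ ∀ (β : Type) [Fintype β] [Nonempty β] (G : SimpleGraph β) (τ : ℝ), 0 ≤ τ →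
      (∀ U : Fin r → Finset β, Pairwise (fun i j => Disjoint (U i) (U j)) →
        (∀ i, #(U i) = ⌊α i * Fintype.card β⌋₊) →
        |(∑ s : Finset (Fin r), if h : s.card = m then
            symCount F G (fun j => U (s.orderEmbOfFin h j)) else 0)
          - p ^ numEdges F *
            ∑ s : Finset (Fin r), if s.card = m then ∏ i ∈ s, ((U i).card : ℝ) else 0|
          ≤ τ * (Fintype.card β : ℝ) ^ m) →
      ∃ g : β → ℝ, (∀ v, |g v| ≤ 1) ∧
        |∑ v, g v| ≤ C * (τ + 1 / √(Fintype.card β)) * Fintype.card β ∧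
        ((α ≠ fun _ => 1 / (r : ℝ)) → ∀ v, g v = 0) ∧
        ∀ (U : Fin m → Finset β) (a : Fin m → ℝ), Pairwise (fun i j => Disjoint (U i) (U j)) →
          (∀ i, ∑ v ∈ U i, g v = a i * #(U i)) →
          |∑ σ : Equiv.Perm (Fin m), (labCount F G (fun i => U (σ i)) : ℝ) -
            m.factorial * (p ^ numEdges F + ∑ i, a i) * ∏ i, (#(U i) : ℝ)| ≤
            C * (τ + 1 / √(Fintype.card β)) * (Fintype.card β : ℝ) ^ m := by
  classical
  obtain ⟨C, hC, key⟩ := exists_vertexWeight hm hrm hα hsum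
  set K : ℝ := m.factorial + 2 * r * m * (Fintype.card (Fin m ↪ Fin r) : ℝ) with hK
  have hK0 : 0 ≤ K := by positivity
  refine ⟨2 ^ m * (C * K), by positivity, fun β _ _ G τ hτ0 hτ => ?_⟩
  set N : ℝ := (Fintype.card β : ℝ) with hN
  have hN0 : 0 < N := by rw [hN]; exact_mod_cast Fintype.card_pos
  set ρ := τ + 1 / √N with hρ
  have hρ0 : 0 ≤ ρ := by positivity
  have h2m : (1 : ℝ) ≤ 2 ^ m := one_le_pow₀ (by norm_num)
  set f := deviation G (orderedEdges F) p with hf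
  have hbdd : EmbSumBounded f α (K * ρ * N ^ m) := by
    intro φ h0 h1 h2
    refine (abs_embSum_le_of_sets (τ := m.factorial * τ) (abs_deviation_le G _ hp0 hp1)
      (deviation_of_not_injective G _ p) (fun i => (hα i).le) hsum ?_ h0 h1 h2).trans ?_
    · intro U hU hcard
      have e1 := factorial_mul_eq_embSum F G p hU
      have e2 := hτ U hU hcard
      have e3 : |embSum (deviation G (orderedEdges F) p) fun i v => if v ∈ U i then 1 else 0| ≤
          m.factorial * (τ * N ^ m) := by
        rw [← e1, abs_mul, Nat.abs_cast]
        exact mul_le_mul_of_nonneg_left e2 (Nat.cast_nonneg _)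
      rw [mul_assoc]
      exact e3
    · refine mul_le_mul_of_nonneg_right ?_ (by positivity)
      rw [hK, hρ, add_mul, mul_add, mul_add, mul_one_div, mul_one_div]
      have e1 : 0 ≤ (m.factorial : ℝ) / √N := by positivity
      have e2 : 0 ≤ 2 * r * m * (Fintype.card (Fin m ↪ Fin r) : ℝ) * τ := by positivity
      linarith
  obtain ⟨g, hg1, hg2, hg3, hg4⟩ := key β f _ (abs_deviation_le G _ hp0 hp1) hbdd
  refine ⟨g, hg1, ?_, hg3, fun U a hU ha => ?_⟩
  · have hNm : 0 < N ^ m := by positivity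
    have : |∑ v, g v| ≤ C * K * ρ * N := by
      refine le_of_mul_le_mul_right (hg2.trans_eq ?_) hNm
      ring
    refine this.trans ?_
    have h0 : 0 ≤ C * K * ρ * N := by positivity
    calc C * K * ρ * N ≤ 2 ^ m * (C * K * ρ * N) := le_mul_of_one_le_left h0 h2m
      _ = _ := by ring
  · have h1 := abs_sum_perm_le hg4 hU
    have h2 : ∀ σ : Equiv.Perm (Fin m), ∑ x, (f x - ∑ j, g (x j)) *
        ∏ j, (if x j ∈ U (σ j) then (1 : ℝ) else 0) = (labCount F G (fun i => U (σ i)) : ℝ) -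
          (p ^ numEdges F + ∑ i, a i) * ∏ i, (#(U i) : ℝ) := by
      intro σ
      simp_rw [sub_mul]
      rw [Finset.sum_sub_distrib, hf, ← labCount_sub_eq_sum_deviation F G p
        (U := fun i => U (σ i)) (fun i j hij => hU (σ.injective.ne hij)),
        Equiv.prod_comp σ (fun i => (#(U i) : ℝ))]
      have h3 : ∀ j, ∑ x : Fin m → β, g (x j) * ∏ i, (if x i ∈ U (σ i) then (1 : ℝ) else 0) =
          a (σ j) * ∏ i, (#(U i) : ℝ) := by
        intro j
        rw [sum_apply_mul_prod_eq g (fun i v => if v ∈ U (σ i) then 1 else 0) j,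
          ← Equiv.prod_comp σ (fun i => (#(U i) : ℝ)),
          ← Finset.mul_prod_erase univ (fun i => (#(U (σ i)) : ℝ)) (Finset.mem_univ j),
          ← mul_assoc, ← ha]
        congr 1
        · simp
        · simp
      have h4 : ∑ x : Fin m → β, (∑ j, g (x j)) *
          ∏ i, (if x i ∈ U (σ i) then (1 : ℝ) else 0) = (∑ i, a i) * ∏ i, (#(U i) : ℝ) := by
        simp_rw [Finset.sum_mul]
        rw [Finset.sum_comm, Finset.sum_congr rfl fun j _ => h3 j,
          Equiv.sum_comp σ fun i => a i * ∏ i, (#(U i) : ℝ)]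
      rw [h4]
      ring
    rw [Finset.sum_congr rfl fun σ _ => h2 σ, Finset.sum_sub_distrib, Finset.sum_const,
      Finset.card_univ, Fintype.card_perm, Fintype.card_fin, nsmul_eq_mul, ← mul_assoc] at h1
    refine h1.trans_eq ?_
    ring

lemma abs_adjInd_sub_le_one {β : Type*} (G : SimpleGraph β) {p : ℝ} (hp0 : 0 ≤ p) (hp1 : p ≤ 1)
    (a b : β) : |adjInd G a b - p| ≤ 1 := by
  rw [abs_le]
  constructor <;> linarith [adjInd_nonneg G a b, adjInd_le_one G a b]

lemma abs_sum_adjInd_sub_le_card_mul_card {β : Type*} (G : SimpleGraph β) {p : ℝ} (hp0 : 0 ≤ p)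
    (hp1 : p ≤ 1) (A B : Finset β) :
    |∑ a ∈ A, ∑ b ∈ B, (adjInd G a b - p)| ≤ #A * #B := by
  refine (Finset.abs_sum_le_sum_abs _ _).trans ?_
  have h : ∀ a ∈ A, |∑ b ∈ B, (adjInd G a b - p)| ≤ #B := fun a _ =>
    (Finset.abs_sum_le_sum_abs _ _).trans
      ((Finset.sum_le_sum fun b _ => abs_adjInd_sub_le_one G hp0 hp1 a b).trans_eq (by simp))
  exact (Finset.sum_le_sum h).trans_eq (by simp)

open Classical in
lemma edgeDensity_mem_Icc {β : Type*} (G : SimpleGraph β) (s t : Finset β) :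
    (0 : ℝ) ≤ (G.edgeDensity s t : ℝ) ∧ (G.edgeDensity s t : ℝ) ≤ 1 :=
  ⟨by exact_mod_cast G.edgeDensity_nonneg s t, by exact_mod_cast G.edgeDensity_le_one s t⟩

open Classical in
lemma sum_adjInd_eq {β : Type*} (G : SimpleGraph β) (A B : Finset β) :
    ∑ a ∈ A, ∑ b ∈ B, adjInd G a b = (G.edgeDensity A B : ℝ) * (#A * #B) := by
  have h1 : ∑ a ∈ A, ∑ b ∈ B, adjInd G a b = #(G.interedges A B) := by
    rw [SimpleGraph.interedges, Rel.interedges, Finset.card_filter, Finset.sum_product]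
    push_cast
    exact Finset.sum_congr rfl fun a _ => Finset.sum_congr rfl fun b _ => rfl
  rw [h1, SimpleGraph.edgeDensity_def]
  push_cast
  rcases eq_or_ne ((#A : ℝ) * #B) 0 with h0 | h0
  · rw [h0, mul_zero]
    have h2 := G.card_interedges_le_mul A B
    have h3 : ((#(G.interedges A B) : ℕ) : ℝ) ≤ #A * #B := by exact_mod_cast h2
    exact le_antisymm (h3.trans h0.le) (Nat.cast_nonneg _)
  · rw [div_mul_cancel₀ _ h0]

open Classical in
/-- Uniform pairs have small discrepancy. -/
lemma SimpleGraph.IsUniform.abs_sum_adjInd_sub_le {β : Type*} {G : SimpleGraph β} {ε : ℝ}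
    {s t : Finset β} (h : G.IsUniform ε s t) {A B : Finset β} (hA : A ⊆ s) (hB : B ⊆ t) :
    |∑ a ∈ A, ∑ b ∈ B, (adjInd G a b - G.edgeDensity s t)| ≤ ε * #s * #t := by
  obtain ⟨h0, h1⟩ := edgeDensity_mem_Icc G s t
  have hε := h.pos
  have hA' : (#A : ℝ) ≤ #s := by exact_mod_cast Finset.card_le_card hA
  have hB' : (#B : ℝ) ≤ #t := by exact_mod_cast Finset.card_le_card hB
  by_cases hA2 : (#s : ℝ) * ε ≤ #A
  · by_cases hB2 : (#t : ℝ) * ε ≤ #B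
    · have h2 := (h hA hB hA2 hB2).le
      simp_rw [Finset.sum_sub_distrib, sum_adjInd_eq, Finset.sum_const, nsmul_eq_mul]
      rw [← mul_assoc (#A : ℝ), mul_comm ((#A : ℝ) * #B), ← sub_mul, abs_mul,
        abs_of_nonneg (by positivity : (0 : ℝ) ≤ #A * #B), mul_assoc]
      exact mul_le_mul h2 (by gcongr) (by positivity) hε.le
    · push Not at hB2
      refine (abs_sum_adjInd_sub_le_card_mul_card G h0 h1 A B).trans ?_
      calc (#A : ℝ) * #B ≤ #s * (#t * ε) := by gcongr
        _ = _ := by ring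
  · push Not at hA2
    refine (abs_sum_adjInd_sub_le_card_mul_card G h0 h1 A B).trans ?_
    calc (#A : ℝ) * #B ≤ #s * ε * #t := by gcongr
      _ = _ := by ring

open Classical in
/-- A family of vertex classes of almost equal sizes covering the graph such that few pairs fail
to be `ε`-uniform. -/
structure IsRegularFamily {β : Type*} [Fintype β] (G : SimpleGraph β) (ε η : ℝ) {k : ℕ}
    (Ω : Fin k → Finset β) : Prop where
  disjoint : Pairwise fun i j => Disjoint (Ω i) (Ω j)
  cover : ∀ v, ∃ i, v ∈ Ω i
  nonempty : ∀ i, (Ω i).Nonempty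
  abs_card_sub_le : ∀ i, |(#(Ω i) : ℝ) - Fintype.card β / k| ≤ 1
  card_not_uniform : (Nat.card {q : Fin k × Fin k //
    ¬ (q.1 ≠ q.2 ∧ G.IsUniform ε (Ω q.1) (Ω q.2))} : ℝ) ≤ η * (k : ℝ) ^ 2

lemma exists_isRegularFamily {ε η : ℝ} (hε : 0 < ε) (hη : 0 < η) :
    ∃ L K : ℕ, 0 < L ∧ ∀ (β : Type) [Fintype β] (G : SimpleGraph β), L ≤ Fintype.card β →
      ∃ k : ℕ, 0 < k ∧ k ≤ K ∧ ∃ Ω : Fin k → Finset β, IsRegularFamily G ε η Ω := by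
  classical
  obtain ⟨L, hL⟩ := exists_nat_gt (2 / η)
  have hL0 : (0 : ℝ) < L := (by positivity : 0 < 2 / η).trans hL
  set ε' := min ε (η / 2) with hε'
  have hε0 : 0 < ε' := lt_min hε (by positivity)
  refine ⟨L, SzemerediRegularity.bound ε' L, by exact_mod_cast hL0, fun β _ G hβ => ?_⟩
  obtain ⟨P, hP, hPl, hPu, hPuni⟩ := szemeredi_regularity G hε0 hβ
  obtain ⟨k, hk⟩ : ∃ k, k = #P.parts := ⟨_, rfl⟩
  rw [← hk] at hPl hPu
  have hk0 : 0 < k := (by exact_mod_cast hL0 : 0 < L).trans_le hPl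
  obtain ⟨e⟩ : Nonempty (Fin k ≃ P.parts) := ⟨(P.parts.equivFinOfCardEq hk.symm).symm⟩
  refine ⟨k, hk0, hPu, fun i => (e i : Finset β), ?_, ?_, ?_, ?_, ?_⟩
  · intro i j hij
    exact P.disjoint (e i).2 (e j).2 fun h => hij (e.injective (Subtype.ext h))
  · intro v
    obtain ⟨s, hs, hv⟩ := P.exists_mem (Finset.mem_univ v)
    exact ⟨e.symm ⟨s, hs⟩, by simpa using hv⟩
  · exact fun i => P.nonempty_of_mem_parts (e i).2
  · intro i
    have h1 := hP.average_le_card_part (e i).2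
    have h2 := hP.card_part_le_average_add_one (e i).2
    rw [Finset.card_univ, ← hk] at h1 h2
    have h3 : ((Fintype.card β / k : ℕ) : ℝ) ≤ Fintype.card β / k := Nat.cast_div_le
    have h4 : (Fintype.card β : ℝ) / k < (Fintype.card β / k : ℕ) + 1 := by
      rw [div_lt_iff₀ (by exact_mod_cast hk0)]
      exact_mod_cast Nat.lt_mul_of_div_lt (Nat.lt_succ_self _) hk0
    have h1' : ((Fintype.card β / k : ℕ) : ℝ) ≤ #(e i : Finset β) := by exact_mod_cast h1
    have h2' : (#(e i : Finset β) : ℝ) ≤ (Fintype.card β / k : ℕ) + 1 := by exact_mod_cast h2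
    rw [abs_le]
    constructor <;> linarith
  · have hcard : Nat.card {q : Fin k × Fin k // ¬ (q.1 ≠ q.2 ∧
        G.IsUniform ε (e q.1 : Finset β) (e q.2))} ≤ k + #(P.nonUniforms G ε') := by
      rw [Nat.card_eq_fintype_card, Fintype.card_subtype]
      have hinj : Function.Injective fun q : Fin k × Fin k =>
          ((e q.1 : Finset β), (e q.2 : Finset β)) := fun a b hab =>
        Prod.ext (e.injective (Subtype.ext (congrArg Prod.fst hab)))
          (e.injective (Subtype.ext (congrArg Prod.snd hab)))
      have hsub : (univ.filter fun q : Fin k × Fin k => ¬ (q.1 ≠ q.2 ∧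
          G.IsUniform ε (e q.1 : Finset β) (e q.2))) ⊆
          (univ.image fun i : Fin k => (i, i)) ∪
            ((P.nonUniforms G ε').preimage (fun q : Fin k × Fin k =>
              ((e q.1 : Finset β), (e q.2 : Finset β))) hinj.injOn) := by
        rintro ⟨i, j⟩ hq
        rw [Finset.mem_filter] at hq
        rw [Finset.mem_union]
        by_cases hij : i = j
        · left
          subst hij
          exact Finset.mem_image_of_mem _ (Finset.mem_univ _)
        · right
          rw [Finset.mem_preimage, Finpartition.mk_mem_nonUniforms]
          exact ⟨(e i).2, (e j).2, fun h => hij (e.injective (Subtype.ext h)),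
            fun h => hq.2 ⟨hij, h.mono (min_le_left _ _)⟩⟩
      refine (Finset.card_le_card hsub).trans ((Finset.card_union_le _ _).trans ?_)
      refine add_le_add (Finset.card_image_le.trans_eq (by simp)) ?_
      rw [Finset.card_preimage]
      exact Finset.card_filter_le _ _
    have h1 : (#(P.nonUniforms G ε') : ℝ) ≤ η / 2 * (k : ℝ) ^ 2 := by
      refine (show (#(P.nonUniforms G ε') : ℝ) ≤ ((k * (k - 1) : ℕ) : ℝ) * ε'
        from hk ▸ hPuni).trans ?_
      have h2 : ((k * (k - 1) : ℕ) : ℝ) ≤ (k : ℝ) ^ 2 := by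
        rw [sq]
        exact_mod_cast Nat.mul_le_mul_left k (Nat.sub_le k 1)
      calc ((k * (k - 1) : ℕ) : ℝ) * ε' ≤ (k : ℝ) ^ 2 * (η / 2) :=
            mul_le_mul h2 (min_le_right _ _) hε0.le (by positivity)
        _ = _ := mul_comm _ _
    have h2 : (k : ℝ) ≤ η / 2 * (k : ℝ) ^ 2 := by
      have h3 : 2 / η ≤ k := hL.le.trans (by exact_mod_cast hPl)
      rw [div_le_iff₀ hη] at h3
      nlinarith [(Nat.cast_nonneg k : (0 : ℝ) ≤ k)]
    calc (Nat.card {q : Fin k × Fin k // ¬ (q.1 ≠ q.2 ∧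
        G.IsUniform ε (e q.1 : Finset β) (e q.2))} : ℝ) ≤ k + #(P.nonUniforms G ε') := by
          exact_mod_cast hcard
      _ ≤ _ := by linarith

open Classical in
/-- Counting lemma for a tuple of disjoint vertex classes that are pairwise uniform. -/
lemma abs_labCount_sub_prod_edgeDensity_le {m : ℕ} {β : Type} [Fintype β] (F : SimpleGraph (Fin m))
    (G : SimpleGraph β) {ε : ℝ} {U : Fin m → Finset β}
    (hU : Pairwise fun i j => Disjoint (U i) (U j)) (hne : ∀ i, (U i).Nonempty)
    (huni : ∀ i j, i ≠ j → G.IsUniform ε (U i) (U j)) :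
    |(labCount F G U : ℝ) - (∏ e ∈ orderedEdges F, (G.edgeDensity (U e.1) (U e.2) : ℝ)) *
      ∏ l, (#(U l) : ℝ)| ≤ numEdges F * ε * ∏ l, (#(U l) : ℝ) := by
  have h1 : (labCount F G U : ℝ) = ∑ x ∈ Fintype.piFinset U,
      (∏ l, if x l ∈ U l then (1 : ℝ) else 0) * edgeProd (adjInd G) (orderedEdges F) x := by
    rw [labCount_eq_sum, ← Finset.sum_subset (Finset.subset_univ (Fintype.piFinset U))]
    · refine Finset.sum_congr rfl fun x hx => ?_
      rw [Fintype.mem_piFinset] at hx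
      have hinj : Function.Injective x := by
        intro i j hij
        by_contra hne
        exact Finset.disjoint_left.1 (hU hne) (hx i) (hij ▸ hx j)
      rw [if_pos hinj, mul_comm]
    · intro x _ hx
      rw [Fintype.mem_piFinset] at hx
      push Not at hx
      obtain ⟨l, hl⟩ := hx
      rw [Finset.prod_eq_zero (Finset.mem_univ l) (if_neg hl), mul_zero]
  rw [h1, ← card_orderedEdges]
  exact abs_count_sub_le G U U hne (fun _ => subset_rfl)
    (fun i j => (G.edgeDensity (U i) (U j) : ℝ)) (fun i j => (edgeDensity_mem_Icc G _ _).1)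
    (fun i j => (edgeDensity_mem_Icc G _ _).2) ε _ (fun e he => orderedEdges_lt he)
    fun e he A hA B hB => (huni _ _ (orderedEdges_lt he).ne).abs_sum_adjInd_sub_le hA hB

namespace IsRegularFamily

variable {β : Type} [Fintype β] {G : SimpleGraph β} {ε η : ℝ} {k : ℕ} {Ω : Fin k → Finset β}

open Classical in
lemma sum_eq (h : IsRegularFamily G ε η Ω) (X : Finset β) (f : β → ℝ) :
    ∑ a ∈ X, f a = ∑ i, ∑ a ∈ X ∩ Ω i, f a := by
  rw [← Finset.sum_biUnion]
  · congr 1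
    ext v
    simp [h.cover v]
  · exact fun i _ j _ hij => (h.disjoint hij).mono Finset.inter_subset_right
      Finset.inter_subset_right

lemma sum_card (h : IsRegularFamily G ε η Ω) : ∑ i, (#(Ω i) : ℝ) = Fintype.card β := by
  classical
  have := h.sum_eq univ fun _ => (1 : ℝ)
  simpa using this.symm

lemma one_le_card (h : IsRegularFamily G ε η Ω) (i : Fin k) : (1 : ℝ) ≤ #(Ω i) := by
  exact_mod_cast (h.nonempty i).card_pos

lemma le_card (h : IsRegularFamily G ε η Ω) : (k : ℝ) ≤ Fintype.card β := by
  rw [← h.sum_card]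
  calc (k : ℝ) = ∑ _i : Fin k, (1 : ℝ) := by simp
    _ ≤ _ := Finset.sum_le_sum fun i _ => h.one_le_card i

lemma card_le_mul_card (h : IsRegularFamily G ε η Ω) (i : Fin k) :
    (Fintype.card β : ℝ) ≤ 2 * k * #(Ω i) := by
  have hk : (0 : ℝ) < k := by exact_mod_cast i.pos
  have h1 := (abs_le.1 (h.abs_card_sub_le i)).1
  have h2 := h.one_le_card i
  have h3 : (Fintype.card β : ℝ) / k ≤ 2 * #(Ω i) := by linarith
  rw [div_le_iff₀ hk] at h3
  linarith

lemma card_le (h : IsRegularFamily G ε η Ω) (i : Fin k) :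
    (#(Ω i) : ℝ) ≤ 2 * Fintype.card β / k := by
  have hk : (0 : ℝ) < k := by exact_mod_cast i.pos
  have h1 := (abs_le.1 (h.abs_card_sub_le i)).2
  have h2 : 1 ≤ (Fintype.card β : ℝ) / k := (one_le_div hk).2 h.le_card
  rw [mul_div_assoc]
  linarith

lemma abs_sum_average_le (h : IsRegularFamily G ε η Ω) (hk : 0 < k) {g : β → ℝ}
    (hg : ∀ v, |g v| ≤ 1) {ρ : ℝ} (hsum : |∑ v, g v| ≤ ρ * Fintype.card β) :
    |∑ i, (∑ v ∈ Ω i, g v) / #(Ω i)| ≤ (ρ + k / Fintype.card β) * k := by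
  classical
  have hk' : (0 : ℝ) < k := by exact_mod_cast hk
  set N : ℝ := (Fintype.card β : ℝ) with hN
  have hN0 : 0 < N := hk'.trans_le h.le_card
  have h1 : ∀ i, |(∑ v ∈ Ω i, g v) / #(Ω i) - k / N * ∑ v ∈ Ω i, g v| ≤ k / N := by
    intro i
    have hs : (0 : ℝ) < #(Ω i) := one_pos.trans_le (h.one_le_card i)
    have e1 : |∑ v ∈ Ω i, g v| ≤ #(Ω i) :=
      (Finset.abs_sum_le_sum_abs _ _).trans ((Finset.sum_le_sum fun v _ => hg v).trans_eq (by simp))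
    have e2 : (∑ v ∈ Ω i, g v) / #(Ω i) - k / N * ∑ v ∈ Ω i, g v =
        -((∑ v ∈ Ω i, g v) / #(Ω i) * (k / N) * (#(Ω i) - N / k)) := by
      field_simp
      ring
    rw [e2, abs_neg, abs_mul, abs_mul, abs_div, abs_of_pos hs, abs_of_pos (div_pos hk' hN0)]
    have e3 : |∑ v ∈ Ω i, g v| / #(Ω i) ≤ 1 := (div_le_one hs).2 e1
    calc _ ≤ 1 * (k / N) * 1 := by
          gcongr
          exact h.abs_card_sub_le i
      _ = _ := by ring
  have h2 : ∑ v, g v = ∑ i, ∑ v ∈ Ω i, g v := by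
    have := h.sum_eq univ g
    simpa using this
  have h3 : |∑ i, (∑ v ∈ Ω i, g v) / #(Ω i) - k / N * ∑ v, g v| ≤ k * (k / N) := by
    rw [h2, Finset.mul_sum, ← Finset.sum_sub_distrib]
    exact (Finset.abs_sum_le_sum_abs _ _).trans
      ((Finset.sum_le_sum fun i _ => h1 i).trans_eq (by simp))
  have h4 : |k / N * ∑ v, g v| ≤ ρ * k := by
    rw [abs_mul, abs_of_pos (div_pos hk' hN0)]
    calc k / N * |∑ v, g v| ≤ k / N * (ρ * N) := by gcongr
      _ = _ := by field_simp
  have h5 := abs_add_le (∑ i, (∑ v ∈ Ω i, g v) / #(Ω i) - k / N * ∑ v, g v) (k / N * ∑ v, g v)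
  rw [sub_add_cancel] at h5
  linarith

open Classical in
lemma approxBalanced (h : IsRegularFamily G ε η Ω) (hk : 0 < k) {m K : ℕ} (hkK : k ≤ K)
    (F : SimpleGraph (Fin m)) {c : ℝ} {g : β → ℝ} (hg : ∀ v, |g v| ≤ 1) {ρ : ℝ} (hρ : 0 ≤ ρ)
    (hsum : |∑ v, g v| ≤ ρ * Fintype.card β)
    (hcount : ∀ (U : Fin m → Finset β) (a : Fin m → ℝ),
      Pairwise (fun i j => Disjoint (U i) (U j)) → (∀ i, ∑ v ∈ U i, g v = a i * #(U i)) →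
      |∑ σ : Equiv.Perm (Fin m), (labCount F G (fun i => U (σ i)) : ℝ) -
        m.factorial * (c + ∑ i, a i) * ∏ i, (#(U i) : ℝ)| ≤ ρ * (Fintype.card β : ℝ) ^ m)
    {η' : ℝ} (hη : η ≤ η') (hη1 : ρ + K / Fintype.card β ≤ η')
    (hη2 : m.factorial * (numEdges F * ε) + ρ * (2 * K) ^ m ≤ η') :
    ApproxBalanced (orderedEdges F) c η' (fun i j => (G.edgeDensity (Ω i) (Ω j) : ℝ))
      (fun i => (∑ v ∈ Ω i, g v) / #(Ω i))
      (fun i j => i ≠ j ∧ G.IsUniform ε (Ω i) (Ω j)) := by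
  have hs : ∀ i, (0 : ℝ) < #(Ω i) := fun i => one_pos.trans_le (h.one_le_card i)
  have hkK' : (k : ℝ) ≤ K := by exact_mod_cast hkK
  refine ⟨fun a b => by rw [G.edgeDensity_comm], fun a b => (edgeDensity_mem_Icc G _ _).1,
    fun a b => (edgeDensity_mem_Icc G _ _).2, fun i => ?_, fun a b hab => ⟨hab.1.symm, hab.2.symm⟩,
    h.card_not_uniform.trans (by gcongr), ?_, fun x hx => ?_⟩
  · rw [abs_div, abs_of_pos (hs i), div_le_one (hs i)]
    exact (Finset.abs_sum_le_sum_abs _ _).trans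
      ((Finset.sum_le_sum fun v _ => hg v).trans_eq (by simp))
  · refine (h.abs_sum_average_le hk hg hsum).trans ?_
    refine mul_le_mul_of_nonneg_right (le_trans ?_ hη1) (Nat.cast_nonneg k)
    gcongr
  · set P : ℝ := ∏ l, (#(Ω (x l)) : ℝ) with hP
    have hP0 : 0 < P := Finset.prod_pos fun l _ => hs _
    have hdis : Pairwise fun i j => Disjoint (Ω (x i)) (Ω (x j)) := fun i j hij =>
      h.disjoint (hx i j hij).1
    have h1 := hcount (fun i => Ω (x i)) (fun i => (∑ v ∈ Ω (x i), g v) / #(Ω (x i))) hdis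
      fun i => (div_mul_cancel₀ _ (hs _).ne').symm
    have h2 : ∀ σ : Equiv.Perm (Fin m), |(labCount F G (fun i => Ω (x (σ i))) : ℝ) -
        edgeProd (fun i j => (G.edgeDensity (Ω i) (Ω j) : ℝ)) (orderedEdges F) (x ∘ σ) * P| ≤
          numEdges F * ε * P := by
      intro σ
      have h3 := abs_labCount_sub_prod_edgeDensity_le F G (ε := ε) (U := fun i => Ω (x (σ i)))
        (fun i j hij => hdis (σ.injective.ne hij)) (fun i => h.nonempty _)
        (fun i j hij => (hx _ _ (σ.injective.ne hij)).2)
      rw [Equiv.prod_comp σ fun i => (#(Ω (x i)) : ℝ)] at h3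
      exact h3
    have h4 : |∑ σ : Equiv.Perm (Fin m), (labCount F G (fun i => Ω (x (σ i))) : ℝ) -
        (∑ σ : Equiv.Perm (Fin m), edgeProd (fun i j => (G.edgeDensity (Ω i) (Ω j) : ℝ))
          (orderedEdges F) (x ∘ σ)) * P| ≤ m.factorial * (numEdges F * ε * P) := by
      rw [Finset.sum_mul, ← Finset.sum_sub_distrib]
      refine (Finset.abs_sum_le_sum_abs _ _).trans
        ((Finset.sum_le_sum fun σ _ => h2 σ).trans_eq ?_)
      rw [Finset.sum_const, Finset.card_univ, Fintype.card_perm, Fintype.card_fin, nsmul_eq_mul]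
    have h5 : (Fintype.card β : ℝ) ^ m ≤ (2 * K) ^ m * P := by
      calc (Fintype.card β : ℝ) ^ m = ∏ _l : Fin m, (Fintype.card β : ℝ) := by simp
        _ ≤ ∏ l : Fin m, (2 * K * #(Ω (x l)) : ℝ) :=
            Finset.prod_le_prod (fun _ _ => Nat.cast_nonneg _) fun l _ =>
              (h.card_le_mul_card (x l)).trans (by gcongr)
        _ = _ := by rw [Finset.prod_mul_distrib]; simp [hP]
    refine le_of_mul_le_mul_right ?_ hP0
    rw [← abs_of_pos hP0, ← abs_mul, abs_of_pos hP0, sub_mul]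
    have h6 := abs_sub_le
      ((∑ σ : Equiv.Perm (Fin m), edgeProd (fun i j => (G.edgeDensity (Ω i) (Ω j) : ℝ))
          (orderedEdges F) (x ∘ σ)) * P)
      (∑ σ : Equiv.Perm (Fin m), (labCount F G (fun i => Ω (x (σ i))) : ℝ))
      (m.factorial * (c + ∑ j, (∑ v ∈ Ω (x j), g v) / #(Ω (x j))) * P)
    rw [abs_sub_comm] at h4
    calc _ ≤ m.factorial * (numEdges F * ε * P) + ρ * ((2 * K) ^ m * P) :=
          h6.trans (add_le_add h4 (h1.trans (mul_le_mul_of_nonneg_left h5 hρ)))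
      _ = (m.factorial * (numEdges F * ε) + ρ * (2 * K) ^ m) * P := by ring
      _ ≤ _ := mul_le_mul_of_nonneg_right hη2 hP0.le

open Classical in
/-- If most class densities are close to `p` then the graph has small discrepancy. -/
lemma abs_sum_adjInd_sub_le (h : IsRegularFamily G ε η Ω) (hk : 0 < k) (hε : 0 ≤ ε) {p δ : ℝ}
    (hδ : 0 ≤ δ) (hp0 : 0 ≤ p) (hp1 : p ≤ 1)
    (hw : (#(univ.filter fun q : Fin k × Fin k =>
      δ < |(G.edgeDensity (Ω q.1) (Ω q.2) : ℝ) - p|) : ℝ) ≤ δ * (k : ℝ) ^ 2) (X Y : Finset β) :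
    |∑ a ∈ X, ∑ b ∈ Y, (adjInd G a b - p)| ≤
      (ε + δ + 4 * (η + δ)) * (Fintype.card β : ℝ) ^ 2 := by
  have hk' : (0 : ℝ) < k := by exact_mod_cast hk
  set N : ℝ := (Fintype.card β : ℝ) with hN
  set B1 := univ.filter fun q : Fin k × Fin k =>
    ¬ (q.1 ≠ q.2 ∧ G.IsUniform ε (Ω q.1) (Ω q.2)) with hB1
  set B2 := univ.filter fun q : Fin k × Fin k =>
    δ < |(G.edgeDensity (Ω q.1) (Ω q.2) : ℝ) - p| with hB2
  have hB1c : (#B1 : ℝ) ≤ η * (k : ℝ) ^ 2 := by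
    have := h.card_not_uniform
    rwa [Nat.card_eq_fintype_card, Fintype.card_subtype] at this
  have h1 : ∑ a ∈ X, ∑ b ∈ Y, (adjInd G a b - p) =
      ∑ q : Fin k × Fin k, ∑ a ∈ X ∩ Ω q.1, ∑ b ∈ Y ∩ Ω q.2, (adjInd G a b - p) := by
    rw [h.sum_eq X, Fintype.sum_prod_type]
    refine Finset.sum_congr rfl fun i _ => ?_
    rw [Finset.sum_congr rfl fun a _ => h.sum_eq Y fun b => adjInd G a b - p, Finset.sum_comm]
  have h2 : ∀ q : Fin k × Fin k,
      |∑ a ∈ X ∩ Ω q.1, ∑ b ∈ Y ∩ Ω q.2, (adjInd G a b - p)| ≤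
        (ε + δ) * (#(Ω q.1) * #(Ω q.2)) +
          ((if q ∈ B1 then (2 * N / k) ^ 2 else 0) + if q ∈ B2 then (2 * N / k) ^ 2 else 0) := by
    intro q
    have hX : (#(X ∩ Ω q.1) : ℝ) ≤ #(Ω q.1) := by
      exact_mod_cast Finset.card_le_card Finset.inter_subset_right
    have hY : (#(Y ∩ Ω q.2) : ℝ) ≤ #(Ω q.2) := by
      exact_mod_cast Finset.card_le_card Finset.inter_subset_right
    have e1 : |∑ a ∈ X ∩ Ω q.1, ∑ b ∈ Y ∩ Ω q.2, (adjInd G a b - p)| ≤ (2 * N / k) ^ 2 :=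
      (abs_sum_adjInd_sub_le_card_mul_card G hp0 hp1 _ _).trans (by
        rw [sq]
        exact mul_le_mul (hX.trans (h.card_le _)) (hY.trans (h.card_le _)) (Nat.cast_nonneg _)
          (by positivity))
    have e2 : 0 ≤ (ε + δ) * ((#(Ω q.1) : ℝ) * #(Ω q.2)) := by positivity
    have e3 : 0 ≤ (2 * N / k) ^ 2 := sq_nonneg _
    by_cases hq1 : q ∈ B1
    · rw [if_pos hq1]
      split_ifs <;> linarith
    by_cases hq2 : q ∈ B2
    · rw [if_neg hq1, if_pos hq2]
      linarith
    rw [if_neg hq1, if_neg hq2, add_zero, add_zero]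
    simp only [hB1, hB2, Finset.mem_filter, Finset.mem_univ, true_and, not_not, not_lt] at hq1 hq2
    have e4 := hq1.2.abs_sum_adjInd_sub_le (A := X ∩ Ω q.1) (B := Y ∩ Ω q.2)
      Finset.inter_subset_right Finset.inter_subset_right
    set d : ℝ := (G.edgeDensity (Ω q.1) (Ω q.2) : ℝ) with hd
    have e5 : ∑ a ∈ X ∩ Ω q.1, ∑ b ∈ Y ∩ Ω q.2, (adjInd G a b - p) =
        ∑ a ∈ X ∩ Ω q.1, ∑ b ∈ Y ∩ Ω q.2, (adjInd G a b - d) +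
          (d - p) * (#(X ∩ Ω q.1) * #(Y ∩ Ω q.2)) := by
      simp_rw [Finset.sum_sub_distrib, Finset.sum_const, nsmul_eq_mul]
      ring
    have e6 : |(d - p) * ((#(X ∩ Ω q.1) : ℝ) * #(Y ∩ Ω q.2))| ≤ δ * (#(Ω q.1) * #(Ω q.2)) := by
      rw [abs_mul, abs_of_nonneg (by positivity : (0 : ℝ) ≤ #(X ∩ Ω q.1) * #(Y ∩ Ω q.2))]
      exact mul_le_mul hq2 (by gcongr) (by positivity) hδ
    rw [e5]
    refine (abs_add_le _ _).trans ((add_le_add e4 e6).trans_eq ?_)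
    ring
  have h3 : ∑ q : Fin k × Fin k, (#(Ω q.1) * #(Ω q.2) : ℝ) = N ^ 2 := by
    rw [Fintype.sum_prod_type, sq, hN, ← h.sum_card, Finset.sum_mul_sum]
  have h4 : ∀ B : Finset (Fin k × Fin k), ∑ q, (if q ∈ B then (2 * N / k) ^ 2 else 0) =
      #B * (2 * N / k) ^ 2 := fun B => by simp
  rw [h1]
  refine (Finset.abs_sum_le_sum_abs _ _).trans ((Finset.sum_le_sum fun q _ => h2 q).trans ?_)
  rw [Finset.sum_add_distrib, Finset.sum_add_distrib, ← Finset.mul_sum, h3, h4, h4]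
  calc (ε + δ) * N ^ 2 + (#B1 * (2 * N / k) ^ 2 + #B2 * (2 * N / k) ^ 2)
      ≤ (ε + δ) * N ^ 2 + (η * (k : ℝ) ^ 2 * (2 * N / k) ^ 2 +
          δ * (k : ℝ) ^ 2 * (2 * N / k) ^ 2) := by gcongr
    _ = _ := by field_simp; ring

end IsRegularFamily

theorem SatisfiesPr.cutSmall {m r : ℕ} {F : SimpleGraph (Fin m)} (hF : 0 < numEdges F)
    {p : ℝ} (hp0 : 0 < p) (hp1 : p ≤ 1) (hrm : m ≤ r)
    {α : Fin r → ℝ} (hα : ∀ i, 0 < α i) (hsum : ∑ i, α i ≤ 1)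
    (hcase : (α ≠ fun _ => 1 / (r : ℝ)) ∨ 1 < numEdges F)
    {V : ℕ → ℕ} {G : ∀ n, SimpleGraph (Fin (V n))} (hV : Tendsto V atTop atTop)
    (h : SatisfiesPr F p α V G) : CutSmall p V G := by
  classical
  obtain ⟨τ, hτ, hτ'⟩ := h
  have hne : (orderedEdges F).Nonempty := by
    rw [← Finset.card_pos, card_orderedEdges]
    exact hF
  have hm : 2 ≤ m := by
    obtain ⟨e, he⟩ := hne
    have := orderedEdges_lt he
    omega
  obtain ⟨C, hC, key⟩ := exists_weight_symmetrised_count F hm hrm hp0.le hp1 hα hsum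
  intro δ hδ
  obtain ⟨η', hη', hcluster⟩ := ApproxBalanced.card_weight_le
    (E := orderedEdges F) (fun e he => orderedEdges_lt he) hne hp0 (δ := δ / 10) (by positivity)
  set M : ℝ := m.factorial * numEdges F with hM
  have hM0 : 0 < M := by positivity
  set ε : ℝ := min (δ / 10) (η' / (2 * M)) with hε
  have hε0 : 0 < ε := by positivity
  set η : ℝ := min (δ / 20) η' with hη
  have hη0 : 0 < η := by positivity
  obtain ⟨L, K, -, hreg⟩ := exists_isRegularFamily hε0 hη0
  set ρ : ℕ → ℝ := fun n => C * (|τ n| + 1 / √(V n : ℝ)) with hρ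
  have hVR : Tendsto (fun n => (V n : ℝ)) atTop atTop := tendsto_natCast_atTop_atTop.comp hV
  have hρ0 : ∀ n, 0 ≤ ρ n := fun n => by positivity
  have hρlim : Tendsto ρ atTop (nhds 0) := by
    have h1 : Tendsto (fun n => 1 / √(V n : ℝ)) atTop (nhds 0) :=
      (tendsto_const_nhds.div_atTop (Real.tendsto_sqrt_atTop.comp hVR))
    have h2 := (hτ.abs.add h1).const_mul C
    rwa [abs_zero, add_zero, mul_zero] at h2
  have hlim1 : Tendsto (fun n => ρ n + K / (V n : ℝ)) atTop (nhds 0) := by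
    simpa using hρlim.add (tendsto_const_nhds.div_atTop hVR)
  have hlim2 : Tendsto (fun n => ρ n * (2 * K : ℝ) ^ m) atTop (nhds 0) := by
    simpa using hρlim.mul_const ((2 * K : ℝ) ^ m)
  filter_upwards [hlim1.eventually_le_const hη', hlim2.eventually_le_const (half_pos hη'),
    hV.eventually_ge_atTop (max L 1)] with n hn1 hn2 hn3 X Y
  have hVn : 0 < V n := (le_max_right _ _).trans hn3
  have : Nonempty (Fin (V n)) := ⟨⟨0, hVn⟩⟩
  obtain ⟨g, hg1, hg2, hg3, hg4⟩ := key (Fin (V n)) (G n) |τ n| (abs_nonneg _) (by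
    intro U hU hcard
    rw [Fintype.card_fin] at hcard ⊢
    exact (hτ' n U hU hcard).trans (by gcongr; exact le_abs_self _))
  rw [Fintype.card_fin] at hg2
  rw [Fintype.card_fin] at hg4
  obtain ⟨k, hk, hkK, Ω, hΩ⟩ := hreg (Fin (V n)) (G n) (by
    rw [Fintype.card_fin]
    exact (le_max_left _ _).trans hn3)
  have hbal := hΩ.approxBalanced hk hkK F (c := p ^ #(orderedEdges F)) hg1 (hρ0 n)
    (by rw [Fintype.card_fin]; exact hg2)
    (by rw [Fintype.card_fin, card_orderedEdges]; exact hg4)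
    (η' := η') (min_le_right _ _) (by rw [Fintype.card_fin]; exact hn1) (by
      have h1 : (m.factorial : ℝ) * (numEdges F * ε) ≤ η' / 2 := by
        calc (m.factorial : ℝ) * (numEdges F * ε) = M * ε := by rw [hM]; ring
          _ ≤ M * (η' / (2 * M)) := by gcongr; exact min_le_right _ _
          _ = η' / 2 := by field_simp
      linarith)
  have hw := hcluster k _ _ _ hbal (by
    rcases hcase with h1 | h1
    · exact Or.inr fun a => by simp [hg3 h1]
    · exact Or.inl (by rw [card_orderedEdges]; exact h1))
  refine (hΩ.abs_sum_adjInd_sub_le (δ := δ / 10) hk hε0.le (by positivity) hp0.le hp1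
    (by convert hw) X Y).trans ?_
  rw [Fintype.card_fin]
  gcongr
  have h1 : ε ≤ δ / 10 := min_le_left _ _
  have h2 : η ≤ δ / 20 := min_le_left _ _
  linarith

/-- **Theorem (Tr).** Let `e(F) > 0`, `0 < p ≤ 1`, `r ≥ m`, `α_i > 0`, `∑ α_i ≤ 1`.
If either `(α₁,…,α_r) ≠ (1/r,…,1/r)`, or `e(F) > 1` and `F` is regular, a star, or
disconnected, then `P̃(F;α₁,…,α_r)` is a `p`-quasi-random property. -/
theorem stmt3 {m r : ℕ} (F : SimpleGraph (Fin m)) (hF : 0 < numEdges F)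
    (p : ℝ) (hp0 : 0 < p) (hp1 : p ≤ 1) (hrm : m ≤ r)
    (α : Fin r → ℝ) (hα : ∀ i, 0 < α i) (hsum : ∑ i, α i ≤ 1)
    (hcase : (α ≠ fun _ => 1 / (r : ℝ)) ∨
      (1 < numEdges F ∧ (IsRegularGraph F ∨ IsStar F ∨ ¬ F.Connected))) :
    ∀ (V : ℕ → ℕ) (G : ∀ n, SimpleGraph (Fin (V n))), Tendsto V atTop atTop →
      (SatisfiesPr F p α V G ↔ IsQuasirandom p V G) := by
  intro V G hV
  refine ⟨fun h => (h.cutSmall hF hp0 hp1 hrm hα hsum (hcase.imp_right And.left) hV).isQuasirandom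
    hp0.le hp1 hV, fun h => (h.cutSmall hp0.le hp1 hV).satisfiesPr F ?_ hp0.le hp1 α hV⟩
  rcases Nat.eq_zero_or_pos m with rfl | hm
  · obtain ⟨e, -⟩ := Finset.card_pos.1 ((card_orderedEdges F).symm ▸ hF)
    exact e.1.elim0
  · exact hm
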